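/- arXiv:2410.04389 — 4 statements merged into one kernel-verified Lean document; each statement's English description precedes it below -/
import Mathlib

section
/- Every bridgeless cubic graph that is not isomorphic to the Petersen graph and that contains a 2-factor (a spanning 2-regular subgraph) with at most two connected components admits a normal 6-edge-coloring, i.e. a proper edge-coloring with at most 6 colors in which every edge is poor or rich. -/
open scoped Classical

/-- The Klein four-group `Z2 × Z2`. -/
abbrev K4 : Type := ZMod 2 × ZMod 2

/-- `α = (1,0)`. -/
def flowAlpha : K4 := (1, 0)

/-- `β = (0,1)`. -/
def flowBeta : K4 := (0, 1)

/-- A graph is bridgeless if no edge is a bridge, i.e. deleting any single edge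
does not increase the number of connected components. -/
def SimpleGraph.Bridgeless {V : Type} (G : SimpleGraph V) : Prop :=
  ∀ e : Sym2 V, ¬ G.IsBridge e

/-- The complementary 2-factor `G − M`: the spanning subgraph of `G` with
edge set `E(G) \ M`. -/
def compl2Factor {V : Type} (G : SimpleGraph V) (M : G.Subgraph) : SimpleGraph V :=
  G.deleteEdges M.edgeSet

/-- A nowhere-zero `Z2 × Z2` flow with respect to a perfect matching `M`, encoded as a
vertex function: `θ v` is the flow value of the unique `M`-edge `e_v` incident to `v`
(so `θ` is constant on the two endpoints of each matching edge, nonzero everywhere,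
and sums to zero over every connected component of `G − M`). -/
def IsNZFlowWrt {V : Type} [Fintype V] (G : SimpleGraph V) (M : G.Subgraph)
    (θ : V → K4) : Prop :=
  (∀ ⦃u v : V⦄, M.Adj u v → θ u = θ v) ∧
  (∀ v : V, θ v ≠ 0) ∧
  (∀ u : V, ∑ v ∈ Finset.univ.filter (fun w => (compl2Factor G M).Reachable u w), θ v = 0)

/-- `θ` is non-conflicting: there is no edge `uv ∈ E(G) \ M` with
`θ(e_u) = α` and `θ(e_v) = β`. -/
def NonConflicting {V : Type} (G : SimpleGraph V) (M : G.Subgraph) (θ : V → K4) : Prop :=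
  ¬ ∃ u v : V, G.Adj u v ∧ ¬ M.Adj u v ∧ θ u = flowAlpha ∧ θ v = flowBeta

/-- The set of colors appearing on the edges incident to `v`. -/
noncomputable def colorsAt {V : Type} [Fintype V] {k : ℕ} (G : SimpleGraph V)
    (c : Sym2 V → Fin k) (v : V) : Finset (Fin k) :=
  (Finset.univ.filter (fun w => G.Adj v w)).image (fun w => c s(v, w))

/-- A proper edge-coloring: edges sharing a vertex receive different colors. -/
def IsProperEdgeColoring {V : Type} {k : ℕ} (G : SimpleGraph V) (c : Sym2 V → Fin k) : Prop :=
  ∀ ⦃u v w : V⦄, G.Adj u v → G.Adj u w → v ≠ w → c s(u, v) ≠ c s(u, w)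

/-- `G` has a normal `k`-edge-coloring: a proper edge-coloring with at most `k` colors
in which every edge `uv` is poor (`|S_c(u) ∪ S_c(v)| = 3`) or rich (`|S_c(u) ∪ S_c(v)| = 5`). -/
def HasNormalColoring {V : Type} [Fintype V] (G : SimpleGraph V) (k : ℕ) : Prop :=
  ∃ c : Sym2 V → Fin k, IsProperEdgeColoring G c ∧
    ∀ ⦃u v : V⦄, G.Adj u v →
      ((colorsAt G c u ∪ colorsAt G c v).card = 3 ∨ (colorsAt G c u ∪ colorsAt G c v).card = 5)

/-- The Petersen graph, as the Kneser graph `K(5,2)`: vertices are the 2-element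
subsets of a 5-element set, adjacent exactly when disjoint. -/
def PetersenGraph : SimpleGraph {s : Finset (Fin 5) // s.card = 2} :=
  SimpleGraph.fromRel (fun a b => Disjoint a.1 b.1)

/-- The two endpoint color sets `A`, `B` make an edge poor or rich. -/
def PoorOrRich (A B : Finset (Fin 6)) : Prop := (A ∪ B).card = 3 ∨ (A ∪ B).card = 5

instance (A B : Finset (Fin 6)) : Decidable (PoorOrRich A B) :=
  inferInstanceAs (Decidable (_ ∨ _))

theorem PoorOrRich.symm {A B : Finset (Fin 6)} (h : PoorOrRich A B) : PoorOrRich B A := by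
  unfold PoorOrRich at *; rwa [Finset.union_comm]

theorem PoorOrRich.self {A : Finset (Fin 6)} (h : A.card = 3) : PoorOrRich A A := by
  left; rwa [Finset.union_self]

/-- The colors at `x` when `f y` colors the edge from `y` to its successor `σ y` and
`g y` colors the matching edge at `y`. -/
def colorTriple {W : Type} (σ : Equiv.Perm W) (f g : W → Fin 6) (x : W) : Finset (Fin 6) :=
  {f x, f (σ.symm x), g x}

/-- A normal coloring of the cubic graph whose edges join `x` to `σ x` and `x` to `μ x`. -/
def NormalModel {W : Type} (σ : Equiv.Perm W) (μ : W → W) : Prop :=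
  ∃ f g : W → Fin 6, (∀ x, g (μ x) = g x) ∧ (∀ x, (colorTriple σ f g x).card = 3) ∧
    (∀ x, PoorOrRich (colorTriple σ f g x) (colorTriple σ f g (σ x))) ∧
    (∀ x, PoorOrRich (colorTriple σ f g x) (colorTriple σ f g (μ x)))

theorem card_triple_eq_three {a b c : Fin 6} :
    ({a, b, c} : Finset (Fin 6)).card = 3 ↔ a ≠ b ∧ a ≠ c ∧ b ≠ c := by
  revert a b c; decide

theorem NormalModel.hasNormalColoring {V W : Type} [Fintype V] {G : SimpleGraph V} (e : W ≃ V)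
    {σ : Equiv.Perm W} {μ : W → W}
    (hadj : ∀ x y, G.Adj (e x) (e y) ↔ y = σ x ∨ x = σ y ∨ y = μ x)
    (hμ : ∀ x, μ (μ x) = x) (hσ : ∀ x, σ x ≠ σ.symm x) (hμσ : ∀ x, μ x ≠ σ x)
    (h : NormalModel σ μ) : HasNormalColoring G 6 := by
  obtain ⟨f, g, hg, h3, hs, hm⟩ := h
  have hμσ' : ∀ x, μ x ≠ σ.symm x := fun x hx => hμσ (μ x) (by rw [hμ, hx]; simp)
  let F : V → V → Fin 6 := fun u v =>
    if e.symm v = σ (e.symm u) then f (e.symm u)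
    else if e.symm u = σ (e.symm v) then f (e.symm v)
    else if e.symm v = μ (e.symm u) then g (e.symm u) else 0
  have hF : ∀ u v, F u v = F v u := by
    intro u v
    simp only [F]
    set x := e.symm u
    set y := e.symm v
    have h1 : ¬ (y = σ x ∧ x = σ y) := by
      rintro ⟨h1, h2⟩
      exact hσ x (by rw [← h1, h2]; simp)
    have h2 : y = μ x ↔ x = μ y :=
      ⟨fun h => by rw [h, hμ], fun h => by rw [h, hμ]⟩
    by_cases a : y = σ x
    · have b : ¬ x = σ y := fun b => h1 ⟨a, b⟩
      rw [if_pos a, if_neg b, if_pos a]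
    · by_cases b : x = σ y
      · rw [if_neg a, if_pos b, if_pos b]
      · by_cases c : y = μ x
        · rw [if_neg a, if_neg b, if_pos c, if_neg b, if_neg a, if_pos (h2.mp c), c, hg]
        · rw [if_neg a, if_neg b, if_neg c, if_neg b, if_neg a, if_neg (fun h => c (h2.mpr h))]
  let c : Sym2 V → Fin 6 := Sym2.lift ⟨F, hF⟩
  have c1 : ∀ x, c s(e x, e (σ x)) = f x := fun x => by
    simp [c, F]
  have c2 : ∀ x, c s(e x, e (σ.symm x)) = f (σ.symm x) := fun x => by
    rw [Sym2.eq_swap]; conv_lhs => rw [← σ.apply_symm_apply x]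
    simpa using c1 (σ.symm x)
  have c3 : ∀ x, c s(e x, e (μ x)) = g x := fun x => by
    have h1 : ¬ x = σ (μ x) := fun h => hμσ' x (by rw [Equiv.eq_symm_apply]; exact h.symm)
    simp [c, F, hμσ x, h1]
  have hcol : ∀ x, colorsAt G c (e x) = colorTriple σ f g x := by
    intro x
    ext k
    simp only [colorsAt, colorTriple, Finset.mem_image, Finset.mem_filter, Finset.mem_univ,
      true_and, Finset.mem_insert, Finset.mem_singleton]
    constructor
    · rintro ⟨w, hw, rfl⟩
      obtain ⟨y, rfl⟩ := e.surjective w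
      rcases (hadj x y).mp hw with rfl | rfl | rfl
      · exact Or.inl (c1 x)
      · right; left
        simpa using c2 (σ y)
      · exact Or.inr (Or.inr (c3 x))
    · rintro (rfl | rfl | rfl)
      · exact ⟨_, (hadj _ _).mpr (Or.inl rfl), c1 x⟩
      · exact ⟨_, (hadj _ _).mpr (Or.inr (Or.inl (by simp))), c2 x⟩
      · exact ⟨_, (hadj _ _).mpr (Or.inr (Or.inr rfl)), c3 x⟩
  refine ⟨c, ?_, ?_⟩
  · intro u v w huv huw hvw
    obtain ⟨x, rfl⟩ := e.surjective u
    obtain ⟨y, rfl⟩ := e.surjective v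
    obtain ⟨z, rfl⟩ := e.surjective w
    obtain ⟨d1, d2, d3⟩ := card_triple_eq_three.mp (h3 x)
    have key : ∀ y, G.Adj (e x) (e y) → (y = σ x ∧ c s(e x, e y) = f x) ∨
        (y = σ.symm x ∧ c s(e x, e y) = f (σ.symm x)) ∨ (y = μ x ∧ c s(e x, e y) = g x) := by
      intro y hy
      rcases (hadj x y).mp hy with rfl | h | rfl
      · exact Or.inl ⟨rfl, c1 x⟩
      · have : y = σ.symm x := by rw [h]; simp
        subst this
        exact Or.inr (Or.inl ⟨rfl, c2 x⟩)
      · exact Or.inr (Or.inr ⟨rfl, c3 x⟩)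
    have hyz : y ≠ z := fun h => hvw (by rw [h])
    rcases key y huv with ⟨a, a'⟩ | ⟨a, a'⟩ | ⟨a, a'⟩ <;>
    rcases key z huw with ⟨b, b'⟩ | ⟨b, b'⟩ | ⟨b, b'⟩ <;>
    first
      | exact absurd (a.trans b.symm) hyz
      | (rw [a', b']; first | assumption | (apply Ne.symm; assumption))
  · intro u v huv
    obtain ⟨x, rfl⟩ := e.surjective u
    obtain ⟨y, rfl⟩ := e.surjective v
    rw [hcol, hcol]
    rcases (hadj x y).mp huv with rfl | rfl | rfl
    · exact hs x
    · exact (hs y).symm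
    · exact hm x

/-- `pos` runs through `X` along the cyclic permutation `σ` of order `n`. -/
structure Track {X : Type} (σ : Equiv.Perm X) (n : ℤ) (pos : ℤ → X) : Prop where
  n_pos : 0 < n
  surj : ∀ x, ∃ i, pos i = x
  inj : ∀ i j, pos i = pos j ↔ n ∣ i - j
  step : ∀ i, pos (i + 1) = σ (pos i)

/-- The vertices strictly between positions `p` and `q`. -/
noncomputable def arc {X : Type} (pos : ℤ → X) (p q : ℤ) : Finset X := (Finset.Ioo p q).image pos

namespace Track

variable {X : Type} {σ : Equiv.Perm X} {n : ℤ} {pos : ℤ → X}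

theorem exists_pos (h : Track σ n pos) (a : ℤ) (x : X) : ∃ i, a ≤ i ∧ i < a + n ∧ pos i = x := by
  obtain ⟨i, rfl⟩ := h.surj x
  have hn := h.n_pos
  refine ⟨a + (i - a) % n, ?_, ?_, ?_⟩
  · have := Int.emod_nonneg (i - a) hn.ne'; omega
  · have := Int.emod_lt_of_pos (i - a) hn; omega
  · rw [h.inj]
    have := Int.mul_ediv_add_emod (i - a) n
    exact ⟨-((i - a) / n), by rw [mul_neg]; omega⟩

theorem inj_of_lt (h : Track σ n pos) {i j : ℤ} (hij : pos i = pos j) (h1 : i - j < n)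
    (h2 : j - i < n) : i = j := by
  rw [h.inj] at hij
  have := Int.eq_zero_of_abs_lt_dvd hij (by rw [abs_lt]; omega)
  omega

theorem pos_add (h : Track σ n pos) (i : ℤ) : pos (i + n) = pos i := by
  rw [h.inj]; simp

theorem pos_symm (h : Track σ n pos) (i : ℤ) : σ.symm (pos i) = pos (i - 1) := by
  rw [Equiv.symm_apply_eq, ← h.step]; simp

theorem shift (h : Track σ n pos) (c : ℤ) : Track σ n (fun i => pos (i + c)) where
  n_pos := h.n_pos
  surj x := by
    obtain ⟨i, rfl⟩ := h.surj x
    exact ⟨i - c, by simp⟩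
  inj i j := by rw [h.inj]; simp
  step i := by rw [← h.step]; congr 1; ring

theorem reflect (h : Track σ n pos) : Track σ⁻¹ n (fun i => pos (-i)) where
  n_pos := h.n_pos
  surj x := by
    obtain ⟨i, rfl⟩ := h.surj x
    exact ⟨-i, by simp⟩
  inj i j := by
    rw [h.inj, ← Int.dvd_neg]; congr! 1; ring
  step i := by
    have := h.pos_symm (-i)
    rw [show -(i + 1) = -i - 1 by ring, ← this]; rfl

theorem sum_image_Ioc (h : Track σ n pos) {A : Type} [AddCommMonoid A] (θ : X → A) {p q : ℤ}
    (hpq : q - p ≤ n) : ∑ x ∈ (Finset.Ioc p q).image pos, θ x =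
      ∑ i ∈ Finset.Ioc p q, θ (pos i) := by
  refine Finset.sum_image ?_
  intro i hi j hj hij
  simp only [Finset.coe_Ioc, Set.mem_Ioc] at hi hj
  exact h.inj_of_lt hij (by omega) (by omega)

theorem sum_arc (h : Track σ n pos) {A : Type} [AddCommMonoid A] (θ : X → A) {p q : ℤ}
    (hpq : q - p ≤ n + 1) : ∑ x ∈ arc pos p q, θ x = ∑ i ∈ Finset.Ioo p q, θ (pos i) := by
  refine Finset.sum_image ?_
  intro i hi j hj hij
  simp only [Finset.coe_Ioo, Set.mem_Ioo] at hi hj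
  exact h.inj_of_lt hij (by omega) (by omega)

theorem card_arc (h : Track σ n pos) {p q : ℤ} (hpq : q - p ≤ n + 1) (hle : p < q) :
    ((arc pos p q).card : ℤ) = q - p - 1 := by
  rw [Finset.card_eq_sum_ones, h.sum_arc _ hpq, ← Finset.card_eq_sum_ones, Int.card_Ioo]
  omega

theorem univ_eq [Fintype X] (h : Track σ n pos) (p : ℤ) :
    Finset.univ = (Finset.Ioc p (p + n)).image pos := by
  ext x
  simp only [Finset.mem_univ, Finset.mem_image, Finset.mem_Ioc, true_iff]
  obtain ⟨i, h1, h2, rfl⟩ := h.exists_pos (p + 1) x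
  exact ⟨i, by omega, rfl⟩

theorem potential_add (h : Track σ n pos) {A : Type} [AddCommGroup A] {f θ : X → A}
    (hf : ∀ x, f (σ x) = f x + θ (σ x)) {p q : ℤ} (hpq : p ≤ q) :
    f (pos q) = f (pos p) + ∑ i ∈ Finset.Ioc p q, θ (pos i) := by
  induction q, hpq using Int.leInduction with
  | base => simp
  | succ q hq ih =>
    rw [h.step, hf, ih, ← h.step, add_assoc, ← Finset.insert_Ioc_right_eq_Ioc_add_one hq,
      Finset.sum_insert (by simp), add_comm (θ _)]

/-- A function with zero sum on a cycle is the increment of a potential. -/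
theorem exists_potential [Fintype X] (h : Track σ n pos) {A : Type} [AddCommGroup A] {θ : X → A}
    (hθ : ∑ x, θ x = 0) : ∃ f : X → A, ∀ x, f (σ x) = f x + θ (σ x) := by
  let F : ℤ → A := fun k => ∑ i ∈ Finset.Ioc 0 k, θ (pos i)
  have hF : ∀ k, 0 ≤ k → F (k + 1) = F k + θ (pos (k + 1)) := fun k hk => by
    simp only [F]
    rw [← Finset.insert_Ioc_right_eq_Ioc_add_one hk, Finset.sum_insert (by simp), add_comm]
  have hn : F n = 0 := by
    simp only [F]
    rw [← h.sum_image_Ioc θ (by omega), ← hθ, h.univ_eq 0, zero_add]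
  choose r hr0 hrn hr using h.exists_pos 0
  refine ⟨fun x => F (r x), fun x => ?_⟩
  have h0 := hr0 x
  have h1 := hrn x
  have h2 := hr0 (σ x)
  have h3 := hrn (σ x)
  have hx : pos (r (σ x)) = pos (r x + 1) := by rw [hr, h.step, hr]
  have hθx : θ (σ x) = θ (pos (r x + 1)) := by rw [h.step, hr]
  simp only
  rw [hθx, ← hF _ h0]
  by_cases hc : r x + 1 < n
  · rw [h.inj_of_lt hx (by omega) (by omega)]
  · have : r x + 1 = n := by omega
    rw [this] at hx ⊢
    rw [hn]
    have : pos (r (σ x)) = pos 0 := by rw [hx, ← h.pos_add 0, zero_add]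
    rw [h.inj_of_lt this (by omega) (by omega)]
    simp [F]

end Track

theorem mem_arc {X : Type} {pos : ℤ → X} {p q : ℤ} {x : X} :
    x ∈ arc pos p q ↔ ∃ i, p < i ∧ i < q ∧ pos i = x := by
  simp [arc, and_assoc]

theorem arc_shift {X : Type} (pos : ℤ → X) (c p q : ℤ) :
    arc (fun i => pos (i + c)) p q = arc pos (p + c) (q + c) := by
  ext x
  simp only [mem_arc]
  constructor
  · rintro ⟨i, h1, h2, h3⟩; exact ⟨i + c, by omega, by omega, h3⟩
  · rintro ⟨i, h1, h2, h3⟩; exact ⟨i - c, by omega, by omega, by simpa using h3⟩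

theorem arc_reflect {X : Type} (pos : ℤ → X) (p q : ℤ) :
    arc (fun i => pos (-i)) p q = arc pos (-q) (-p) := by
  ext x
  simp only [mem_arc]
  constructor
  · rintro ⟨i, h1, h2, h3⟩; exact ⟨-i, by omega, by omega, h3⟩
  · rintro ⟨i, h1, h2, h3⟩; exact ⟨-i, by omega, by omega, by simpa using h3⟩

theorem Track.arc_add {X : Type} {σ : Equiv.Perm X} {n : ℤ} {pos : ℤ → X} (h : Track σ n pos)
    (p q : ℤ) : arc pos (p + n) (q + n) = arc pos p q := by
  rw [← arc_shift]; congr 1; ext i; exact h.pos_add i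

/-- The matching color associated with a flow value. -/
def matchColor (t : K4) : Fin 6 := if t = (1, 1) then 5 else 4

/-- The cycle color associated with a potential. -/
def cycleColor (y : K4) : Fin 6 := ⟨2 * y.1.val + y.2.val, by
  have := y.1.val_lt; have := y.2.val_lt; omega⟩

theorem colorTriple_potential {X : Type} {σ : Equiv.Perm X} {f θ : X → K4} {g : X → Fin 6}
    (hf : ∀ x, f (σ x) = f x + θ (σ x)) (x : X) :
    colorTriple σ (fun x => cycleColor (f x)) g x
      = {cycleColor (f x), cycleColor (f x + θ x), g x} := by
  have : f (σ.symm x) = f x + θ x := by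
    have h1 := hf (σ.symm x)
    rw [Equiv.apply_symm_apply] at h1
    rw [h1, add_assoc, CharTwo.add_self_eq_zero, add_zero]
  simp only [colorTriple, this]

theorem colorTriple_potential_succ {X : Type} {σ : Equiv.Perm X} {f θ : X → K4} {g : X → Fin 6}
    (hf : ∀ x, f (σ x) = f x + θ (σ x)) (x : X) :
    colorTriple σ (fun x => cycleColor (f x)) g (σ x)
      = {cycleColor (f x), cycleColor (f x + θ (σ x)), g (σ x)} := by
  simp only [colorTriple, Equiv.symm_apply_apply, hf, Finset.insert_comm]

theorem card_flow_triple {y t c : K4} (ht : t ≠ 0) :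
    ({cycleColor y, cycleColor (y + t), matchColor c} : Finset (Fin 6)).card = 3 := by
  revert y t c; decide

theorem poorOrRich_flow_edge {y t t' : K4} (ht : t ≠ 0) (ht' : t' ≠ 0)
    (h : ¬ (t = flowAlpha ∧ t' = flowBeta)) (h' : ¬ (t = flowBeta ∧ t' = flowAlpha)) :
    PoorOrRich {cycleColor y, cycleColor (y + t), matchColor t}
      {cycleColor y, cycleColor (y + t'), matchColor t'} := by
  revert y t t'; decide

theorem poorOrRich_flow_match {y y' t c : K4} (ht : t ≠ 0) :
    PoorOrRich {cycleColor y, cycleColor (y + t), matchColor c}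
      {cycleColor y', cycleColor (y' + t), matchColor c} := by
  revert y y' t c; decide

/-- A coloring of a cycle with chords and dangling spokes `S`, normal at every cycle edge and
chord, whose three spokes may be attached to a triangle. -/
def SpokeColoring {X : Type} (σ : Equiv.Perm X) (m : X → X) (S : Finset X) : Prop :=
  ∃ f g : X → Fin 6, (∀ x ∉ S, g (m x) = g x) ∧ (∀ x, (colorTriple σ f g x).card = 3) ∧
    (∀ x, PoorOrRich (colorTriple σ f g x) (colorTriple σ f g (σ x))) ∧
    (∀ x ∉ S, PoorOrRich (colorTriple σ f g x) (colorTriple σ f g (m x))) ∧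
    (S.image g).card = 3 ∧ ∀ x ∈ S, PoorOrRich (colorTriple σ f g x) (S.image g)

theorem SpokeColoring.inv {X : Type} {σ : Equiv.Perm X} {m : X → X} {S : Finset X}
    (h : SpokeColoring σ⁻¹ m S) : SpokeColoring σ m S := by
  obtain ⟨f, g, h1, h2, h3, h4, h5⟩ := h
  have key : ∀ x, colorTriple σ (fun x => f (σ x)) g x = colorTriple σ⁻¹ f g x := fun x => by
    have : (Equiv.symm σ⁻¹) x = σ x := rfl
    simp only [colorTriple, Equiv.apply_symm_apply, this, Finset.insert_comm]
  refine ⟨fun x => f (σ x), g, h1, fun x => by rw [key]; exact h2 x, fun x => ?_,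
    fun x hx => by rw [key, key]; exact h4 x hx, h5.1, fun x hx => by rw [key]; exact h5.2 x hx⟩
  rw [key, key]
  simpa using (h3 (σ x)).symm

/-- The color of the chord or spoke at a vertex with flow value `t`, with `p` the potential
whose color replaces the flow value `α`. -/
def chordColor (p t : K4) : Fin 6 := if t = flowAlpha then cycleColor p else matchColor t

theorem card_chord_triple {y p t : K4} (ht : t ≠ 0)
    (h : t = flowAlpha → y = p + (1, 1) ∨ y = p + (0, 1)) :
    ({cycleColor y, cycleColor (y + t), chordColor p t} : Finset (Fin 6)).card = 3 := by
  revert y p t; decide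

set_option synthInstance.maxSize 2000 in
set_option synthInstance.maxHeartbeats 200000 in
theorem poorOrRich_chord_edge {y p t t' : K4} (ht : t ≠ 0) (ht' : t' ≠ 0)
    (h : t = flowAlpha → y = p + (1, 1) ∨ y = p + (0, 1))
    (h1 : t = flowAlpha → t' = flowAlpha ∨ t' = flowBeta ∧ y = p + (1, 1))
    (h2 : t' = flowAlpha → t = flowAlpha ∨ t = (1, 1) ∧ y = p + (0, 1)) :
    PoorOrRich {cycleColor y, cycleColor (y + t), chordColor p t}
      {cycleColor y, cycleColor (y + t'), chordColor p t'} := by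
  revert y p t t'; decide

theorem poorOrRich_chord {y y' p t : K4} (ht : t ≠ 0)
    (h : t = flowAlpha → y = p + (1, 1) ∨ y = p + (0, 1))
    (h' : t = flowAlpha → y' = p + (1, 1) ∨ y' = p + (0, 1)) :
    PoorOrRich {cycleColor y, cycleColor (y + t), chordColor p t}
      {cycleColor y', cycleColor (y' + t), chordColor p t} := by
  revert y y' p t; decide

theorem poorOrRich_spoke {y p t : K4} (ht : t ≠ 0) (h : p ≠ y) (h' : p ≠ y + t) :
    PoorOrRich {cycleColor y, cycleColor (y + t), chordColor p t} {cycleColor p, 4, 5} := by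
  revert y p t; decide

/-- An odd cycle with three spokes at positions `0`, `P`, `Q`, chords `m`, and `k` parallel chords
around the spoke at position `0`. -/
structure Config {X : Type} (σ : Equiv.Perm X) (n : ℤ) (pos : ℤ → X) (P Q k : ℤ) (m : X → X) :
    Prop where
  track : Track σ n pos
  odd : Odd n
  hk : 0 ≤ k
  hP : k + 1 < P
  hQ : P + 1 < Q
  hn : Q + k + 1 < n
  rung : ∀ i, 0 < i → i ≤ k → m (pos i) = pos (-i)
  mate : ∀ x ∉ ({pos 0, pos P, pos Q} : Finset X), m x ∉ ({pos 0, pos P, pos Q} : Finset X)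
  invol : ∀ x ∉ ({pos 0, pos P, pos Q} : Finset X), m (m x) = x
  ne : ∀ x ∉ ({pos 0, pos P, pos Q} : Finset X), m x ≠ x

/-- The indicator of `A` with values in `ZMod 2`. -/
noncomputable def ind {X : Type} (A : Finset X) (x : X) : ZMod 2 := if x ∈ A then 1 else 0

/-- The parity of the number of ends of the chord at `x` which lie in `A`. -/
noncomputable def cross {X : Type} (m : X → X) (A : Finset X) (x : X) : ZMod 2 :=
  ind A x + ind A (m x)

namespace Config

variable {X : Type} {σ : Equiv.Perm X} {n : ℤ} {pos : ℤ → X} {P Q k : ℤ} {m : X → X}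

theorem reflect_spokes (h : Config σ n pos P Q k m) :
    ({pos (-0), pos (-(n - Q)), pos (-(n - P))} : Finset X) = {pos 0, pos P, pos Q} := by
  rw [show -(n - Q) = Q - n by ring, show -(n - P) = P - n by ring,
    ← h.track.pos_add (Q - n), ← h.track.pos_add (P - n)]
  simp only [sub_add_cancel, neg_zero, Finset.pair_comm]

theorem reflect (h : Config σ n pos P Q k m) :
    Config σ⁻¹ n (fun i => pos (-i)) (n - Q) (n - P) k m := by
  have hS := h.reflect_spokes
  have h1 := h.hP
  have h2 := h.hQ
  have h3 := h.hn
  have h0 := h.hk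
  refine ⟨h.track.reflect, h.odd, h.hk, by omega, by omega, by omega, ?_, ?_, ?_, ?_⟩
  · intro i hi hik
    have := h.rung i hi hik
    have hx : pos i ∉ ({pos 0, pos P, pos Q} : Finset X) := by
      simp only [Finset.mem_insert, Finset.mem_singleton, not_or]
      refine ⟨fun e => ?_, fun e => ?_, fun e => ?_⟩ <;>
      · have := h.track.inj_of_lt e (by omega) (by omega); omega
    rw [← this, h.invol _ hx, neg_neg]
  · rw [hS]; exact h.mate
  · rw [hS]; exact h.invol
  · rw [hS]; exact h.ne

theorem rotate_spokes (h : Config σ n pos P Q k m) :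
    ({pos (0 + P), pos (Q - P + P), pos (n - P + P)} : Finset X) = {pos 0, pos P, pos Q} := by
  rw [← h.track.pos_add 0]
  simp only [sub_add_cancel, zero_add]
  ext x; simp only [Finset.mem_insert, Finset.mem_singleton]; tauto

theorem rotate (h : Config σ n pos P Q 0 m) :
    Config σ n (fun i => pos (i + P)) (Q - P) (n - P) 0 m := by
  have hS := h.rotate_spokes
  have h1 := h.hP
  have h2 := h.hQ
  have h3 := h.hn
  refine ⟨h.track.shift P, h.odd, h.hk, by omega, by omega, by omega, ?_, ?_, ?_, ?_⟩
  · intro i hi hik; omega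
  · rw [hS]; exact h.mate
  · rw [hS]; exact h.invol
  · rw [hS]; exact h.ne

end Config

theorem card_spoke_colors (p : K4) : ({cycleColor p, 4, 5} : Finset (Fin 6)).card = 3 := by
  revert p; decide

theorem chordColor_values (p : K4) :
    ({chordColor p flowAlpha, chordColor p flowBeta, chordColor p (1, 1)} : Finset (Fin 6))
      = {cycleColor p, 4, 5} := by
  revert p; decide

theorem spokeColoring_of_flow {X : Type} {σ : Equiv.Perm X} {m : X → X} {S : Finset X}
    {f θ : X → K4} (p : K4) (hf : ∀ x, f (σ x) = f x + θ (σ x)) (h0 : ∀ x, θ x ≠ 0)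
    (hm : ∀ x ∉ S, θ (m x) = θ x)
    (hα : ∀ x, θ x = flowAlpha → f x = p + (1, 1) ∨ f x = p + (0, 1))
    (h1 : ∀ x, θ x = flowAlpha →
      θ (σ x) = flowAlpha ∨ θ (σ x) = flowBeta ∧ f x = p + (1, 1))
    (h2 : ∀ x, θ (σ x) = flowAlpha → θ x = flowAlpha ∨ θ x = (1, 1) ∧ f x = p + (0, 1))
    (hS : S.image θ = {flowAlpha, flowBeta, (1, 1)})
    (hp : ∀ x ∈ S, p ≠ f x ∧ p ≠ f x + θ x) : SpokeColoring σ m S := by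
  have hT : ∀ x, colorTriple σ (fun x => cycleColor (f x)) (fun x => chordColor p (θ x)) x
      = {cycleColor (f x), cycleColor (f x + θ x), chordColor p (θ x)} :=
    fun x => colorTriple_potential hf x
  have hW : S.image (fun x => chordColor p (θ x)) = {cycleColor p, 4, 5} := by
    rw [show (fun x => chordColor p (θ x)) = chordColor p ∘ θ from rfl, ← Finset.image_image, hS]
    simp only [Finset.image_insert, Finset.image_singleton, chordColor_values]
  refine ⟨fun x => cycleColor (f x), fun x => chordColor p (θ x),
    fun x hx => by simp only [hm x hx],
    fun x => ?_, fun x => ?_, fun x hx => ?_, ?_, fun x hx => ?_⟩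
  · rw [hT]; exact card_chord_triple (h0 x) (hα x)
  · rw [hT, colorTriple_potential_succ hf]
    exact poorOrRich_chord_edge (h0 x) (h0 _) (hα x) (h1 x) (h2 x)
  · rw [hT, hT, hm x hx]
    exact poorOrRich_chord (h0 x) (hα x) (by rw [← hm x hx]; exact hα (m x))
  · rw [hW]; exact card_spoke_colors p
  · rw [hT, hW]; exact poorOrRich_spoke (h0 x) (hp x hx).1 (hp x hx).2

theorem sum_eq_zero_of_mate {X A : Type} [Fintype X] [AddCommGroup A] (hA : ∀ a : A, a + a = 0)
    {m : X → X} {S : Finset X} {θ : X → A} (hmS : ∀ x ∉ S, m x ∉ S) (hmm : ∀ x ∉ S, m (m x) = x)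
    (hne : ∀ x ∉ S, m x ≠ x) (hm : ∀ x ∉ S, θ (m x) = θ x) (hS : ∑ x ∈ S, θ x = 0) :
    ∑ x, θ x = 0 := by
  rw [← Finset.sum_add_sum_compl S, hS, zero_add]
  refine Finset.sum_involution (fun x _ => m x) ?_ ?_ ?_ ?_
  · intro x hx; rw [hm x (Finset.mem_compl.mp hx), hA]
  · intro x hx _; exact hne x (Finset.mem_compl.mp hx)
  · intro x hx; exact Finset.mem_compl.mpr (hmS x (Finset.mem_compl.mp hx))
  · intro x hx; exact hmm x (Finset.mem_compl.mp hx)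

/-- The parity of the number of elements of `B` in `A`. -/
noncomputable def parity {X : Type} (A B : Finset X) : ZMod 2 := ∑ x ∈ B, ind A x

theorem sum_ite_mem_const {X : Type} (A B : Finset X) :
    ∑ x ∈ A, (if x ∈ B then flowBeta else (1, 1) : K4)
      = (A.card : ZMod 2) • ((1, 1) : K4) + parity A B • flowAlpha := by
  have h1 : ∀ x, (if x ∈ B then flowBeta else (1, 1) : K4) = (1, 1) + ind B x • flowAlpha := by
    intro x
    unfold ind
    split_ifs <;> decide
  simp_rw [h1]
  rw [Finset.sum_add_distrib, Finset.sum_const, Nat.cast_smul_eq_nsmul, ← Finset.sum_smul]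
  congr 2
  simp only [parity, ind, Finset.sum_ite_mem, Finset.sum_const]
  rw [Finset.inter_comm]

theorem nsmul_flowAlpha (c : ℕ) : c • flowAlpha = if Odd c then flowAlpha else 0 := by
  have h2 : (2 : ℕ) • flowAlpha = 0 := by decide
  split_ifs with h
  · obtain ⟨d, rfl⟩ := h
    rw [add_smul, mul_comm, mul_smul, h2, smul_zero, zero_add, one_smul]
  · obtain ⟨d, rfl⟩ := Nat.not_odd_iff_even.mp h
    rw [← two_mul, mul_comm, mul_smul, h2, smul_zero]

theorem K4.cases_of_add_flowAlpha (c x y : K4) (h : x = y + c) (hc : c = flowAlpha ∨ c = 0) :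
    y = x + (1, 1) + (1, 1) ∨ y = x + (1, 1) + (0, 1) := by
  revert c x y; decide

theorem Ioc_sub_one_eq_Ioo (p q : ℤ) : Finset.Ioc p (q - 1) = Finset.Ioo p q := by
  ext; simp only [Finset.mem_Ioc, Finset.mem_Ioo]; omega

namespace Config

variable {X : Type} {σ : Equiv.Perm X} {n : ℤ} {pos : ℤ → X} {P Q k : ℤ} {m : X → X}

theorem mate_mem_block (h : Config σ n pos P Q k m) {x : X}
    (hx : x ∉ ({pos 0, pos P, pos Q} : Finset X)) (hb : x ∈ arc pos (-k - 1) (k + 1)) :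
    m x ∈ arc pos (-k - 1) (k + 1) := by
  obtain ⟨i, h1, h2, rfl⟩ := mem_arc.mp hb
  have hi : i ≠ 0 := by rintro rfl; simp at hx
  rcases lt_or_gt_of_ne hi with hi | hi
  · have := h.rung (-i) (by omega) (by omega)
    rw [neg_neg] at this
    have h3 : pos (-i) ∉ ({pos 0, pos P, pos Q} : Finset X) := by
      have h1 := h.hP
      have h2 := h.hQ
      have h3 := h.hn
      simp only [Finset.mem_insert, Finset.mem_singleton, not_or]
      refine ⟨fun e => ?_, fun e => ?_, fun e => ?_⟩ <;>
      · have := h.track.inj_of_lt e (by omega) (by omega); omega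
    rw [← this, h.invol _ h3]
    exact mem_arc.mpr ⟨-i, by omega, by omega, rfl⟩
  · rw [h.rung i hi (by omega)]
    exact mem_arc.mpr ⟨-i, by omega, by omega, rfl⟩

theorem spokeColoring_aux [Fintype X] (h : Config σ n pos P Q k m) {B : Finset X} {r s : ℤ}
    (hB : B ⊆ arc pos k P ∪ arc pos P Q ∪ arc pos Q (n - k)) (hmB : ∀ x ∈ B, m x ∈ B)
    (ha : pos (k + 1) ∈ B) (hb : pos (-(k + 1)) ∉ B) (hr : r = P ∧ s = Q ∨ r = Q ∧ s = P)
    {Θ₁ Θ₂ : K4} (h1 : ∑ x ∈ arc pos k P, (if x ∈ B then flowBeta else (1, 1) : K4) = Θ₁)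
    (h2 : ∑ x ∈ arc pos P Q, (if x ∈ B then flowBeta else (1, 1) : K4) = Θ₂)
    (hP : ∀ t, t = (if r = P then flowBeta else (1, 1) : K4) → Θ₁ ≠ (1, 1) ∧ Θ₁ + t ≠ (1, 1) ∧
      Θ₁ + t + Θ₂ ≠ (1, 1) ∧ Θ₁ + Θ₂ + flowAlpha ≠ (1, 1)) :
    SpokeColoring σ m {pos 0, pos P, pos Q} := by
  have hk := h.hk
  have hkP := h.hP
  have hPQ := h.hQ
  have hQn := h.hn
  have hne : ∀ i j, i ≠ j → i - j < n → j - i < n → pos i ≠ pos j := fun i j hij h1 h2 e =>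
    hij (h.track.inj_of_lt e h1 h2)
  have hbl : ∀ i, k < i → i < n - k → pos i ∉ arc pos (-k - 1) (k + 1) := by
    intro i h1 h2 hi
    obtain ⟨j, h3, h4, h5⟩ := mem_arc.mp hi
    exact hne j i (by omega) (by omega) (by omega) h5
  have hBarc : ∀ x ∈ B, ∃ i, k < i ∧ i < n - k ∧ i ≠ P ∧ i ≠ Q ∧ pos i = x := by
    intro x hx
    have := hB hx
    simp only [Finset.mem_union, mem_arc] at this
    rcases this with (⟨i, h1, h2, h3⟩ | ⟨i, h1, h2, h3⟩) | ⟨i, h1, h2, h3⟩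
    · exact ⟨i, by omega, by omega, by omega, by omega, h3⟩
    · exact ⟨i, by omega, by omega, by omega, by omega, h3⟩
    · exact ⟨i, by omega, by omega, by omega, by omega, h3⟩
  have hBS : ∀ x ∈ B, x ∉ ({pos 0, pos P, pos Q} : Finset X) := by
    intro x hx
    obtain ⟨i, h1, h2, h3, h4, rfl⟩ := hBarc x hx
    simp only [Finset.mem_insert, Finset.mem_singleton, not_or]
    exact ⟨hne _ _ (by omega) (by omega) (by omega), hne _ _ (by omega) (by omega) (by omega),
      hne _ _ (by omega) (by omega) (by omega)⟩
  have hrS : pos r ∈ ({pos 0, pos P, pos Q} : Finset X) := by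
    rcases hr with ⟨rfl, rfl⟩ | ⟨rfl, rfl⟩ <;> simp
  set θ : X → K4 := fun x => if x ∈ arc pos (-k - 1) (k + 1) then flowAlpha
    else if x ∈ B ∨ x = pos r then flowBeta else (1, 1) with hθ
  have hθα : ∀ x, θ x = flowAlpha ↔ x ∈ arc pos (-k - 1) (k + 1) := by
    intro x
    simp only [hθ]
    split_ifs with h1 h2
    · simp [h1]
    · simp only [h1, iff_false]; decide
    · simp only [h1, iff_false]; decide
  have h0 : ∀ x, θ x ≠ 0 := by
    intro x
    simp only [hθ]
    split_ifs <;> decide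
  have hm : ∀ x ∉ ({pos 0, pos P, pos Q} : Finset X), θ (m x) = θ x := by
    intro x hx
    have e1 : m x ∈ arc pos (-k - 1) (k + 1) ↔ x ∈ arc pos (-k - 1) (k + 1) := by
      refine ⟨fun h' => ?_, h.mate_mem_block hx⟩
      have := h.mate_mem_block (h.mate x hx) h'
      rwa [h.invol x hx] at this
    have e2 : m x ∈ B ↔ x ∈ B := by
      refine ⟨fun h' => ?_, hmB x⟩
      have := hmB _ h'
      rwa [h.invol x hx] at this
    have e3 : m x ≠ pos r := fun e => h.mate x hx (e ▸ hrS)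
    have e4 : x ≠ pos r := fun e => hx (e ▸ hrS)
    simp only [hθ, e1, e2, e3, e4]
  have t0 : θ (pos 0) = flowAlpha := (hθα _).mpr (mem_arc.mpr ⟨0, by omega, by omega, rfl⟩)
  have tarc : ∀ i, k < i → i < n - k → i ≠ P → i ≠ Q →
      θ (pos i) = if pos i ∈ B then flowBeta else (1, 1) := by
    intro i h1 h2 h3 h4
    have : pos i ≠ pos r := hne _ _ (by omega) (by omega) (by omega)
    simp only [hθ, hbl i h1 h2, if_false, this, or_false]
  have hPB : pos P ∉ B := fun hx => hBS _ hx (by simp)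
  have hQB : pos Q ∉ B := fun hx => hBS _ hx (by simp)
  have tP : θ (pos P) = if r = P then flowBeta else (1, 1) := by
    simp only [hθ, hbl P (by omega) (by omega), if_false, hPB, false_or]
    rcases hr with ⟨rfl, rfl⟩ | ⟨rfl, rfl⟩
    · simp
    · rw [if_neg (hne _ _ (by omega) (by omega) (by omega)), if_neg (by omega)]
  have tQ : θ (pos Q) = if r = P then (1, 1) else flowBeta := by
    simp only [hθ, hbl Q (by omega) (by omega), if_false, hQB, false_or]
    rcases hr with ⟨rfl, rfl⟩ | ⟨rfl, rfl⟩
    · rw [if_neg (hne _ _ (by omega) (by omega) (by omega)), if_pos rfl]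
    · rw [if_pos rfl, if_neg (by omega)]
  have hsum : ∑ x, θ x = 0 := by
    refine sum_eq_zero_of_mate CharTwo.add_self_eq_zero h.mate h.invol h.ne hm ?_
    rw [Finset.sum_insert, Finset.sum_insert, Finset.sum_singleton, t0, tP, tQ]
    · split_ifs <;> decide
    · simp only [Finset.mem_singleton]; exact hne _ _ (by omega) (by omega) (by omega)
    · simp only [Finset.mem_insert, Finset.mem_singleton, not_or]
      exact ⟨hne _ _ (by omega) (by omega) (by omega), hne _ _ (by omega) (by omega) (by omega)⟩
  obtain ⟨f, hf⟩ := h.track.exists_potential hsum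
  have hrun : ∀ i, -k - 1 ≤ i → i ≤ k → f (pos k) = f (pos i) + (k - i).toNat • flowAlpha := by
    intro i h1 h2
    rw [h.track.potential_add hf h2]
    congr 1
    rw [Finset.sum_congr rfl (g := fun _ => flowAlpha), Finset.sum_const, Int.card_Ioc]
    intro j hj
    rw [Finset.mem_Ioc] at hj
    exact (hθα _).mpr (mem_arc.mpr ⟨j, by omega, by omega, rfl⟩)
  have hfa : ∀ x, θ x = flowAlpha →
      f x = f (pos k) + (1, 1) + (1, 1) ∨ f x = f (pos k) + (1, 1) + (0, 1) := by
    intro x hx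
    obtain ⟨i, h1, h2, rfl⟩ := mem_arc.mp ((hθα x).mp hx)
    refine K4.cases_of_add_flowAlpha _ _ _ (hrun i (by omega) (by omega)) ?_
    rw [nsmul_flowAlpha]
    split_ifs <;> simp
  have s1 : f (pos (P - 1)) = f (pos k) + Θ₁ := by
    rw [h.track.potential_add hf (p := k) (by omega), Ioc_sub_one_eq_Ioo,
      ← h1, h.track.sum_arc _ (by omega)]
    congr 1
    refine Finset.sum_congr rfl fun i hi => ?_
    rw [Finset.mem_Ioo] at hi
    exact tarc i (by omega) (by omega) (by omega) (by omega)
  have s2 : f (pos (Q - 1)) = f (pos P) + Θ₂ := by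
    rw [h.track.potential_add hf (p := P) (by omega), Ioc_sub_one_eq_Ioo,
      ← h2, h.track.sum_arc _ (by omega)]
    congr 1
    refine Finset.sum_congr rfl fun i hi => ?_
    rw [Finset.mem_Ioo] at hi
    exact tarc i (by omega) (by omega) (by omega) (by omega)
  have s3 : f (pos P) = f (pos (P - 1)) + θ (pos P) := by
    have := hf (pos (P - 1))
    rwa [← h.track.step, sub_add_cancel] at this
  have s4 : f (pos Q) = f (pos (Q - 1)) + θ (pos Q) := by
    have := hf (pos (Q - 1))
    rwa [← h.track.step, sub_add_cancel] at this
  refine spokeColoring_of_flow (f (pos k) + (1, 1)) hf h0 hm hfa ?_ ?_ ?_ ?_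
  · intro x hx
    obtain ⟨i, h1, h2, rfl⟩ := mem_arc.mp ((hθα x).mp hx)
    by_cases hi : i = k
    · right
      subst hi
      rw [← h.track.step, tarc _ (by omega) (by omega) (by omega) (by omega), if_pos ha]
      refine ⟨rfl, ?_⟩
      rw [add_assoc, CharTwo.add_self_eq_zero, add_zero]
    · left
      rw [← h.track.step, hθα]
      exact mem_arc.mpr ⟨i + 1, by omega, by omega, rfl⟩
  · intro x hx
    obtain ⟨i, h1, h2, h3⟩ := mem_arc.mp ((hθα _).mp hx)
    have hx' : x = pos (i - 1) := by rw [← h.track.pos_symm, h3, Equiv.symm_apply_apply]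
    subst hx'
    by_cases hi : i = -k
    · right
      have e : i - 1 = -(k + 1) := by omega
      rw [e]
      constructor
      · have e2 : pos (-(k + 1)) = pos (n - k - 1) := by
          rw [← h.track.pos_add]; congr 1; ring
        rw [e2] at hb ⊢
        rw [tarc _ (by omega) (by omega) (by omega) (by omega), if_neg hb]
      · have := hrun (-(k + 1)) (by omega) (by omega)
        rw [nsmul_flowAlpha, if_pos ⟨k.toNat, by omega⟩] at this
        rw [this]
        generalize f (pos (-(k + 1))) = y
        revert y; decide
    · left
      rw [hθα]
      exact mem_arc.mpr ⟨i - 1, by omega, by omega, rfl⟩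
  · simp only [Finset.image_insert, Finset.image_singleton, t0, tP, tQ]
    split_ifs
    · rfl
    · rw [Finset.pair_comm]
  · obtain ⟨p1, p2, p3, p4⟩ := hP _ rfl
    rw [← tP] at p2 p3
    have tPQ : θ (pos P) + θ (pos Q) = flowAlpha := by
      rw [tP, tQ]; split_ifs <;> decide
    intro x hx
    simp only [Finset.mem_insert, Finset.mem_singleton] at hx
    rcases hx with rfl | rfl | rfl
    · rw [t0]
      have := hfa _ t0
      generalize f (pos 0) = y at *
      generalize f (pos k) = z at *
      clear * - this
      revert y z; decide
    · rw [s3, s1]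
      generalize θ (pos P) = t at *
      generalize f (pos k) = z at *
      clear * - p1 p2
      revert Θ₁ t z; decide
    · rw [s4, s2, s3, s1]
      rw [← tPQ] at p4
      generalize θ (pos P) = t at *
      generalize θ (pos Q) = t' at *
      generalize f (pos k) = z at *
      clear * - p3 p4
      constructor
      · intro e
        apply p4
        have := congrArg (z + ·) e
        simp only [← add_assoc, show z + z = 0 from CharTwo.add_self_eq_zero z, zero_add] at this
        rw [this]; abel
      · intro e
        apply p3
        have := congrArg (z + ·) e
        simp only [← add_assoc, show z + z = 0 from CharTwo.add_self_eq_zero z, zero_add] at this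
        rw [this, add_assoc _ t' t', CharTwo.add_self_eq_zero, add_zero]

end Config

/-- The parities of a chord set meeting the first and second arc for which the flow lemma applies,
when the first and third arc have lengths of parity `l` and `l'`. -/
def GoodParity (l l' c₁ c₂ : ZMod 2) : Prop := c₁ = 1 ∧ c₂ = l' ∨ c₁ = l ∧ c₂ = l

/-- The vertices on the three arcs between the spokes, outside the block of parallel chords. -/
noncomputable def outer {X : Type} (pos : ℤ → X) (n P Q k : ℤ) : Finset X :=
  arc pos k P ∪ arc pos P Q ∪ arc pos Q (n - k)

theorem flow_parity_first {l l' c c' : ZMod 2} (h : c = 1 ∧ c' = l') :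
    ∀ t : K4, t = (1, 1) → l • ((1, 1) : K4) + c • flowAlpha ≠ (1, 1) ∧
      l • ((1, 1) : K4) + c • flowAlpha + t ≠ (1, 1) ∧
      l • ((1, 1) : K4) + c • flowAlpha + t + ((l + l') • (1, 1) + c' • flowAlpha) ≠ (1, 1) ∧
      l • ((1, 1) : K4) + c • flowAlpha + ((l + l') • (1, 1) + c' • flowAlpha) + flowAlpha
        ≠ (1, 1) := by
  rintro t rfl
  obtain ⟨rfl, rfl⟩ := h
  revert l c'; decide

theorem flow_parity_second {l l' c c' : ZMod 2} (h : c = l ∧ c' = l) :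
    ∀ t : K4, t = flowBeta → l • ((1, 1) : K4) + c • flowAlpha ≠ (1, 1) ∧
      l • ((1, 1) : K4) + c • flowAlpha + t ≠ (1, 1) ∧
      l • ((1, 1) : K4) + c • flowAlpha + t + ((l + l') • (1, 1) + c' • flowAlpha) ≠ (1, 1) ∧
      l • ((1, 1) : K4) + c • flowAlpha + ((l + l') • (1, 1) + c' • flowAlpha) + flowAlpha
        ≠ (1, 1) := by
  rintro t rfl
  rw [h.1, h.2]
  clear h
  revert l l'; decide

theorem parity_pair {X : Type} (A : Finset X) {x y : X} (hxy : x ≠ y) :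
    parity A {x, y} = ind A x + ind A y := Finset.sum_pair hxy

namespace Config

variable {X : Type} {σ : Equiv.Perm X} {n : ℤ} {pos : ℤ → X} {P Q k : ℤ} {m : X → X}

theorem card_arc_cast (h : Config σ n pos P Q k m) {p q : ℤ} (hpq : q - p ≤ n + 1) (hle : p < q) :
    ((arc pos p q).card : ZMod 2) = ((q - p - 1 : ℤ) : ZMod 2) := by
  rw [← h.track.card_arc hpq hle, Int.cast_natCast]

theorem length_second (h : Config σ n pos P Q k m) :
    ((Q - P - 1 : ℤ) : ZMod 2) = ((P - k - 1 : ℤ) : ZMod 2) + ((n - k - Q - 1 : ℤ) : ZMod 2) := by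
  rw [← Int.cast_add, ZMod.intCast_eq_intCast_iff_dvd_sub]
  obtain ⟨d, hd⟩ := h.odd
  push_cast
  omega

theorem spokeColoring_of_goodParity [Fintype X] (h : Config σ n pos P Q k m) {B : Finset X}
    (hB : B ⊆ outer pos n P Q k) (hmB : ∀ x ∈ B, m x ∈ B)
    (ha : pos (k + 1) ∈ B) (hb : pos (-(k + 1)) ∉ B)
    (hgood : GoodParity ((P - k - 1 : ℤ) : ZMod 2) ((n - k - Q - 1 : ℤ) : ZMod 2)
      (parity (arc pos k P) B) (parity (arc pos P Q) B)) :
    SpokeColoring σ m {pos 0, pos P, pos Q} := by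
  have hk := h.hk
  have hkP := h.hP
  have hPQ := h.hQ
  have hQn := h.hn
  have e1 := sum_ite_mem_const (arc pos k P) B
  have e2 := sum_ite_mem_const (arc pos P Q) B
  rw [h.card_arc_cast (by omega) (by omega)] at e1 e2
  rw [h.length_second] at e2
  rcases hgood with hg | hg
  · refine h.spokeColoring_aux hB hmB ha hb (Or.inr ⟨rfl, rfl⟩) e1 e2 ?_
    rw [if_neg (by omega)]
    exact flow_parity_first hg
  · refine h.spokeColoring_aux hB hmB ha hb (Or.inl ⟨rfl, rfl⟩) e1 e2 ?_
    rw [if_pos rfl]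
    exact flow_parity_second hg

theorem pos_ne (h : Config σ n pos P Q k m) {i j : ℤ} (hij : i ≠ j) (h1 : i - j < n)
    (h2 : j - i < n) : pos i ≠ pos j := fun e => hij (h.track.inj_of_lt e h1 h2)

theorem mem_outer (h : Config σ n pos P Q k m) {x : X} :
    x ∈ outer pos n P Q k ↔ x ∉ ({pos 0, pos P, pos Q} : Finset X) ∧
      x ∉ arc pos (-k - 1) (k + 1) := by
  have hk := h.hk
  have hkP := h.hP
  have hPQ := h.hQ
  have hQn := h.hn
  constructor
  · intro hx
    obtain ⟨i, h1, h2, h3, h4, rfl⟩ : ∃ i, k < i ∧ i < n - k ∧ i ≠ P ∧ i ≠ Q ∧ pos i = x := by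
      simp only [outer, Finset.mem_union, mem_arc] at hx
      rcases hx with (⟨i, h1, h2, h3⟩ | ⟨i, h1, h2, h3⟩) | ⟨i, h1, h2, h3⟩
      · exact ⟨i, by omega, by omega, by omega, by omega, h3⟩
      · exact ⟨i, by omega, by omega, by omega, by omega, h3⟩
      · exact ⟨i, by omega, by omega, by omega, by omega, h3⟩
    constructor
    · simp only [Finset.mem_insert, Finset.mem_singleton, not_or]
      exact ⟨h.pos_ne (by omega) (by omega) (by omega), h.pos_ne (by omega) (by omega) (by omega),
        h.pos_ne (by omega) (by omega) (by omega)⟩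
    · intro hi
      obtain ⟨j, h3, h4, h5⟩ := mem_arc.mp hi
      exact h.pos_ne (by omega) (by omega) (by omega) h5
  · rintro ⟨hS, hb⟩
    obtain ⟨i, h1, h2, rfl⟩ := h.track.exists_pos (-k) x
    have hi : k < i := by
      by_contra hc
      exact hb (mem_arc.mpr ⟨i, by omega, by omega, rfl⟩)
    have hiP : i ≠ P := by rintro rfl; simp at hS
    have hiQ : i ≠ Q := by rintro rfl; simp at hS
    simp only [outer, Finset.mem_union, mem_arc]
    rcases lt_or_gt_of_ne hiP with h3 | h3
    · exact Or.inl (Or.inl ⟨i, by omega, by omega, rfl⟩)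
    · rcases lt_or_gt_of_ne hiQ with h4 | h4
      · exact Or.inl (Or.inr ⟨i, by omega, by omega, rfl⟩)
      · exact Or.inr ⟨i, by omega, by omega, rfl⟩

theorem outer_mate (h : Config σ n pos P Q k m) {x : X} (hx : x ∈ outer pos n P Q k) :
    m x ∈ outer pos n P Q k ∧ m (m x) = x ∧ m x ≠ x := by
  rw [h.mem_outer] at *
  refine ⟨⟨h.mate x hx.1, fun hb => ?_⟩, h.invol x hx.1, h.ne x hx.1⟩
  have := h.mate_mem_block (h.mate x hx.1) hb
  rw [h.invol x hx.1] at this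
  exact hx.2 this

theorem first_mem (h : Config σ n pos P Q k m) : pos (k + 1) ∈ outer pos n P Q k := by
  have := h.hP
  simp only [outer, Finset.mem_union]
  exact Or.inl (Or.inl (mem_arc.mpr ⟨k + 1, by omega, by omega, rfl⟩))

theorem last_eq (h : Config σ n pos P Q k m) : pos (-(k + 1)) = pos (n - k - 1) := by
  rw [← h.track.pos_add]; congr 1; ring

theorem last_mem (h : Config σ n pos P Q k m) : pos (-(k + 1)) ∈ outer pos n P Q k := by
  have := h.hn
  rw [h.last_eq]
  simp only [outer, Finset.mem_union]
  exact Or.inr (mem_arc.mpr ⟨n - k - 1, by omega, by omega, rfl⟩)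

theorem first_ne_last (h : Config σ n pos P Q k m) : pos (k + 1) ≠ pos (-(k + 1)) := by
  have hk := h.hk
  have hkP := h.hP
  have hPQ := h.hQ
  have hQn := h.hn
  rw [h.last_eq]
  exact h.pos_ne (by omega) (by omega) (by omega)

theorem first_chord_good [Fintype X] (h : Config σ n pos P Q k m)
    (hab : m (pos (k + 1)) ≠ pos (-(k + 1)))
    (hgood : GoodParity ((P - k - 1 : ℤ) : ZMod 2) ((n - k - Q - 1 : ℤ) : ZMod 2)
      (cross m (arc pos k P) (pos (k + 1))) (cross m (arc pos P Q) (pos (k + 1)))) :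
    SpokeColoring σ m {pos 0, pos P, pos Q} := by
  obtain ⟨h1, h2, h3⟩ := h.outer_mate h.first_mem
  refine h.spokeColoring_of_goodParity (B := {pos (k + 1), m (pos (k + 1))}) ?_ ?_ ?_ ?_ ?_
  · intro x hx
    simp only [Finset.mem_insert, Finset.mem_singleton] at hx
    rcases hx with rfl | rfl
    · exact h.first_mem
    · exact h1
  · intro x hx
    simp only [Finset.mem_insert, Finset.mem_singleton] at hx ⊢
    rcases hx with rfl | rfl
    · right; rfl
    · left; exact h2
  · simp
  · simp only [Finset.mem_insert, Finset.mem_singleton, not_or]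
    exact ⟨h.first_ne_last.symm, hab.symm⟩
  · rwa [parity_pair _ h3.symm, parity_pair _ h3.symm]

theorem two_chords_good [Fintype X] (h : Config σ n pos P Q k m)
    (hab : m (pos (k + 1)) ≠ pos (-(k + 1))) {d : X} (hd : d ∈ outer pos n P Q k)
    (hda : d ≠ pos (k + 1)) (hda' : d ≠ m (pos (k + 1)))
    (hdb : d ≠ pos (-(k + 1))) (hdb' : d ≠ m (pos (-(k + 1))))
    (hgood : GoodParity ((P - k - 1 : ℤ) : ZMod 2) ((n - k - Q - 1 : ℤ) : ZMod 2)
      (cross m (arc pos k P) (pos (k + 1)) + cross m (arc pos k P) d)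
      (cross m (arc pos P Q) (pos (k + 1)) + cross m (arc pos P Q) d)) :
    SpokeColoring σ m {pos 0, pos P, pos Q} := by
  obtain ⟨h1, h2, h3⟩ := h.outer_mate h.first_mem
  obtain ⟨h4, h5, h6⟩ := h.outer_mate hd
  obtain ⟨-, h7, -⟩ := h.outer_mate h.last_mem
  have hda2 : m d ≠ m (pos (k + 1)) := fun e => hda (by rw [← h5, e, h2])
  have hda3 : m d ≠ pos (k + 1) := fun e => hda' (by rw [← e, h5])
  have hdb3 : m d ≠ pos (-(k + 1)) := fun e => hdb' (by rw [← e, h5])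
  have hpar : ∀ A : Finset X, parity A {pos (k + 1), m (pos (k + 1)), d, m d}
      = cross m A (pos (k + 1)) + cross m A d := by
    intro A
    rw [parity, Finset.sum_insert, Finset.sum_insert, Finset.sum_pair h6.symm, cross, cross,
      add_assoc]
    · simp only [Finset.mem_insert, Finset.mem_singleton, not_or]
      exact ⟨hda'.symm, hda2.symm⟩
    · simp only [Finset.mem_insert, Finset.mem_singleton, not_or]
      exact ⟨h3.symm, hda.symm, hda3.symm⟩
  refine h.spokeColoring_of_goodParity (B := {pos (k + 1), m (pos (k + 1)), d, m d}) ?_ ?_ ?_ ?_ ?_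
  · intro x hx
    simp only [Finset.mem_insert, Finset.mem_singleton] at hx
    rcases hx with rfl | rfl | rfl | rfl
    · exact h.first_mem
    · exact h1
    · exact hd
    · exact h4
  · intro x hx
    simp only [Finset.mem_insert, Finset.mem_singleton] at hx ⊢
    rcases hx with rfl | rfl | rfl | rfl
    · right; left; rfl
    · left; exact h2
    · right; right; right; rfl
    · right; right; left; exact h5
  · simp
  · simp only [Finset.mem_insert, Finset.mem_singleton, not_or]
    exact ⟨h.first_ne_last.symm, hab.symm, hdb.symm, hdb3.symm⟩
  · rwa [hpar, hpar]

end Config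

theorem ZMod.two_cases (c : ZMod 2) : c = 0 ∨ c = 1 := by revert c; decide

namespace Config

variable {X : Type} {σ : Equiv.Perm X} {n : ℤ} {pos : ℤ → X} {P Q k : ℤ} {m : X → X}

theorem reflect_arc_first (h : Config σ n pos P Q k m) :
    arc (fun i => pos (-i)) k (n - Q) = arc pos Q (n - k) := by
  rw [arc_reflect, ← h.track.arc_add]; congr 1 <;> ring

theorem reflect_arc_second (h : Config σ n pos P Q k m) :
    arc (fun i => pos (-i)) (n - Q) (n - P) = arc pos P Q := by
  rw [arc_reflect, ← h.track.arc_add]; congr 1 <;> ring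

theorem reflect_arc_third (h : Config σ n pos P Q k m) :
    arc (fun i => pos (-i)) (n - P) (n - k) = arc pos k P := by
  rw [arc_reflect, ← h.track.arc_add]; congr 1 <;> ring

theorem reflect_outer (h : Config σ n pos P Q k m) :
    outer (fun i => pos (-i)) n (n - Q) (n - P) k = outer pos n P Q k := by
  rw [outer, h.reflect_arc_first, h.reflect_arc_second, h.reflect_arc_third, outer,
    Finset.union_right_comm, Finset.union_comm (arc pos Q _), Finset.union_right_comm]

theorem mate_first_ne_last_iff (h : Config σ n pos P Q k m) :
    m (pos (k + 1)) ≠ pos (-(k + 1)) ↔ m (pos (-(k + 1))) ≠ pos (k + 1) := by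
  have h1 := (h.outer_mate h.first_mem).2.1
  have h2 := (h.outer_mate h.last_mem).2.1
  exact not_congr ⟨fun e => by rw [← e, h1], fun e => by rw [← e, h2]⟩

theorem spokeColoring_of_reflect (h : Config σ n pos P Q k m)
    (hc : SpokeColoring σ⁻¹ m {pos (-0), pos (-(n - Q)), pos (-(n - P))}) :
    SpokeColoring σ m {pos 0, pos P, pos Q} := by
  rw [h.reflect_spokes] at hc
  exact hc.inv

theorem last_chord_good [Fintype X] (h : Config σ n pos P Q k m)
    (hab : m (pos (k + 1)) ≠ pos (-(k + 1)))
    (hgood : GoodParity ((n - k - Q - 1 : ℤ) : ZMod 2) ((P - k - 1 : ℤ) : ZMod 2)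
      (cross m (arc pos Q (n - k)) (pos (-(k + 1)))) (cross m (arc pos P Q) (pos (-(k + 1))))) :
    SpokeColoring σ m {pos 0, pos P, pos Q} := by
  refine h.spokeColoring_of_reflect (h.reflect.first_chord_good ?_ ?_)
  · rw [neg_neg]; exact h.mate_first_ne_last_iff.mp hab
  · rw [h.reflect_arc_first, h.reflect_arc_second]
    convert hgood using 3 <;> ring

theorem two_chords_good_last [Fintype X] (h : Config σ n pos P Q k m)
    (hab : m (pos (k + 1)) ≠ pos (-(k + 1))) {d : X} (hd : d ∈ outer pos n P Q k)
    (hda : d ≠ pos (k + 1)) (hda' : d ≠ m (pos (k + 1)))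
    (hdb : d ≠ pos (-(k + 1))) (hdb' : d ≠ m (pos (-(k + 1))))
    (hgood : GoodParity ((n - k - Q - 1 : ℤ) : ZMod 2) ((P - k - 1 : ℤ) : ZMod 2)
      (cross m (arc pos Q (n - k)) (pos (-(k + 1))) + cross m (arc pos Q (n - k)) d)
      (cross m (arc pos P Q) (pos (-(k + 1))) + cross m (arc pos P Q) d)) :
    SpokeColoring σ m {pos 0, pos P, pos Q} := by
  refine h.spokeColoring_of_reflect (h.reflect.two_chords_good (d := d) ?_ ?_ ?_ ?_ ?_ ?_ ?_)
  · rw [neg_neg]; exact h.mate_first_ne_last_iff.mp hab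
  · rwa [h.reflect_outer]
  · exact hdb
  · exact hdb'
  · rwa [neg_neg]
  · rwa [neg_neg]
  · rw [h.reflect_arc_first, h.reflect_arc_second]
    convert hgood using 3 <;> ring

theorem mem_arc_iff (h : Config σ n pos P Q k m) {p q i : ℤ} (h1 : i < p + n) (h2 : q - n < i) :
    pos i ∈ arc pos p q ↔ p < i ∧ i < q := by
  rw [mem_arc]
  constructor
  · rintro ⟨j, h3, h4, h5⟩
    have := h.track.inj_of_lt h5 (by omega) (by omega)
    omega
  · rintro ⟨h3, h4⟩
    exact ⟨i, h3, h4, rfl⟩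

theorem ind_arc {p q i : ℤ} (h1 : p < i) (h2 : i < q) : ind (arc pos p q) (pos i) = 1 :=
  if_pos (mem_arc.mpr ⟨i, h1, h2, rfl⟩)

theorem ind_arc_eq_zero (h : Config σ n pos P Q k m) {p q i : ℤ} (h1 : i < p + n)
    (h2 : q - n < i) (h3 : i ≤ p ∨ q ≤ i) : ind (arc pos p q) (pos i) = 0 := by
  refine if_neg ?_
  rw [h.mem_arc_iff h1 h2]
  omega

theorem ind_add (h : Config σ n pos P Q k m) {x : X} (hx : x ∈ outer pos n P Q k) :
    ind (arc pos k P) x = 1 ∧ ind (arc pos P Q) x = 0 ∧ ind (arc pos Q (n - k)) x = 0 ∨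
    ind (arc pos k P) x = 0 ∧ ind (arc pos P Q) x = 1 ∧ ind (arc pos Q (n - k)) x = 0 ∨
    ind (arc pos k P) x = 0 ∧ ind (arc pos P Q) x = 0 ∧ ind (arc pos Q (n - k)) x = 1 := by
  have hk := h.hk
  have hkP := h.hP
  have hPQ := h.hQ
  have hQn := h.hn
  simp only [outer, Finset.mem_union, mem_arc] at hx
  rcases hx with (⟨i, h1, h2, rfl⟩ | ⟨i, h1, h2, rfl⟩) | ⟨i, h1, h2, rfl⟩
  · exact Or.inl ⟨ind_arc h1 h2, h.ind_arc_eq_zero (by omega) (by omega) (by omega),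
      h.ind_arc_eq_zero (by omega) (by omega) (by omega)⟩
  · exact Or.inr (Or.inl ⟨h.ind_arc_eq_zero (by omega) (by omega) (by omega), ind_arc h1 h2,
      h.ind_arc_eq_zero (by omega) (by omega) (by omega)⟩)
  · exact Or.inr (Or.inr ⟨h.ind_arc_eq_zero (by omega) (by omega) (by omega),
      h.ind_arc_eq_zero (by omega) (by omega) (by omega), ind_arc h1 h2⟩)

theorem cross_add (h : Config σ n pos P Q k m) {x : X} (hx : x ∈ outer pos n P Q k) :
    cross m (arc pos k P) x + cross m (arc pos P Q) x + cross m (arc pos Q (n - k)) x = 0 := by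
  simp only [cross]
  rcases h.ind_add hx with ⟨h1, h2, h3⟩ | ⟨h1, h2, h3⟩ | ⟨h1, h2, h3⟩ <;>
  rcases h.ind_add (h.outer_mate hx).1 with ⟨h4, h5, h6⟩ | ⟨h4, h5, h6⟩ | ⟨h4, h5, h6⟩ <;>
  rw [h1, h2, h3, h4, h5, h6] <;> decide

theorem cross_mate (h : Config σ n pos P Q k m) {x : X} (hx : x ∈ outer pos n P Q k)
    (A : Finset X) : cross m A (m x) = cross m A x := by
  rw [cross, cross, (h.outer_mate hx).2.1, add_comm]

theorem ind_first (h : Config σ n pos P Q k m) : ind (arc pos k P) (pos (k + 1)) = 1 :=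
  if_pos (mem_arc.mpr ⟨k + 1, by omega, h.hP, rfl⟩)

theorem ind_last (h : Config σ n pos P Q k m) : ind (arc pos Q (n - k)) (pos (-(k + 1))) = 1 := by
  have := h.hn
  rw [h.last_eq]
  exact if_pos (mem_arc.mpr ⟨n - k - 1, by omega, by omega, rfl⟩)

theorem cross_first (h : Config σ n pos P Q k m) :
    ¬ (cross m (arc pos P Q) (pos (k + 1)) = 1 ∧
      cross m (arc pos Q (n - k)) (pos (k + 1)) = 1) := by
  have h0 := h.ind_first
  simp only [cross]
  rcases h.ind_add h.first_mem with ⟨h1, h2, h3⟩ | ⟨h1, h2, h3⟩ | ⟨h1, h2, h3⟩ <;>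
  rcases h.ind_add (h.outer_mate h.first_mem).1 with ⟨h4, h5, h6⟩ | ⟨h4, h5, h6⟩ | ⟨h4, h5, h6⟩ <;>
  · rw [h1] at h0; rw [h2, h3, h5, h6]; revert h0; decide

theorem cross_last (h : Config σ n pos P Q k m) :
    ¬ (cross m (arc pos k P) (pos (-(k + 1))) = 1 ∧
      cross m (arc pos P Q) (pos (-(k + 1))) = 1) := by
  have h0 := h.ind_last
  simp only [cross]
  rcases h.ind_add h.last_mem with ⟨h1, h2, h3⟩ | ⟨h1, h2, h3⟩ | ⟨h1, h2, h3⟩ <;>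
  rcases h.ind_add (h.outer_mate h.last_mem).1 with ⟨h4, h5, h6⟩ | ⟨h4, h5, h6⟩ | ⟨h4, h5, h6⟩ <;>
  · rw [h3] at h0; rw [h1, h2, h4, h5]; revert h0; decide

/-- The chord at `x` is neither the chord at `pos (k + 1)` nor the one at `pos (-(k + 1))`. -/
def Apart (pos : ℤ → X) (k : ℤ) (m : X → X) (x : X) : Prop :=
  x ≠ pos (k + 1) ∧ x ≠ m (pos (k + 1)) ∧ x ≠ pos (-(k + 1)) ∧ x ≠ m (pos (-(k + 1)))

theorem apart_of_cross (h : Config σ n pos P Q k m) {x : X}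
    (h1 : ∃ A, cross m A x ≠ cross m A (pos (k + 1)))
    (h2 : ∃ A, cross m A x ≠ cross m A (pos (-(k + 1)))) : Apart pos k m x := by
  obtain ⟨A, hA⟩ := h1
  obtain ⟨B, hB⟩ := h2
  refine ⟨?_, ?_, ?_, ?_⟩
  · rintro rfl; exact hA rfl
  · rintro rfl; exact hA (h.cross_mate h.first_mem A)
  · rintro rfl; exact hB rfl
  · rintro rfl; exact hB (h.cross_mate h.last_mem B)

theorem even_even_obstruction [Fintype X] (h : Config σ n pos P Q k m)
    (hc : ¬ SpokeColoring σ m {pos 0, pos P, pos Q}) (hab : m (pos (k + 1)) ≠ pos (-(k + 1)))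
    (h1 : ((P - k - 1 : ℤ) : ZMod 2) = 0) (h3 : ((n - k - Q - 1 : ℤ) : ZMod 2) = 0) :
    cross m (arc pos P Q) (pos (k + 1)) = 1 ∧ cross m (arc pos P Q) (pos (-(k + 1))) = 1 ∧
      ∀ x ∈ outer pos n P Q k, Apart pos k m x → cross m (arc pos P Q) x = 0 := by
  have ha := fun g => hc (h.first_chord_good hab g)
  have hb := fun g => hc (h.last_chord_good hab g)
  rw [h1, h3] at ha hb
  have ha' : cross m (arc pos P Q) (pos (k + 1)) = 1 := by
    generalize cross m (arc pos k P) _ = u at ha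
    generalize cross m (arc pos P Q) _ = v at ha ⊢
    unfold GoodParity at ha
    clear * - ha
    revert u v; decide
  refine ⟨ha', ?_, fun x hx hx' => ?_⟩
  · generalize cross m (arc pos Q _) _ = u at hb
    generalize cross m (arc pos P Q) _ = v at hb ⊢
    unfold GoodParity at hb
    clear * - hb
    revert u v; decide
  · have := fun g => hc (h.two_chords_good hab hx hx'.1 hx'.2.1 hx'.2.2.1 hx'.2.2.2 g)
    rw [h1, h3, ha'] at this
    generalize cross m _ _ + cross m _ _ = u at this
    generalize cross m (arc pos P Q) _ = v at this ⊢
    unfold GoodParity at this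
    clear * - this
    revert u v; decide

theorem even_odd_obstruction [Fintype X] (h : Config σ n pos P Q k m)
    (hc : ¬ SpokeColoring σ m {pos 0, pos P, pos Q}) (hab : m (pos (k + 1)) ≠ pos (-(k + 1)))
    (h1 : ((P - k - 1 : ℤ) : ZMod 2) = 0) (h3 : ((n - k - Q - 1 : ℤ) : ZMod 2) = 1) :
    cross m (arc pos Q (n - k)) (pos (k + 1)) = 1 ∧
      cross m (arc pos Q (n - k)) (pos (-(k + 1))) = 0 ∧
      ∀ x ∈ outer pos n P Q k, Apart pos k m x → cross m (arc pos Q (n - k)) x = 0 := by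
  have ha := fun g => hc (h.first_chord_good hab g)
  have hb := fun g => hc (h.last_chord_good hab g)
  have hsa := h.cross_add h.first_mem
  rw [h1, h3] at ha hb
  unfold GoodParity at ha hb
  refine ⟨?_, ?_, fun x hx hx' => ?_⟩
  · clear * - ha hsa
    generalize cross m (arc pos k P) _ = u at *
    generalize cross m (arc pos P Q) _ = v at *
    generalize cross m (arc pos Q _) _ = w at *
    revert u v w; decide
  · generalize cross m (arc pos P Q) (pos (-(k + 1))) = v at *
    generalize cross m (arc pos Q _) (pos (-(k + 1))) = w at *
    clear * - hb
    revert v w; decide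
  · have := fun g => hc (h.two_chords_good hab hx hx'.1 hx'.2.1 hx'.2.2.1 hx'.2.2.2 g)
    have hsx := h.cross_add hx
    rw [h1, h3] at this
    unfold GoodParity at this
    generalize cross m (arc pos k P) (pos (k + 1)) = u at *
    generalize cross m (arc pos P Q) (pos (k + 1)) = v at *
    generalize cross m (arc pos Q _) (pos (k + 1)) = w at *
    generalize cross m (arc pos k P) x = u' at *
    generalize cross m (arc pos P Q) x = v' at *
    generalize cross m (arc pos Q _) x = w' at *
    clear * - ha hsa this hsx
    revert u v w u' v' w'; decide

set_option synthInstance.maxSize 2000 in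
set_option synthInstance.maxHeartbeats 400000 in
theorem odd_odd_coloring [Fintype X] (h : Config σ n pos P Q k m)
    (hab : m (pos (k + 1)) ≠ pos (-(k + 1)))
    (h1 : ((P - k - 1 : ℤ) : ZMod 2) = 1) (h3 : ((n - k - Q - 1 : ℤ) : ZMod 2) = 1)
    {x y : X} (hx : x ∈ outer pos n P Q k) (hy : y ∈ outer pos n P Q k)
    (hx₁ : cross m (arc pos k P) x = 1) (hx₂ : cross m (arc pos P Q) x = 1)
    (hy₂ : cross m (arc pos P Q) y = 1) (hy₃ : cross m (arc pos Q (n - k)) y = 1) :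
    SpokeColoring σ m {pos 0, pos P, pos Q} := by
  by_contra hc
  have ha := fun g => hc (h.first_chord_good hab g)
  have hb := fun g => hc (h.last_chord_good hab g)
  have hsa := h.cross_add h.first_mem
  have hsb := h.cross_add h.last_mem
  have hsx := h.cross_add hx
  have hsy := h.cross_add hy
  have hfa := h.cross_first
  have hfb := h.cross_last
  have hax := fun hx' : Apart pos k m x => fun g =>
    hc (h.two_chords_good hab hx hx'.1 hx'.2.1 hx'.2.2.1 hx'.2.2.2 g)
  have hay := fun hx' : Apart pos k m y => fun g =>
    hc (h.two_chords_good hab hy hx'.1 hx'.2.1 hx'.2.2.1 hx'.2.2.2 g)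
  have hby := fun hx' : Apart pos k m y => fun g =>
    hc (h.two_chords_good_last hab hy hx'.1 hx'.2.1 hx'.2.2.1 hx'.2.2.2 g)
  have apx : ∀ A B, cross m A x ≠ cross m A (pos (k + 1)) →
    cross m B x ≠ cross m B (pos (-(k + 1))) → Apart pos k m x :=
    fun A B hA hB => h.apart_of_cross ⟨A, hA⟩ ⟨B, hB⟩
  have apy : ∀ A B, cross m A y ≠ cross m A (pos (k + 1)) →
    cross m B y ≠ cross m B (pos (-(k + 1))) → Apart pos k m y :=
    fun A B hA hB => h.apart_of_cross ⟨A, hA⟩ ⟨B, hB⟩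
  have apx1 := apx (arc pos P Q) (arc pos k P)
  have apx2 := apx (arc pos P Q) (arc pos P Q)
  have apy1 := apy (arc pos P Q) (arc pos P Q)
  rw [h1, h3] at ha hb
  rw [h1, h3] at hax hay hby
  unfold GoodParity at ha hb hax hay hby
  rw [hx₁, hx₂] at hsx
  rw [hy₂, hy₃] at hsy
  rw [hx₁, hx₂] at hax
  rw [hy₂] at hay
  rw [hy₂, hy₃] at hby
  rw [hx₁, hx₂] at apx1
  rw [hx₂] at apx2
  rw [hy₂] at apy1
  generalize cross m (arc pos k P) (pos (k + 1)) = u at *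
  generalize cross m (arc pos P Q) (pos (k + 1)) = v at *
  generalize cross m (arc pos Q _) (pos (k + 1)) = w at *
  generalize cross m (arc pos k P) (pos (-(k + 1))) = u' at *
  generalize cross m (arc pos P Q) (pos (-(k + 1))) = v' at *
  generalize cross m (arc pos Q _) (pos (-(k + 1))) = w' at *
  generalize cross m (arc pos k P) y = y₁ at *
  clear * - ha hb hsa hsb hsy hfa hfb hax hay hby apx1 apx2 apy1
  generalize Apart pos k m x = p at *
  generalize Apart pos k m y = q at *
  by_cases hp : p <;> by_cases hq : q <;>
    simp only [hp, hq, forall_true_left, imp_false, false_imp_iff] at * <;>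
    revert u v w u' v' w' y₁ <;> decide

end Config

namespace Config

variable {X : Type} {σ : Equiv.Perm X} {n : ℤ} {pos : ℤ → X} {P Q k : ℤ} {m : X → X}

theorem even_even_crossing [Fintype X] (h : Config σ n pos P Q k m)
    (hc : ¬ SpokeColoring σ m {pos 0, pos P, pos Q}) (hab : m (pos (k + 1)) ≠ pos (-(k + 1)))
    (h1 : ((P - k - 1 : ℤ) : ZMod 2) = 0) (h3 : ((n - k - Q - 1 : ℤ) : ZMod 2) = 0)
    {x : X} (hx : x ∈ outer pos n P Q k) (hcr : cross m (arc pos P Q) x = 1) :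
    x = pos (k + 1) ∨ x = pos (-(k + 1)) ∨ m x = pos (k + 1) ∨ m x = pos (-(k + 1)) := by
  by_contra hne
  simp only [not_or] at hne
  have := (h.even_even_obstruction hc hab h1 h3).2.2 x hx ⟨hne.1, fun e => ?_, hne.2.1, fun e => ?_⟩
  · rw [hcr] at this; exact one_ne_zero this
  · exact hne.2.2.1 (by rw [e, (h.outer_mate h.first_mem).2.1])
  · exact hne.2.2.2 (by rw [e, (h.outer_mate h.last_mem).2.1])

theorem even_odd_crossing [Fintype X] (h : Config σ n pos P Q k m)
    (hc : ¬ SpokeColoring σ m {pos 0, pos P, pos Q}) (hab : m (pos (k + 1)) ≠ pos (-(k + 1)))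
    (h1 : ((P - k - 1 : ℤ) : ZMod 2) = 0) (h3 : ((n - k - Q - 1 : ℤ) : ZMod 2) = 1)
    {x : X} (hx : x ∈ outer pos n P Q k) (hcr : cross m (arc pos Q (n - k)) x = 1) :
    x = pos (k + 1) ∨ m x = pos (k + 1) := by
  have ho := h.even_odd_obstruction hc hab h1 h3
  by_contra hne
  simp only [not_or] at hne
  have := ho.2.2 x hx ⟨hne.1, fun e => ?_, fun e => ?_, fun e => ?_⟩
  · rw [hcr] at this; exact one_ne_zero this
  · exact hne.2 (by rw [e, (h.outer_mate h.first_mem).2.1])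
  · rw [e, ho.2.1] at hcr; exact zero_ne_one hcr
  · rw [e, h.cross_mate h.last_mem, ho.2.1] at hcr; exact zero_ne_one hcr

theorem before_second (h : Config σ n pos P Q k m) : pos (P - 1) ∈ outer pos n P Q k := by
  have := h.hP
  exact Finset.mem_union_left _
    (Finset.mem_union_left _ (mem_arc.mpr ⟨P - 1, by omega, by omega, rfl⟩))

theorem after_second (h : Config σ n pos P Q k m) : pos (P + 1) ∈ outer pos n P Q k := by
  have := h.hQ
  exact Finset.mem_union_left _
    (Finset.mem_union_right _ (mem_arc.mpr ⟨P + 1, by omega, by omega, rfl⟩))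

theorem before_third (h : Config σ n pos P Q k m) : pos (Q - 1) ∈ outer pos n P Q k := by
  have := h.hQ
  exact Finset.mem_union_left _
    (Finset.mem_union_right _ (mem_arc.mpr ⟨Q - 1, by omega, by omega, rfl⟩))

theorem after_third (h : Config σ n pos P Q k m) : pos (Q + 1) ∈ outer pos n P Q k := by
  have := h.hn
  exact Finset.mem_union_right _ (mem_arc.mpr ⟨Q + 1, by omega, by omega, rfl⟩)

theorem mate_eq_comm (h : Config σ n pos P Q k m) {x y : X} (hx : x ∈ outer pos n P Q k)
    (e : m x = y) : m y = x := by
  rw [← e, (h.outer_mate hx).2.1]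

theorem cast_even {i : ℤ} (hi : Even i) : ((i : ℤ) : ZMod 2) = 0 := by
  rwa [ZMod.intCast_zmod_eq_zero_iff_dvd, Nat.cast_two, ← even_iff_two_dvd]

theorem cast_odd {i : ℤ} (hi : Odd i) : ((i : ℤ) : ZMod 2) = 1 := by
  obtain ⟨j, rfl⟩ := hi
  push_cast
  rw [show (2 : ZMod 2) = 0 from rfl, zero_mul, zero_add]

theorem cross_third_second (h : Config σ n pos P Q k m) (h3 : m (pos (Q - 1)) = pos (Q + 1)) :
    cross m (arc pos P Q) (pos (Q - 1)) = 1 ∧ cross m (arc pos Q (n - k)) (pos (Q - 1)) = 1 := by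
  have hk := h.hk
  have hkP := h.hP
  have hPQ := h.hQ
  have hQn := h.hn
  rw [cross, cross, h3, ind_arc (by omega) (by omega),
    h.ind_arc_eq_zero (by omega) (by omega) (by omega),
    h.ind_arc_eq_zero (by omega) (by omega) (by omega), ind_arc (by omega) (by omega)]
  decide

theorem cross_first_second (h : Config σ n pos P Q k m) (h2 : m (pos (P - 1)) = pos (P + 1)) :
    cross m (arc pos k P) (pos (P - 1)) = 1 ∧ cross m (arc pos P Q) (pos (P - 1)) = 1 := by
  have hk := h.hk
  have hkP := h.hP
  have hPQ := h.hQ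
  have hQn := h.hn
  rw [cross, cross, h2, ind_arc (by omega) (by omega),
    h.ind_arc_eq_zero (by omega) (by omega) (by omega),
    h.ind_arc_eq_zero (by omega) (by omega) (by omega), ind_arc (by omega) (by omega)]
  decide

theorem spokeColoring_of_even_odd_block [Fintype X] (h : Config σ n pos P Q k m)
    (hab : m (pos (k + 1)) ≠ pos (-(k + 1))) (h3 : m (pos (Q - 1)) = pos (Q + 1))
    (h1 : Even (P - k - 1)) (h2 : Odd (n - k - Q - 1)) :
    SpokeColoring σ m {pos 0, pos P, pos Q} := by
  have hk := h.hk
  have hkP := h.hP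
  have hPQ := h.hQ
  have hQn := h.hn
  by_contra hc
  rcases h.even_odd_crossing hc hab (cast_even h1) (cast_odd h2) h.before_third
    (h.cross_third_second h3).2 with e | e
  · exact h.pos_ne (by omega) (by omega) (by omega) e
  · rw [h3] at e
    exact h.pos_ne (by omega) (by omega) (by omega) e

theorem exists_maximal_block (h : Config σ n pos P Q 0 m)
    (h2 : m (pos (P - 1)) = pos (P + 1)) (h3 : m (pos (Q - 1)) = pos (Q + 1)) :
    ∃ k, Config σ n pos P Q k m ∧ m (pos (k + 1)) ≠ pos (-(k + 1)) := by
  by_contra! hcon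
  have key : ∀ k : ℕ, Config σ n pos P Q k m := by
    intro k
    induction k with
    | zero => exact h
    | succ k ih =>
      have hr := hcon k ih
      have hk := ih.hk
      have hkP := ih.hP
      have hPQ := ih.hQ
      have hQn := ih.hn
      refine ⟨h.track, h.odd, by omega, ?_, hPQ, ?_, ?_, h.mate, h.invol, h.ne⟩
      · by_contra hlt
        have e : P - 1 = k + 1 := by push_cast at hlt; omega
        rw [e, hr, ih.last_eq] at h2
        exact ih.pos_ne (by omega) (by omega) (by omega) h2
      · by_contra hlt
        have e : Q + 1 = n - k - 1 := by push_cast at hlt; omega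
        rw [e, ← ih.last_eq, ← hr] at h3
        have h4 := (ih.outer_mate ih.before_third).2.1
        rw [h3, (ih.outer_mate ih.first_mem).2.1] at h4
        exact ih.pos_ne (by omega) (by omega) (by omega) h4
      · intro i hi hik
        by_cases e : i ≤ k
        · exact ih.rung i hi e
        · have : i = k + 1 := by push_cast at hik; omega
          rw [this, hr]
  have h4 := (key P.toNat).hP
  have := Int.self_le_toNat P
  omega

/-- The case in which every spoke lies on a triangle with its two neighbors on the cycle. -/
theorem spokeColoring_of_triangles [Fintype X] (h : Config σ n pos P Q 0 m)
    (h2 : m (pos (P - 1)) = pos (P + 1)) (h3 : m (pos (Q - 1)) = pos (Q + 1)) :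
    SpokeColoring σ m {pos 0, pos P, pos Q} := by
  obtain ⟨k, h, hab⟩ := h.exists_maximal_block h2 h3
  have hk := h.hk
  have hkP := h.hP
  have hPQ := h.hQ
  have hQn := h.hn
  rcases Int.even_or_odd (P - k - 1) with p1 | p1 <;>
    rcases Int.even_or_odd (n - k - Q - 1) with p3 | p3
  · by_contra hc
    have hp : P - 1 ≠ k + 1 := by
      obtain ⟨d, hd⟩ := p1; omega
    have hl := h.last_eq
    rcases h.even_even_crossing hc hab (cast_even p1) (cast_even p3) h.before_second
      (h.cross_first_second h2).2 with e | e | e | e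
    · exact h.pos_ne hp (by omega) (by omega) e
    · rw [hl] at e
      exact h.pos_ne (by omega) (by omega) (by omega) e
    · rw [h2] at e
      exact h.pos_ne (by omega) (by omega) (by omega) e
    · rw [hl, h2] at e
      exact h.pos_ne (by omega) (by omega) (by omega) e
  · exact h.spokeColoring_of_even_odd_block hab h3 p1 p3
  · refine h.spokeColoring_of_reflect (h.reflect.spokeColoring_of_even_odd_block ?_ ?_ ?_ ?_)
    · rw [neg_neg]; exact h.mate_first_ne_last_iff.mp hab
    · have e1 : pos (-(n - P - 1)) = pos (P + 1) := by
        rw [← h.track.pos_add]; congr 1; ring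
      have e2 : pos (-(n - P + 1)) = pos (P - 1) := by
        rw [← h.track.pos_add]; congr 1; ring
      rw [e1, e2]
      exact h.mate_eq_comm h.before_second h2
    · convert p3 using 1; ring
    · convert p1 using 1; ring
  · exact h.odd_odd_coloring hab (cast_odd p1) (cast_odd p3) h.before_second h.before_third
      (h.cross_first_second h2).1 (h.cross_first_second h2).2 (h.cross_third_second h3).1
      (h.cross_third_second h3).2

end Config

namespace Config

variable {X : Type} {σ : Equiv.Perm X} {n : ℤ} {pos : ℤ → X} {P Q k : ℤ} {m : X → X}

theorem rotate_arc_first : arc (fun i => pos (i + P)) 0 (Q - P) = arc pos P Q := by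
  rw [arc_shift]; congr 1 <;> ring

theorem rotate_arc_second : arc (fun i => pos (i + P)) (Q - P) (n - P) = arc pos Q (n - 0) := by
  rw [arc_shift]; congr 1 <;> ring

theorem rotate_arc_third (h : Config σ n pos P Q k m) :
    arc (fun i => pos (i + P)) (n - P) (n - 0) = arc pos 0 P := by
  rw [arc_shift, ← h.track.arc_add 0 P]; congr 1 <;> ring

theorem rotate_outer (h : Config σ n pos P Q 0 m) :
    outer (fun i => pos (i + P)) n (Q - P) (n - P) 0 = outer pos n P Q 0 := by
  rw [outer, rotate_arc_first, rotate_arc_second, h.rotate_arc_third, outer,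
    Finset.union_comm, ← Finset.union_assoc]

theorem spokeColoring_of_rotate (h : Config σ n pos P Q k m)
    (hc : SpokeColoring σ m {pos (0 + P), pos (Q - P + P), pos (n - P + P)}) :
    SpokeColoring σ m {pos 0, pos P, pos Q} := by
  rwa [h.rotate_spokes] at hc

theorem mate_mem_of_cross {p q : ℤ} {x : X}
    (h0 : ind (arc pos p q) x = 0) (h1 : cross m (arc pos p q) x = 1) :
    ind (arc pos p q) (m x) = 1 := by
  rwa [cross, h0, zero_add] at h1

theorem even_odd_first [Fintype X] (h : Config σ n pos P Q 0 m)
    (hc : ¬ SpokeColoring σ m {pos 0, pos P, pos Q}) (h1 : Even (P - 1)) (h3 : Odd (n - Q - 1)) :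
    cross m (arc pos Q (n - 0)) (pos 1) = 1 ∧ (m (pos 1) = pos (-1) ∨
      ∀ x ∈ outer pos n P Q 0, cross m (arc pos Q (n - 0)) x = 1 → x = pos 1 ∨ m x = pos 1) := by
  have hkP := h.hP
  have hPQ := h.hQ
  have hQn := h.hn
  have e1 : ((P - 0 - 1 : ℤ) : ZMod 2) = 0 := by rw [sub_zero]; exact cast_even h1
  have e3 : ((n - 0 - Q - 1 : ℤ) : ZMod 2) = 1 := by rw [sub_zero]; exact cast_odd h3
  by_cases hT : m (pos 1) = pos (-1)
  · refine ⟨?_, Or.inl hT⟩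
    have : pos (-1) = pos (n - 1) := by rw [← h.track.pos_add]; congr 1; ring
    rw [cross, hT, this, h.ind_arc_eq_zero (by omega) (by omega) (by omega),
      ind_arc (by omega) (by omega), zero_add]
  · exact ⟨(h.even_odd_obstruction hc hT e1 e3).1,
      Or.inr fun x hx hcr => h.even_odd_crossing hc hT e1 e3 hx hcr⟩

theorem even_odd_second [Fintype X] (h : Config σ n pos P Q 0 m)
    (hc : ¬ SpokeColoring σ m {pos 0, pos P, pos Q}) (h1 : Even (P - 1)) (h2 : Odd (Q - P - 1)) :
    cross m (arc pos P Q) (pos (P - 1)) = 1 ∧ (m (pos (P - 1)) = pos (P + 1) ∨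
      ∀ x ∈ outer pos n P Q 0, cross m (arc pos P Q) x = 1 →
        x = pos (P - 1) ∨ m x = pos (P - 1)) := by
  have hc' := fun g => hc (h.spokeColoring_of_rotate (h.rotate.spokeColoring_of_reflect g))
  have := h.rotate.reflect.even_odd_first hc'
    (by rw [sub_sub_cancel]; exact h1) (by rw [sub_sub_cancel]; exact h2)
  rw [h.rotate.reflect_arc_third, rotate_arc_first, h.rotate.reflect_outer, h.rotate_outer] at this
  rwa [show -1 + P = P - 1 by ring, show - -1 + P = P + 1 by ring] at this

theorem spokeColoring_of_even_odd [Fintype X] (h : Config σ n pos P Q 0 m)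
    (h1 : Even (P - 1)) (h3 : Odd (n - Q - 1)) : SpokeColoring σ m {pos 0, pos P, pos Q} := by
  have hkP := h.hP
  have hPQ := h.hQ
  have hQn := h.hn
  by_contra hc
  have h2 : Odd (Q - P - 1) := by
    obtain ⟨a, ha⟩ := h1
    obtain ⟨b, hb⟩ := h3
    obtain ⟨c, hcn⟩ := h.odd
    exact ⟨c - b - a - 2, by omega⟩
  obtain ⟨c1, d1⟩ := h.even_odd_first hc h1 h3
  obtain ⟨c2, d2⟩ := h.even_odd_second hc h1 h2
  have o1 : pos 1 ∈ outer pos n P Q 0 := h.first_mem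
  have o2 := h.before_second
  by_cases hT3 : m (pos (Q - 1)) = pos (Q + 1)
  · have c3 := h.cross_third_second hT3
    have T2 : m (pos (P - 1)) = pos (P + 1) := by
      refine d2.resolve_right fun d => ?_
      rcases d _ h.before_third c3.1 with e | e
      · exact h.pos_ne (by omega) (by omega) (by omega) e
      · rw [hT3] at e
        exact h.pos_ne (by omega) (by omega) (by omega) e
    exact hc (h.spokeColoring_of_triangles T2 hT3)
  · have r : Config σ n (fun i => pos (i + (Q - P) + P)) _ _ 0 m := h.rotate.rotate
    have e1 : cross m (arc pos 0 P) (pos 1) = 1 := by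
      have := mate_mem_of_cross (h.ind_arc_eq_zero (by omega) (by omega) (by omega)) c1
      have h0 := h.ind_add (h.outer_mate o1).1
      rw [cross, ind_arc (by omega) (by omega)]
      rw [this] at h0
      rcases h0 with h0 | h0 | h0
      · exact absurd h0.2.2 one_ne_zero
      · exact absurd h0.2.2 one_ne_zero
      · rw [h0.1, add_zero]
    have e2 : cross m (arc pos 0 P) (pos (P - 1)) = 1 := by
      have := mate_mem_of_cross (h.ind_arc_eq_zero (by omega) (by omega) (by omega)) c2
      have h0 := h.ind_add (h.outer_mate o2).1
      rw [cross, ind_arc (by omega) (by omega)]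
      rw [this] at h0
      rcases h0 with h0 | h0 | h0
      · exact absurd h0.2.1 one_ne_zero
      · rw [h0.1, add_zero]
      · exact absurd h0.2.1 one_ne_zero
    have ao : outer (fun i => pos (i + (Q - P) + P)) n _ _ 0 = _ :=
      h.rotate.rotate_outer.trans h.rotate_outer
    have a1 : arc (fun i => pos (i + (Q - P) + P)) 0 (n - P - (Q - P)) = arc pos Q (n - 0) :=
      (rotate_arc_first (pos := fun i => pos (i + P))).trans rotate_arc_second
    have a2 : arc (fun i => pos (i + (Q - P) + P)) (n - P - (Q - P)) (n - (Q - P))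
        = arc pos 0 P :=
      (rotate_arc_second (pos := fun i => pos (i + P))).trans h.rotate_arc_third
    have a3 : arc (fun i => pos (i + (Q - P) + P)) (n - (Q - P)) (n - 0) = arc pos P Q :=
      h.rotate.rotate_arc_third.trans rotate_arc_first
    refine hc (h.spokeColoring_of_rotate (h.rotate.spokeColoring_of_rotate
      (r.odd_odd_coloring (x := pos 1) (y := pos (P - 1)) ?_ ?_ ?_ ?_ ?_ ?_ ?_ ?_ ?_)))
    · rw [show 0 + 1 + (Q - P) + P = Q + 1 by ring, show -(0 + 1) + (Q - P) + P = Q - 1 by ring]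
      exact fun e => hT3 (h.mate_eq_comm h.after_third e)
    · refine cast_odd ?_
      convert h3 using 1; ring
    · refine cast_odd ?_
      convert h2 using 1; ring
    · rw [ao]; exact o1
    · rw [ao]; exact o2
    · rw [a1]; exact c1
    · rw [a2]; exact e1
    · rw [a2]; exact e2
    · rw [a3]; exact c2

theorem even_even_first [Fintype X] (h : Config σ n pos P Q 0 m)
    (hc : ¬ SpokeColoring σ m {pos 0, pos P, pos Q}) (h1 : Even (P - 1)) (h3 : Even (n - Q - 1))
    (hT : m (pos 1) ≠ pos (-1)) :
    cross m (arc pos P Q) (pos 1) = 1 ∧ cross m (arc pos P Q) (pos (-1)) = 1 ∧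
      ∀ x ∈ outer pos n P Q 0, cross m (arc pos P Q) x = 1 →
        x = pos 1 ∨ x = pos (-1) ∨ m x = pos 1 ∨ m x = pos (-1) := by
  have e1 : ((P - 0 - 1 : ℤ) : ZMod 2) = 0 := by rw [sub_zero]; exact cast_even h1
  have e3 : ((n - 0 - Q - 1 : ℤ) : ZMod 2) = 0 := by rw [sub_zero]; exact cast_even h3
  have ho := h.even_even_obstruction hc hT e1 e3
  exact ⟨ho.1, ho.2.1, fun x hx hcr => h.even_even_crossing hc hT e1 e3 hx hcr⟩

theorem even_even_second [Fintype X] (h : Config σ n pos P Q 0 m)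
    (hc : ¬ SpokeColoring σ m {pos 0, pos P, pos Q}) (h1 : Even (P - 1)) (h2 : Even (Q - P - 1))
    (hT : m (pos (P + 1)) ≠ pos (P - 1)) :
    cross m (arc pos Q (n - 0)) (pos (P + 1)) = 1 ∧
      cross m (arc pos Q (n - 0)) (pos (P - 1)) = 1 ∧
      ∀ x ∈ outer pos n P Q 0, cross m (arc pos Q (n - 0)) x = 1 →
        x = pos (P + 1) ∨ x = pos (P - 1) ∨ m x = pos (P + 1) ∨ m x = pos (P - 1) := by
  have hc' := fun g => hc (h.spokeColoring_of_rotate g)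
  have s1 : -1 + P = P - 1 := by ring
  have s2 : 1 + P = P + 1 := by ring
  have := h.rotate.even_even_first hc' h2 (by convert h1 using 1; ring)
    (by rw [s1, s2]; exact hT)
  rwa [rotate_arc_second, h.rotate_outer, s1, s2] at this

theorem even_even_third [Fintype X] (h : Config σ n pos P Q 0 m)
    (hc : ¬ SpokeColoring σ m {pos 0, pos P, pos Q}) (h2 : Even (Q - P - 1))
    (h3 : Even (n - Q - 1)) (hT : m (pos (Q + 1)) ≠ pos (Q - 1)) :
    cross m (arc pos 0 P) (pos (Q + 1)) = 1 ∧ cross m (arc pos 0 P) (pos (Q - 1)) = 1 ∧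
      ∀ x ∈ outer pos n P Q 0, cross m (arc pos 0 P) x = 1 →
        x = pos (Q + 1) ∨ x = pos (Q - 1) ∨ m x = pos (Q + 1) ∨ m x = pos (Q - 1) := by
  have hc' := fun g => hc (h.spokeColoring_of_rotate g)
  have s1 : Q - P - 1 + P = Q - 1 := by ring
  have s2 : Q - P + 1 + P = Q + 1 := by ring
  have := h.rotate.even_even_second hc' h2 (by convert h3 using 1; ring)
    (by rw [s1, s2]; exact hT)
  rwa [h.rotate_arc_third, h.rotate_outer, s1, s2] at this

theorem triangle_next [Fintype X] (h : Config σ n pos P Q 0 m)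
    (hc : ¬ SpokeColoring σ m {pos 0, pos P, pos Q}) (h1 : Even (P - 1)) (h2 : Even (Q - P - 1))
    (hT : m (pos 1) = pos (-1)) : m (pos (P + 1)) = pos (P - 1) := by
  have hkP := h.hP
  have hPQ := h.hQ
  have hQn := h.hn
  have hP : P ≠ 2 := by obtain ⟨d, hd⟩ := h1; omega
  have hl : pos (-1) = pos (n - 1) := by rw [← h.track.pos_add]; congr 1; ring
  by_contra hT2
  have o1 : pos 1 ∈ outer pos n P Q 0 := h.first_mem
  have c1 : cross m (arc pos Q (n - 0)) (pos 1) = 1 := by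
    rw [cross, hT, hl, h.ind_arc_eq_zero (by omega) (by omega) (by omega),
      ind_arc (by omega) (by omega), zero_add]
  rcases (h.even_even_second hc h1 h2 hT2).2.2 _ o1 c1 with e | e | e | e
  · exact h.pos_ne (by omega) (by omega) (by omega) e
  · exact h.pos_ne (by omega) (by omega) (by omega) e
  · rw [hT, hl] at e
    exact h.pos_ne (by omega) (by omega) (by omega) e
  · rw [hT, hl] at e
    exact h.pos_ne (by omega) (by omega) (by omega) e

end Config

namespace Config

variable {X : Type} {σ : Equiv.Perm X} {n : ℤ} {pos : ℤ → X} {P Q k : ℤ} {m : X → X}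

theorem last_eq_sub_one (h : Config σ n pos P Q k m) : pos (-1) = pos (n - 1) := by
  rw [← h.track.pos_add]; congr 1; ring

theorem petersen_chords [Fintype X] (h : Config σ n pos P Q 0 m)
    (hc : ¬ SpokeColoring σ m {pos 0, pos P, pos Q}) (h1 : Even (P - 1)) (h2 : Even (Q - P - 1))
    (h3 : Even (n - Q - 1)) (hT1 : m (pos 1) ≠ pos (-1)) (hT2 : m (pos (P + 1)) ≠ pos (P - 1))
    (hT3 : m (pos (Q + 1)) ≠ pos (Q - 1)) :
    m (pos (Q - 1)) = pos 1 ∧ m (pos (P + 1)) = pos (n - 1) ∧ m (pos (P - 1)) = pos (Q + 1) := by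
  have hkP := h.hP
  have hPQ := h.hQ
  have hQn := h.hn
  have g1 : P ≠ 2 := by obtain ⟨d, hd⟩ := h1; omega
  have g2 : Q ≠ P + 2 := by obtain ⟨d, hd⟩ := h2; omega
  have g3 : n ≠ Q + 2 := by obtain ⟨d, hd⟩ := h3; omega
  have E1 := h.even_even_first hc h1 h3 hT1
  have E2 := h.even_even_second hc h1 h2 hT2
  have E3 := h.even_even_third hc h2 h3 hT3
  rw [h.last_eq_sub_one] at E1
  refine ⟨?_, ?_, ?_⟩
  · have c := mate_mem_of_cross (h.ind_arc_eq_zero (by omega) (by omega) (by omega)) E3.2.1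
    have i := h.ind_add (h.outer_mate h.before_third).1
    have j : cross m (arc pos P Q) (pos (Q - 1)) = 1 := by
      rw [cross, ind_arc (by omega) (by omega)]
      simp_all
    rcases E1.2.2 _ h.before_third j with e | e | e | e
    · exact absurd e (h.pos_ne (by omega) (by omega) (by omega))
    · exact absurd e (h.pos_ne (by omega) (by omega) (by omega))
    · exact e
    · rw [e, h.ind_arc_eq_zero (by omega) (by omega) (by omega)] at c
      exact absurd c zero_ne_one
  · have c := mate_mem_of_cross (h.ind_arc_eq_zero (by omega) (by omega) (by omega)) E2.1
    have i := h.ind_add (h.outer_mate h.after_second).1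
    have j : cross m (arc pos P Q) (pos (P + 1)) = 1 := by
      rw [cross, ind_arc (by omega) (by omega)]
      simp_all
    rcases E1.2.2 _ h.after_second j with e | e | e | e
    · exact absurd e (h.pos_ne (by omega) (by omega) (by omega))
    · exact absurd e (h.pos_ne (by omega) (by omega) (by omega))
    · rw [e, h.ind_arc_eq_zero (by omega) (by omega) (by omega)] at c
      exact absurd c zero_ne_one
    · exact e
  · have c := mate_mem_of_cross (h.ind_arc_eq_zero (by omega) (by omega) (by omega)) E2.2.1
    have i := h.ind_add (h.outer_mate h.before_second).1
    have j : cross m (arc pos 0 P) (pos (P - 1)) = 1 := by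
      rw [cross, ind_arc (by omega) (by omega)]
      simp_all
    rcases E3.2.2 _ h.before_second j with e | e | e | e
    · exact absurd e (h.pos_ne (by omega) (by omega) (by omega))
    · exact absurd e (h.pos_ne (by omega) (by omega) (by omega))
    · exact e
    · rw [e, h.ind_arc_eq_zero (by omega) (by omega) (by omega)] at c
      exact absurd c zero_ne_one

theorem petersen_cross_eq_zero [Fintype X] (h : Config σ n pos P Q 0 m)
    (hc : ¬ SpokeColoring σ m {pos 0, pos P, pos Q}) (h1 : Even (P - 1)) (h2 : Even (Q - P - 1))
    (h3 : Even (n - Q - 1)) (hT1 : m (pos 1) ≠ pos (-1)) (hT2 : m (pos (P + 1)) ≠ pos (P - 1))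
    (hT3 : m (pos (Q + 1)) ≠ pos (Q - 1)) {x : X} (hx : x ∈ outer pos n P Q 0)
    (hx1 : x ≠ pos 1) (hx2 : x ≠ pos (n - 1)) (hx3 : x ≠ pos (P - 1)) (hx4 : x ≠ pos (P + 1))
    (hx5 : x ≠ pos (Q - 1)) (hx6 : x ≠ pos (Q + 1)) :
    cross m (arc pos 0 P) x = 0 ∧ cross m (arc pos P Q) x = 0 ∧
      cross m (arc pos Q (n - 0)) x = 0 := by
  obtain ⟨m1, m2, m3⟩ := h.petersen_chords hc h1 h2 h3 hT1 hT2 hT3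
  have m1' := h.mate_eq_comm h.before_third m1
  have m2' := h.mate_eq_comm h.after_second m2
  have m3' := h.mate_eq_comm h.before_second m3
  have E1 := (h.even_even_first hc h1 h3 hT1).2.2 x hx
  have E2 := (h.even_even_second hc h1 h2 hT2).2.2 x hx
  have E3 := (h.even_even_third hc h2 h3 hT3).2.2 x hx
  have inv := (h.outer_mate hx).2.1
  rw [h.last_eq_sub_one] at E1
  refine ⟨(ZMod.two_cases _).resolve_right fun e => ?_,
    (ZMod.two_cases _).resolve_right fun e => ?_, (ZMod.two_cases _).resolve_right fun e => ?_⟩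
  · rcases E3 e with e | e | e | e
    · exact hx6 e
    · exact hx5 e
    · exact hx3 (by rw [← inv, e, m3'])
    · exact hx1 (by rw [← inv, e, m1])
  · rcases E1 e with e | e | e | e
    · exact hx1 e
    · exact hx2 e
    · exact hx5 (by rw [← inv, e, m1'])
    · exact hx4 (by rw [← inv, e, m2'])
  · rcases E2 e with e | e | e | e
    · exact hx4 e
    · exact hx3 e
    · exact hx2 (by rw [← inv, e, m2])
    · exact hx6 (by rw [← inv, e, m3])

end Config

theorem Track.exists_lift {X A : Type} {σ : Equiv.Perm X} {n : ℤ} {pos : ℤ → X}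
    (h : Track σ n pos) (F : ℤ → A) : ∃ f : X → A, ∀ i, 0 ≤ i → i < n → f (pos i) = F i := by
  choose idx h0 hn hidx using h.exists_pos 0
  refine ⟨fun x => F (idx x), fun i hi hin => congrArg F ?_⟩
  have := h0 (pos i)
  have := hn (pos i)
  exact h.inj_of_lt (hidx (pos i)) (by omega) (by omega)

/-- The colour of the cycle edge leaving position `i`. -/
def petersenEdge (P Q n i : ℤ) : Fin 6 :=
  if i = P - 1 ∨ i = Q - 1 ∨ i = n - 1 then 3
  else if i < P then (if i % 2 = 0 then 4 else 0)
  else if i < Q then (if i % 2 = 0 then 2 else 4)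
  else (if i % 2 = 0 then 4 else 1)

/-- The type of position `i`: a spoke, the last position of an arc, or another position of an
arc. -/
def petersenType (P Q n i : ℤ) : Fin 9 :=
  if i = 0 then 0 else if i = P then 1 else if i = Q then 2
  else if i = P - 1 then 3 else if i = Q - 1 then 4 else if i = n - 1 then 5
  else if i < P then 6 else if i < Q then 7 else 8

/-- The colour of the chord or spoke at a position of the given type. -/
def petersenChord : Fin 9 → Fin 6 := ![2, 1, 0, 2, 1, 0, 1, 0, 2]

/-- The colours at a position of the given type. -/
def petersenTriple : Fin 9 → Finset (Fin 6) :=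
  ![{3, 4, 2}, {3, 4, 1}, {3, 4, 0}, {0, 3, 2}, {2, 3, 1}, {1, 3, 0}, {0, 4, 1}, {2, 4, 0},
    {1, 4, 2}]

theorem petersen_triple_eq {P Q n : ℤ} (hP : P % 2 = 1) (hQ : Q % 2 = 0) (hn : n % 2 = 1)
    (hP1 : 1 < P) (hPQ : P + 1 < Q) (hQn : Q + 1 < n) {i : ℤ} (h0 : 0 ≤ i) (h1 : i < n) :
    {petersenEdge P Q n i, if i = 0 then 3 else petersenEdge P Q n (i - 1),
      petersenChord (petersenType P Q n i)} = petersenTriple (petersenType P Q n i) := by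
  simp only [petersenEdge, petersenType]
  have : i = 0 ∨ i = P ∨ i = Q ∨ i = P - 1 ∨ i = Q - 1 ∨ i = n - 1 ∨ (0 < i ∧ i < P - 1) ∨
    (P < i ∧ i < Q - 1) ∨ (Q < i ∧ i < n - 1) := by omega
  have hi := Int.emod_two_eq_zero_or_one i
  rcases this with e | e | e | e | e | e | e | e | e <;> rcases hi with hi | hi <;>
    first
    | omega
    | simp (disch := omega) only [if_pos, if_neg]; decide

theorem petersen_edge_rich {P Q n : ℤ} (hP : P % 2 = 1) (hQ : Q % 2 = 0) (hn : n % 2 = 1)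
    (hP1 : 1 < P) (hPQ : P + 1 < Q) (hQn : Q + 1 < n) {i : ℤ} (h0 : 0 ≤ i) (h1 : i < n) :
    PoorOrRich (petersenTriple (petersenType P Q n i))
      (petersenTriple (if i = n - 1 then 0 else petersenType P Q n (i + 1))) := by
  simp only [petersenType, PoorOrRich]
  have : i = 0 ∨ i = P ∨ i = Q ∨ i = P - 1 ∨ i = Q - 1 ∨ i = n - 1 ∨ i = P - 2 ∧ 0 < i ∨
    i = Q - 2 ∧ P < i ∨ i = n - 2 ∧ Q < i ∨ (0 < i ∧ i < P - 2) ∨ (P < i ∧ i < Q - 2) ∨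
    (Q < i ∧ i < n - 2) := by omega
  rcases this with e | e | e | e | e | e | e | e | e | e | e | e <;>
    simp (disch := omega) only [if_pos, if_neg] <;> decide

theorem petersen_chord_rich {s t : Fin 9} (h : s = t ∨ s = 4 ∧ t = 6 ∨ s = 6 ∧ t = 4 ∨
    s = 7 ∧ t = 5 ∨ s = 5 ∧ t = 7 ∨ s = 3 ∧ t = 8 ∨ s = 8 ∧ t = 3) :
    PoorOrRich (petersenTriple s) (petersenTriple t) ∧ petersenChord t = petersenChord s := by
  rw [PoorOrRich]
  rcases h with rfl | ⟨rfl, rfl⟩ | ⟨rfl, rfl⟩ | ⟨rfl, rfl⟩ | ⟨rfl, rfl⟩ | ⟨rfl, rfl⟩ | ⟨rfl, rfl⟩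
  · revert s; decide
  all_goals decide

theorem mem_arc_of_ind {X : Type} {A : Finset X} {x : X} (h : ind A x = 1) : x ∈ A := by
  by_contra hx
  rw [ind, if_neg hx] at h
  exact zero_ne_one h

namespace Config

variable {X : Type} {σ : Equiv.Perm X} {n : ℤ} {pos : ℤ → X} {P Q k : ℤ} {m : X → X}

theorem spokeColoring_of_petersen (h : Config σ n pos P Q 0 m) (h1 : Even (P - 1))
    (h2 : Even (Q - P - 1)) (h3 : Even (n - Q - 1)) (m1 : m (pos (Q - 1)) = pos 1)
    (m2 : m (pos (P + 1)) = pos (n - 1)) (m3 : m (pos (P - 1)) = pos (Q + 1))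
    (hcr : ∀ x ∈ outer pos n P Q 0, x ≠ pos 1 → x ≠ pos (n - 1) → x ≠ pos (P - 1) →
      x ≠ pos (P + 1) → x ≠ pos (Q - 1) → x ≠ pos (Q + 1) → cross m (arc pos 0 P) x = 0 ∧
        cross m (arc pos P Q) x = 0 ∧ cross m (arc pos Q (n - 0)) x = 0) :
    SpokeColoring σ m {pos 0, pos P, pos Q} := by
  have hkP := h.hP
  have hPQ := h.hQ
  have hQn := h.hn
  have hP : P % 2 = 1 := by obtain ⟨d, hd⟩ := h1; omega
  have hQ : Q % 2 = 0 := by obtain ⟨d, hd⟩ := h2; omega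
  have hn : n % 2 = 1 := by obtain ⟨d, hd⟩ := h3; omega
  obtain ⟨f, hf⟩ := h.track.exists_lift (petersenEdge P Q n)
  obtain ⟨t, ht⟩ := h.track.exists_lift (petersenType P Q n)
  have triple : ∀ x, colorTriple σ f (fun x => petersenChord (t x)) x = petersenTriple (t x) := by
    intro x
    obtain ⟨i, h0, h1, rfl⟩ := h.track.exists_pos 0 x
    rw [zero_add] at h1
    rw [ht i h0 h1, ← petersen_triple_eq hP hQ hn (by omega) hPQ (by omega) h0 h1, colorTriple,
      h.track.pos_symm, hf i h0 h1, ht i h0 h1]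
    split_ifs with hi
    · subst hi
      have last : petersenEdge P Q n (n - 1) = 3 := if_pos (Or.inr (Or.inr rfl))
      rw [zero_sub, h.last_eq_sub_one, hf _ (by omega) (by omega), last]
    · rw [hf _ (by omega) (by omega)]
  have t0 : t (pos 0) = 0 := by rw [ht 0 le_rfl (by omega), petersenType, if_pos rfl]
  have tP : t (pos P) = 1 := by
    rw [ht P (by omega) (by omega), petersenType, if_neg (by omega), if_pos rfl]
  have tQ : t (pos Q) = 2 := by
    rw [ht Q (by omega) (by omega), petersenType, if_neg (by omega), if_neg (by omega), if_pos rfl]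
  have t3 : t (pos (P - 1)) = 3 := by
    rw [ht _ (by omega) (by omega), petersenType]
    simp (disch := omega) only [if_neg, if_true]
  have t4 : t (pos (Q - 1)) = 4 := by
    rw [ht _ (by omega) (by omega), petersenType]
    simp (disch := omega) only [if_neg, if_true]
  have t5 : t (pos (n - 1)) = 5 := by
    rw [ht _ (by omega) (by omega), petersenType]
    simp (disch := omega) only [if_neg, if_true]
  have t6 : ∀ x, ind (arc pos 0 P) x = 1 → x ≠ pos (P - 1) → t x = 6 := by
    intro x hx hne
    obtain ⟨i, g1, g2, rfl⟩ := mem_arc.mp (mem_arc_of_ind hx)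
    have : i ≠ P - 1 := fun e => hne (by rw [e])
    rw [ht _ (by omega) (by omega), petersenType]
    simp (disch := omega) only [if_pos, if_neg]
  have t7 : ∀ x, ind (arc pos P Q) x = 1 → x ≠ pos (Q - 1) → t x = 7 := by
    intro x hx hne
    obtain ⟨i, g1, g2, rfl⟩ := mem_arc.mp (mem_arc_of_ind hx)
    have : i ≠ Q - 1 := fun e => hne (by rw [e])
    rw [ht _ (by omega) (by omega), petersenType]
    simp (disch := omega) only [if_pos, if_neg]
  have t8 : ∀ x, ind (arc pos Q (n - 0)) x = 1 → x ≠ pos (n - 1) → t x = 8 := by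
    intro x hx hne
    obtain ⟨i, g1, g2, rfl⟩ := mem_arc.mp (mem_arc_of_ind hx)
    have : i ≠ n - 1 := fun e => hne (by rw [e])
    rw [ht _ (by omega) (by omega), petersenType]
    simp (disch := omega) only [if_neg]
  have m1' := h.mate_eq_comm h.before_third m1
  have m2' := h.mate_eq_comm h.after_second m2
  have m3' := h.mate_eq_comm h.before_second m3
  have u6 : t (pos 1) = 6 :=
    t6 _ (ind_arc (by omega) (by omega)) (h.pos_ne (by omega) (by omega) (by omega))
  have u7 : t (pos (P + 1)) = 7 :=
    t7 _ (ind_arc (by omega) (by omega)) (h.pos_ne (by omega) (by omega) (by omega))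
  have u8 : t (pos (Q + 1)) = 8 :=
    t8 _ (ind_arc (by omega) (by omega)) (h.pos_ne (by omega) (by omega) (by omega))
  have chord : ∀ x ∉ ({pos 0, pos P, pos Q} : Finset X),
      PoorOrRich (petersenTriple (t x)) (petersenTriple (t (m x))) ∧
        petersenChord (t (m x)) = petersenChord (t x) := by
    intro x hx
    have hxo : x ∈ outer pos n P Q 0 := h.mem_outer.mpr ⟨hx, by
      rw [mem_arc]
      rintro ⟨i, g1, g2, rfl⟩
      obtain rfl : i = 0 := by omega
      simp at hx⟩
    apply petersen_chord_rich
    by_cases x1 : x = pos 1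
    · rw [x1, m1', u6, t4]; decide
    by_cases x2 : x = pos (n - 1)
    · rw [x2, m2', u7, t5]; decide
    by_cases x3 : x = pos (P - 1)
    · rw [x3, m3, u8, t3]; decide
    by_cases x4 : x = pos (P + 1)
    · rw [x4, m2, u7, t5]; decide
    by_cases x5 : x = pos (Q - 1)
    · rw [x5, m1, u6, t4]; decide
    by_cases x6 : x = pos (Q + 1)
    · rw [x6, m3', u8, t3]; decide
    left
    have inv := (h.outer_mate hxo).2.1
    have y3 : m x ≠ pos (P - 1) := fun e => x6 (by rw [← inv, e, m3])
    have y4 : m x ≠ pos (Q - 1) := fun e => x1 (by rw [← inv, e, m1])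
    have y5 : m x ≠ pos (n - 1) := fun e => x4 (by rw [← inv, e, m2'])
    obtain ⟨c1, c2, c3⟩ := hcr x hxo x1 x2 x3 x4 x5 x6
    rw [cross, CharTwo.add_eq_zero] at c1 c2 c3
    rcases h.ind_add hxo with ⟨i1, -, -⟩ | ⟨-, i1, -⟩ | ⟨-, -, i1⟩
    · rw [t6 x i1 x3, t6 (m x) (c1 ▸ i1) y3]
    · rw [t7 x i1 x5, t7 (m x) (c2 ▸ i1) y4]
    · rw [t8 x i1 x2, t8 (m x) (c3 ▸ i1) y5]
  refine ⟨f, fun x => petersenChord (t x), fun x hx => (chord x hx).2, fun x => ?_, fun x => ?_,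
    fun x hx => by rw [triple, triple]; exact (chord x hx).1, ?_, fun x hx => ?_⟩
  · rw [triple]
    generalize t x = s
    revert s; decide
  · rw [triple, triple]
    obtain ⟨i, h0, h1, rfl⟩ := h.track.exists_pos 0 x
    rw [zero_add] at h1
    have := petersen_edge_rich hP hQ hn (by omega) hPQ (by omega) h0 h1
    rw [ht i h0 h1, ← h.track.step]
    split_ifs at this with hi
    · rwa [hi, sub_add_cancel, ← zero_add n, h.track.pos_add, t0, zero_add, ← hi]
    · rwa [ht (i + 1) (by omega) (by omega)]
  · simp only [Finset.image_insert, Finset.image_singleton, t0, tP, tQ]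
    decide
  · rw [triple]
    simp only [Finset.image_insert, Finset.image_singleton, t0, tP, tQ, PoorOrRich]
    simp only [Finset.mem_insert, Finset.mem_singleton] at hx
    rcases hx with rfl | rfl | rfl
    · rw [t0]; decide
    · rw [tP]; decide
    · rw [tQ]; decide

theorem spokeColoring_of_even [Fintype X] (h : Config σ n pos P Q 0 m) (h1 : Even (P - 1))
    (h2 : Even (Q - P - 1)) (h3 : Even (n - Q - 1)) : SpokeColoring σ m {pos 0, pos P, pos Q} := by
  by_contra hc
  have hc' := fun g => hc (h.spokeColoring_of_rotate g)
  have hc'' := fun g => hc' (h.rotate.spokeColoring_of_rotate g)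
  have s1 : -1 + P = P - 1 := by ring
  have s2 : 1 + P = P + 1 := by ring
  have s3 : Q - P + 1 + P = Q + 1 := by ring
  have s4 : Q - P - 1 + P = Q - 1 := by ring
  have r1 := h.triangle_next hc h1 h2
  have r2 := h.rotate.triangle_next hc' h2 (by convert h3 using 1; ring)
  have r3 := h.rotate.rotate.triangle_next hc'' (by convert h3 using 1; ring)
    (by convert h1 using 1; ring)
  simp only [s1, s2, s3, s4] at r2
  rw [show 1 + (Q - P) + P = Q + 1 by ring, show -1 + (Q - P) + P = Q - 1 by ring,
    show n - P - (Q - P) + 1 + (Q - P) + P = 1 + n by ring,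
    show n - P - (Q - P) - 1 + (Q - P) + P = -1 + n by ring, h.track.pos_add,
    h.track.pos_add] at r3
  by_cases hT2 : m (pos (P + 1)) = pos (P - 1)
  · exact hc (h.spokeColoring_of_triangles (h.mate_eq_comm h.after_second hT2)
      (h.mate_eq_comm h.after_third (r2 hT2)))
  · have hT1 := fun e => hT2 (r1 e)
    have hT3 := fun e => hT1 (r3 e)
    obtain ⟨m1, m2, m3⟩ := h.petersen_chords hc h1 h2 h3 hT1 hT2 hT3
    exact hc (h.spokeColoring_of_petersen h1 h2 h3 m1 m2 m3 fun x hx x1 x2 x3 x4 x5 x6 =>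
      h.petersen_cross_eq_zero hc h1 h2 h3 hT1 hT2 hT3 hx x1 x2 x3 x4 x5 x6)

/-- A cycle of odd length with chords and three pairwise nonconsecutive spokes has a coloring
whose spokes may be attached to a triangle. -/
theorem spokeColoring [Fintype X] (h : Config σ n pos P Q 0 m) :
    SpokeColoring σ m {pos 0, pos P, pos Q} := by
  obtain ⟨d, hd⟩ := h.odd
  rcases Int.even_or_odd (P - 1) with h1 | h1 <;> rcases Int.even_or_odd (n - Q - 1) with h3 | h3
  · refine h.spokeColoring_of_even h1 ?_ h3
    obtain ⟨a, ha⟩ := h1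
    obtain ⟨b, hb⟩ := h3
    exact ⟨d - a - b - 1, by omega⟩
  · exact h.spokeColoring_of_even_odd h1 h3
  · refine h.spokeColoring_of_rotate (h.rotate.spokeColoring_of_rotate
      (h.rotate.rotate.spokeColoring_of_even_odd ?_ ?_))
    · convert h3 using 1; ring
    · obtain ⟨a, ha⟩ := h1
      obtain ⟨b, hb⟩ := h3
      exact ⟨d - a - b - 2, by omega⟩
  · refine h.spokeColoring_of_rotate (h.rotate.spokeColoring_of_even_odd ?_ ?_)
    · obtain ⟨a, ha⟩ := h1
      obtain ⟨b, hb⟩ := h3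
      exact ⟨d - a - b - 2, by omega⟩
    · convert h1 using 1; ring

end Config

theorem normalModel_of_flow {W : Type} {σ : Equiv.Perm W} {μ : W → W} {f θ : W → K4}
    (hf : ∀ x, f (σ x) = f x + θ (σ x)) (h0 : ∀ x, θ x ≠ 0) (hμ : ∀ x, θ (μ x) = θ x)
    (hαβ : ∀ x, ¬ (θ x = flowAlpha ∧ θ (σ x) = flowBeta))
    (hβα : ∀ x, ¬ (θ x = flowBeta ∧ θ (σ x) = flowAlpha)) : NormalModel σ μ := by
  refine ⟨fun x => cycleColor (f x), fun x => matchColor (θ x), fun x => congrArg matchColor (hμ x),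
    fun x => ?_, fun x => ?_, fun x => ?_⟩
  · rw [colorTriple_potential hf]
    exact card_flow_triple (h0 x)
  · rw [colorTriple_potential hf, colorTriple_potential_succ hf]
    exact poorOrRich_flow_edge (h0 x) (h0 _) (hαβ x) (hβα x)
  · rw [colorTriple_potential hf, colorTriple_potential hf, hμ]
    exact poorOrRich_flow_match (h0 x)

theorem Track.card_eq {X : Type} [Fintype X] {σ : Equiv.Perm X} {n : ℤ} {pos : ℤ → X}
    (h : Track σ n pos) : (Fintype.card X : ℤ) = n := by
  rw [← Finset.card_univ, h.univ_eq 0, Finset.card_eq_sum_ones,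
    h.sum_image_Ioc _ (by omega), ← Finset.card_eq_sum_ones, Int.card_Ioc]
  have := h.n_pos
  omega

theorem normalModel_one_cycle {X : Type} [Fintype X] {σ : Equiv.Perm X} {n : ℤ} {pos : ℤ → X}
    {μ : X → X} (h : Track σ n pos) (hμ : ∀ x, μ (μ x) = x) (hne : ∀ x, μ x ≠ x) :
    NormalModel σ μ := by
  obtain ⟨f, hf⟩ := h.exists_potential (θ := fun _ => ((1, 1) : K4))
    (sum_eq_zero_of_mate (fun a => CharTwo.add_self_eq_zero a) (m := μ) (S := ∅)
      (by simp) (fun x _ => hμ x) (fun x _ => hne x) (fun x _ => rfl) (by simp))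
  refine normalModel_of_flow (θ := fun _ => ((1, 1) : K4)) hf (fun _ => by decide)
    (fun _ => rfl) (fun _ => by decide) fun _ => by decide

section Sum

variable {X Y : Type}

/-- The vertices of the first side matched to the second side. -/
noncomputable def spokes [Fintype X] (μ : X ⊕ Y → X ⊕ Y) : Finset X :=
  Finset.univ.filter fun x => ∃ y, μ (Sum.inl x) = Sum.inr y

/-- The mate of a vertex of the first side that is not a spoke. -/
def innerMate (μ : X ⊕ Y → X ⊕ Y) (x : X) : X := Sum.elim id (fun _ => x) (μ (Sum.inl x))

/-- The matching with the two sides interchanged. -/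
def swapMate (μ : X ⊕ Y → X ⊕ Y) (x : Y ⊕ X) : Y ⊕ X := (μ x.swap).swap

theorem mem_spokes [Fintype X] {μ : X ⊕ Y → X ⊕ Y} {x : X} :
    x ∈ spokes μ ↔ ∃ y, μ (Sum.inl x) = Sum.inr y := by simp [spokes]

theorem inl_innerMate [Fintype X] {μ : X ⊕ Y → X ⊕ Y} {x : X} (hx : x ∉ spokes μ) :
    μ (Sum.inl x) = Sum.inl (innerMate μ x) := by
  rw [mem_spokes] at hx
  rw [innerMate]
  rcases h : μ (Sum.inl x) with z | z
  · rfl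
  · exact absurd ⟨z, h⟩ hx

theorem swapMate_swapMate {μ : X ⊕ Y → X ⊕ Y} (hμ : ∀ x, μ (μ x) = x) (x : Y ⊕ X) :
    swapMate μ (swapMate μ x) = x := by simp [swapMate, hμ]

theorem swapMate_ne {μ : X ⊕ Y → X ⊕ Y} (hμ : ∀ x, μ x ≠ x) (x : Y ⊕ X) :
    swapMate μ x ≠ x := fun h => hμ x.swap (by
  simpa [swapMate] using congrArg Sum.swap h)

theorem swapMate_inl {μ : X ⊕ Y → X ⊕ Y} (hμ : ∀ x, μ (μ x) = x) {x : X} {y : Y} :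
    swapMate μ (Sum.inl y) = Sum.inr x ↔ μ (Sum.inl x) = Sum.inr y := by
  constructor
  · intro h
    have : μ (Sum.inr y) = Sum.inl x := by
      have := congrArg Sum.swap h
      simpa [swapMate] using this
    rw [← this, hμ]
  · intro h
    simp [swapMate, ← h, hμ]

theorem innerMate_not_mem_spokes [Fintype X] {μ : X ⊕ Y → X ⊕ Y} (hμ : ∀ x, μ (μ x) = x) {x : X}
    (hx : x ∉ spokes μ) : innerMate μ x ∉ spokes μ := by
  have := congrArg μ (inl_innerMate hx)
  rw [hμ] at this
  rw [mem_spokes, ← this]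
  simp

theorem innerMate_innerMate [Fintype X] {μ : X ⊕ Y → X ⊕ Y} (hμ : ∀ x, μ (μ x) = x) {x : X}
    (hx : x ∉ spokes μ) : innerMate μ (innerMate μ x) = x := by
  have := congrArg μ (inl_innerMate hx)
  rw [hμ, inl_innerMate (innerMate_not_mem_spokes hμ hx)] at this
  exact (Sum.inl.inj this).symm

theorem innerMate_ne [Fintype X] {μ : X ⊕ Y → X ⊕ Y} (hne : ∀ x, μ x ≠ x) {x : X}
    (hx : x ∉ spokes μ) : innerMate μ x ≠ x := fun h => hne (Sum.inl x) (by
  rw [inl_innerMate hx, h])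

theorem card_spokes [Fintype X] {μ : X ⊕ Y → X ⊕ Y} (hμ : ∀ x, μ (μ x) = x) (hne : ∀ x, μ x ≠ x) :
    ((spokes μ).card : ZMod 2) = Fintype.card X := by
  have := sum_eq_zero_of_mate (A := ZMod 2) CharTwo.add_self_eq_zero (S := spokes μ)
    (θ := fun x => if x ∈ spokes μ then 0 else 1)
    (fun x hx => innerMate_not_mem_spokes hμ hx) (fun x hx => innerMate_innerMate hμ hx)
    (fun x hx => innerMate_ne hne hx)
    (fun x hx => by rw [if_neg hx, if_neg (innerMate_not_mem_spokes hμ hx)])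
    (Finset.sum_eq_zero fun x hx => if_pos hx)
  have h2 : ∑ x : X, (if x ∈ spokes μ then (0 : ZMod 2) else 1)
      = ∑ x : X, (1 + if x ∈ spokes μ then 1 else 0) :=
    Finset.sum_congr rfl fun x _ => by split_ifs <;> decide
  rw [h2, Finset.sum_add_distrib, Finset.sum_ite_mem, Finset.univ_inter, Finset.sum_const,
    Finset.sum_const, nsmul_one, nsmul_one, Finset.card_univ, CharTwo.add_eq_zero] at this
  exact this.symm

theorem normalModel_swap {σ : Equiv.Perm X} {τ : Equiv.Perm Y} {μ : X ⊕ Y → X ⊕ Y}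
    (h : NormalModel (Equiv.sumCongr τ σ) (swapMate μ)) : NormalModel (Equiv.sumCongr σ τ) μ := by
  obtain ⟨f, g, h1, h2, h3, h4⟩ := h
  have key : ∀ x : X ⊕ Y, colorTriple (Equiv.sumCongr σ τ) (fun x => f x.swap) (fun x => g x.swap) x
      = colorTriple (Equiv.sumCongr τ σ) f g x.swap := by rintro (x | x) <;> rfl
  refine ⟨fun x => f x.swap, fun x => g x.swap, fun x => ?_, fun x => ?_, fun x => ?_,
    fun x => ?_⟩
  · simpa [swapMate] using h1 x.swap
  · rw [key]; exact h2 _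
  · rw [key, key]
    have := h3 x.swap
    rcases x with x | x <;> exact this
  · rw [key, key]
    have := h4 x.swap
    rwa [swapMate, Sum.swap_swap] at this

theorem exists_potential_sum [Fintype X] [Fintype Y] {σ : Equiv.Perm X} {τ : Equiv.Perm Y}
    {a b : ℤ} {p : ℤ → X} {q : ℤ → Y} (hσ : Track σ a p) (hτ : Track τ b q) {θ : X ⊕ Y → K4}
    (h1 : ∑ x, θ (Sum.inl x) = 0) (h2 : ∑ y, θ (Sum.inr y) = 0) :
    ∃ f : X ⊕ Y → K4, ∀ x, f (Equiv.sumCongr σ τ x) = f x + θ (Equiv.sumCongr σ τ x) := by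
  obtain ⟨f1, hf1⟩ := hσ.exists_potential h1
  obtain ⟨f2, hf2⟩ := hτ.exists_potential h2
  exact ⟨Sum.elim f1 f2, by rintro (x | x); exacts [hf1 x, hf2 x]⟩

theorem normalModel_even_cycles [Fintype X] [Fintype Y] {σ : Equiv.Perm X} {τ : Equiv.Perm Y}
    {a b : ℤ} {p : ℤ → X} {q : ℤ → Y} (hσ : Track σ a p) (hτ : Track τ b q) {μ : X ⊕ Y → X ⊕ Y}
    (ha : Even a) (hb : Even b) : NormalModel (Equiv.sumCongr σ τ) μ := by
  have aux : ∀ c : ℕ, Even c → c • ((1, 1) : K4) = 0 := by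
    rintro c ⟨d, rfl⟩
    rw [add_nsmul, CharTwo.add_self_eq_zero]
  obtain ⟨f, hf⟩ := exists_potential_sum hσ hτ (θ := fun _ => ((1, 1) : K4))
    (by rw [Finset.sum_const, Finset.card_univ]
        exact aux _ (by rw [← hσ.card_eq] at ha; exact_mod_cast ha))
    (by rw [Finset.sum_const, Finset.card_univ]
        exact aux _ (by rw [← hτ.card_eq] at hb; exact_mod_cast hb))
  exact normalModel_of_flow (θ := fun _ => ((1, 1) : K4)) hf (fun _ => by decide)
    (fun _ => rfl) (fun _ => by decide) fun _ => by decide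

/-- Flow values of a vertex: `α` at `x`, `β` at `x'`, and `α + β` elsewhere. -/
noncomputable def pairFlow (x x' z : X) : K4 :=
  if z = x then flowAlpha else if z = x' then flowBeta else (1, 1)

theorem sum_pairFlow [Fintype X] {x x' : X} (h : x ≠ x') (hX : Odd (Fintype.card X)) :
    ∑ z, pairFlow x x' z = 0 := by
  have h1 : ∀ z, pairFlow x x' z
      = (1, 1) + (if z = x then flowBeta else 0) + (if z = x' then flowAlpha else 0) := by
    intro z
    unfold pairFlow
    split_ifs with h1 h2 <;> first | exact absurd (h1.symm.trans h2) h | decide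
  simp_rw [h1]
  rw [Finset.sum_add_distrib, Finset.sum_add_distrib, Finset.sum_ite_eq', Finset.sum_ite_eq',
    if_pos (Finset.mem_univ _), if_pos (Finset.mem_univ _), Finset.sum_const, Finset.card_univ]
  obtain ⟨d, hd⟩ := hX
  rw [hd, add_nsmul, two_mul, add_nsmul, CharTwo.add_self_eq_zero]
  decide

theorem normalModel_of_pair [Fintype X] [Fintype Y] {σ : Equiv.Perm X} {τ : Equiv.Perm Y}
    {a b : ℤ} {p : ℤ → X} {q : ℤ → Y} (hσ : Track σ a p) (hτ : Track τ b q) {μ : X ⊕ Y → X ⊕ Y}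
    (hμ : ∀ x, μ (μ x) = x) (ha : Odd a) (hb : Odd b) {x x' : X} {y y' : Y} (hx : x ≠ x')
    (hy : μ (Sum.inl x) = Sum.inr y) (hy' : μ (Sum.inl x') = Sum.inr y') (h1 : σ x ≠ x')
    (h2 : σ x' ≠ x) (h3 : τ y ≠ y') (h4 : τ y' ≠ y) : NormalModel (Equiv.sumCongr σ τ) μ := by
  have hyy : y ≠ y' := by
    rintro rfl
    have := congrArg μ (hy.trans hy'.symm)
    rw [hμ, hμ] at this
    exact hx (Sum.inl.inj this)
  have oa : Odd (Fintype.card X) := by rw [← hσ.card_eq] at ha; exact_mod_cast ha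
  have ob : Odd (Fintype.card Y) := by rw [← hτ.card_eq] at hb; exact_mod_cast hb
  have hyi : μ (Sum.inr y) = Sum.inl x := by rw [← hy, hμ]
  have hyi' : μ (Sum.inr y') = Sum.inl x' := by rw [← hy', hμ]
  have hA : ∀ {Z : Type} {z z' w : Z}, z ≠ z' → (pairFlow z z' w = flowAlpha ↔ w = z) := by
    intro Z z z' w h
    unfold pairFlow
    split_ifs with g1 g2 <;> simp_all [flowAlpha, flowBeta]
  have hB : ∀ {Z : Type} {z z' w : Z}, z ≠ z' → (pairFlow z z' w = flowBeta ↔ w = z') := by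
    intro Z z z' w h
    unfold pairFlow
    split_ifs with g1 g2 <;> simp_all [flowAlpha, flowBeta]
  have h0 : ∀ {Z : Type} {z z' w : Z}, pairFlow z z' w ≠ 0 := by
    intro Z z z' w
    unfold pairFlow
    split_ifs <;> decide
  set θ : X ⊕ Y → K4 := Sum.elim (pairFlow x x') (pairFlow y y') with hθ
  have hα : ∀ w, θ w = flowAlpha ↔ w = Sum.inl x ∨ w = Sum.inr y := by
    rintro (w | w) <;> simp [hθ, hA hx, hA hyy]
  have hβ : ∀ w, θ w = flowBeta ↔ w = Sum.inl x' ∨ w = Sum.inr y' := by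
    rintro (w | w) <;> simp [hθ, hB hx, hB hyy]
  have hz : ∀ w, θ w ≠ 0 := by rintro (w | w) <;> exact h0
  obtain ⟨f, hf⟩ := exists_potential_sum hσ hτ (θ := θ) (sum_pairFlow hx oa) (sum_pairFlow hyy ob)
  have three : ∀ s t : K4, s ≠ 0 → t ≠ 0 → (s = flowAlpha ↔ t = flowAlpha) →
      (s = flowBeta ↔ t = flowBeta) → s = t := by decide
  refine normalModel_of_flow hf hz (fun w => three _ _ (hz _) (hz _) ?_ ?_) ?_ ?_
  · rw [hα, hα]
    constructor
    · rintro (e | e)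
      · right; rw [← hμ w, e, hy]
      · left; rw [← hμ w, e, hyi]
    · rintro (rfl | rfl)
      · exact Or.inr hy
      · exact Or.inl hyi
  · rw [hβ, hβ]
    constructor
    · rintro (e | e)
      · right; rw [← hμ w, e, hy']
      · left; rw [← hμ w, e, hyi']
    · rintro (rfl | rfl)
      · exact Or.inr hy'
      · exact Or.inl hyi'
  · intro w
    rw [hα, hβ]
    rintro ⟨rfl | rfl, e⟩ <;> simp_all
  · intro w
    rw [hα, hβ]
    rintro ⟨rfl | rfl, e⟩ <;> simp_all

end Sum

theorem Track.closed_eq_univ {X : Type} [Fintype X] {σ : Equiv.Perm X} {n : ℤ} {pos : ℤ → X}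
    (h : Track σ n pos) {S : Finset X} (hne : S.Nonempty) (hS : ∀ x ∈ S, σ x ∈ S) :
    S = Finset.univ := by
  obtain ⟨x, hx⟩ := hne
  obtain ⟨i, rfl⟩ := h.surj x
  rw [Finset.eq_univ_iff_forall]
  intro y
  obtain ⟨j, h1, -, rfl⟩ := h.exists_pos i y
  induction j, h1 using Int.leInduction with
  | base => exact hx
  | succ j hj ih => rw [h.step]; exact hS _ ih

theorem Finset.exists_eq_of_card_three {X : Type} {S : Finset X} (hS : S.card = 3) {x y : X}
    (hx : x ∈ S) (hy : y ∈ S) (hxy : x ≠ y) : ∃ z, z ≠ x ∧ z ≠ y ∧ S = {x, y, z} := by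
  have h1 : ((S.erase x).erase y).card = 1 := by
    rw [Finset.card_erase_of_mem (Finset.mem_erase.mpr ⟨hxy.symm, hy⟩),
      Finset.card_erase_of_mem hx, hS]
  obtain ⟨z, hz⟩ := Finset.card_eq_one.mp h1
  have hmem : ∀ w, (w ∈ S ∧ w ≠ x ∧ w ≠ y) ↔ w = z := fun w => by
    have := Finset.ext_iff.mp hz w
    simp only [Finset.mem_erase, Finset.mem_singleton] at this
    rw [← this]; tauto
  obtain ⟨hzS, h2, h3⟩ := (hmem z).mpr rfl
  refine ⟨z, h2, h3, ?_⟩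
  ext w
  simp only [Finset.mem_insert, Finset.mem_singleton, ← hmem w]
  constructor
  · tauto
  · rintro (rfl | rfl | h) <;> tauto

/-- A cycle can be traversed starting from any vertex. -/
theorem Track.exists_start {X : Type} {σ : Equiv.Perm X} {n : ℤ} {pos : ℤ → X}
    (h : Track σ n pos) (x : X) : ∃ p : ℤ → X, Track σ n p ∧ p 0 = x := by
  obtain ⟨c, rfl⟩ := h.surj x
  exact ⟨_, h.shift c, congrArg pos (zero_add c)⟩

/-- An odd cycle with three spokes, two of them consecutive, has a proper edge coloring with
three colors that extends a given coloring of the spokes. -/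
theorem exists_three_coloring {X : Type} [Fintype X] {σ : Equiv.Perm X} {n : ℤ} {pos : ℤ → X}
    (h : Track σ n pos) (hn : Odd n) {S : Finset X} (hS : S.card = 3)
    (hadj : ∃ x ∈ S, σ x ∈ S) {q : X → Fin 6} (hq : S.image q = {0, 1, 2}) :
    ∃ f g : X → Fin 6, (∀ x ∈ S, g x = q x) ∧ (∀ x ∉ S, ∀ y ∉ S, g x = g y) ∧
      ∀ x, colorTriple σ f g x = {0, 1, 2} := by
  obtain ⟨x, hx, hσx⟩ := hadj
  obtain ⟨p, h', rfl⟩ := h.exists_start x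
  have h3 : 3 ≤ n := by
    rw [← h.card_eq, ← Finset.card_univ]
    have := Finset.card_le_univ S
    rw [hS, ← Finset.card_univ] at this
    exact_mod_cast this
  rw [← h'.step, zero_add] at hσx
  have h01 : p 0 ≠ p 1 := fun e =>
    absurd (h'.inj_of_lt e (by omega) (by omega)) zero_ne_one
  obtain ⟨z, hz0, hz1, rfl⟩ := Finset.exists_eq_of_card_three hS hx hσx h01
  obtain ⟨f, hf⟩ := h'.exists_lift fun i =>
    if i = 0 then q z else if i % 2 = 1 then q (p 0) else q (p 1)
  have hq' : ({q (p 0), q (p 1), q z} : Finset (Fin 6)) = {0, 1, 2} := by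
    rw [← hq]; simp
  refine ⟨f, fun x => if x = p 0 then q (p 0) else if x = p 1 then q (p 1) else q z, ?_, ?_, ?_⟩
  · intro x hx
    simp only [Finset.mem_insert, Finset.mem_singleton] at hx
    rcases hx with rfl | rfl | rfl
    · simp
    · simp [h01.symm]
    · simp [hz0, hz1]
  · intro x hx y hy
    simp only [Finset.mem_insert, Finset.mem_singleton, not_or] at hx hy
    simp [hx, hy]
  · intro x
    obtain ⟨i, g0, g1, rfl⟩ := h'.exists_pos 0 x
    rw [zero_add] at g1
    rw [colorTriple, h'.pos_symm i, ← hq', hf i g0 g1]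
    by_cases hi0 : i = 0
    · subst hi0
      have e : p (0 - 1) = p (n - 1) := by
        rw [← h'.pos_add]; congr 1; ring
      have en : (n - 1) % 2 ≠ 1 := by obtain ⟨d, hd⟩ := hn; omega
      rw [e, hf _ (by omega) (by omega), if_pos rfl, if_neg (by omega), if_neg en, if_pos rfl]
      ext; simp; tauto
    have c0 : p i ≠ p 0 := fun e => hi0 (h'.inj_of_lt e (by omega) (by omega))
    rw [hf (i - 1) (by omega) (by omega), if_neg hi0, if_neg c0]
    by_cases hi1 : i = 1
    · subst hi1
      rw [if_pos rfl, if_pos (by norm_num), if_pos (by norm_num)]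
      ext; simp; tauto
    have c1 : p i ≠ p 1 := fun e => hi1 (h'.inj_of_lt e (by omega) (by omega))
    rw [if_neg c1, if_neg (show i - 1 ≠ 0 by omega)]
    rcases Int.emod_two_eq_zero_or_one i with e | e
    · rw [if_neg (by omega), if_pos (by omega)]
      ext; simp; tauto
    · rw [if_pos (by omega), if_neg (by omega)]

/-- An odd cycle with three pairwise nonconsecutive spokes has a spoke coloring. -/
theorem spokeColoring_of_nonconsecutive {X : Type} [Fintype X] {σ : Equiv.Perm X} {n : ℤ}
    {pos : ℤ → X} {m : X → X} (h : Track σ n pos) (hn : Odd n) {S : Finset X} (hS : S.card = 3)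
    (hadj : ∀ x ∈ S, σ x ∉ S) (h1 : ∀ x ∉ S, m x ∉ S) (h2 : ∀ x ∉ S, m (m x) = x)
    (h3 : ∀ x ∉ S, m x ≠ x) : SpokeColoring σ m S := by
  obtain ⟨x, y, z, hxy, hxz, hyz, hSe⟩ := Finset.card_eq_three.mp hS
  obtain ⟨p, h', rfl⟩ := h.exists_start x
  obtain ⟨i, i0, hi, rfl⟩ := h'.exists_pos 0 y
  obtain ⟨j, j0, hj, rfl⟩ := h'.exists_pos 0 z
  have i1 : i ≠ 0 := by rintro rfl; exact hxy rfl
  have j1 : j ≠ 0 := by rintro rfl; exact hxz rfl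
  have ij : i ≠ j := by rintro rfl; exact hyz rfl
  have key : ∀ P Q : ℤ, 0 < P → P < Q → Q < n → S = {p 0, p P, p Q} → SpokeColoring σ m S := by
    intro P Q hP hPQ hQ e
    subst e
    have a1 : P ≠ 1 := by
      rintro rfl
      exact hadj (p 0) (by simp) (by rw [← h'.step]; simp)
    have a2 : Q ≠ P + 1 := by
      rintro rfl
      exact hadj (p P) (by simp) (by rw [← h'.step]; simp)
    have a3 : n ≠ Q + 1 := by
      intro e
      refine hadj (p Q) (by simp) ?_
      have := h'.pos_add 0
      rw [zero_add, e] at this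
      rw [← h'.step, this]; simp
    have hc : Config σ n p P Q 0 m :=
      { track := h', odd := hn, hk := le_rfl, hP := by omega, hQ := by omega, hn := by omega
        rung := fun i _ _ => by omega, mate := h1, invol := h2, ne := h3 }
    exact hc.spokeColoring
  rcases lt_or_gt_of_ne ij with g | g
  · exact key i j (by omega) g (by omega) hSe
  · exact key j i (by omega) g (by omega) (by rw [hSe, Finset.pair_comm])

section Odd

variable {X Y : Type} {σ : Equiv.Perm X} {τ : Equiv.Perm Y} {μ : X ⊕ Y → X ⊕ Y} {a b : ℤ}
  {p : ℤ → X} {r : ℤ → Y}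

theorem mate_inr (hμ : ∀ x, μ (μ x) = x) {x : X} {y : Y} :
    μ (Sum.inr y) = Sum.inl x ↔ μ (Sum.inl x) = Sum.inr y :=
  ⟨fun h => by rw [← h, hμ], fun h => by rw [← h, hμ]⟩

theorem swapMate_swapMate_eq (μ : X ⊕ Y → X ⊕ Y) : swapMate (swapMate μ) = μ := by
  ext x; simp [swapMate]

theorem mem_spokes_swapMate [Fintype Y] (hμ : ∀ x, μ (μ x) = x) {y : Y} :
    y ∈ spokes (swapMate μ) ↔ ∃ x, μ (Sum.inl x) = Sum.inr y := by
  simp only [mem_spokes, swapMate_inl hμ]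

theorem mem_spokes_of_mate [Fintype X] {x : X} {y : Y} (h : μ (Sum.inl x) = Sum.inr y) :
    x ∈ spokes μ := mem_spokes.mpr ⟨y, h⟩

theorem mem_spokes_swapMate_of_mate [Fintype Y] (hμ : ∀ x, μ (μ x) = x) {x : X} {y : Y}
    (h : μ (Sum.inl x) = Sum.inr y) : y ∈ spokes (swapMate μ) :=
  (mem_spokes_swapMate hμ).mpr ⟨x, h⟩

theorem image_spokes [Fintype X] [Fintype Y] (hμ : ∀ x, μ (μ x) = x) {A : Type} [DecidableEq A]
    (q : Y → A) (d : A) :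
    (spokes μ).image (fun x => Sum.elim (fun _ => d) q (μ (Sum.inl x)))
      = (spokes (swapMate μ)).image q := by
  ext c
  simp only [Finset.mem_image, mem_spokes, mem_spokes_swapMate hμ]
  constructor
  · rintro ⟨x, ⟨y, h⟩, rfl⟩
    exact ⟨y, ⟨x, h⟩, by rw [h]; rfl⟩
  · rintro ⟨y, ⟨x, h⟩, rfl⟩
    exact ⟨x, ⟨y, h⟩, by rw [h]; rfl⟩

theorem card_spokes_swapMate_le [Fintype X] [Fintype Y] (hμ : ∀ x, μ (μ x) = x) :
    (spokes (swapMate μ)).card ≤ (spokes μ).card := by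
  have h := image_spokes hμ (some : Y → Option Y) none
  rw [← Finset.card_image_of_injective _ (Option.some_injective Y), ← h]
  exact Finset.card_image_le

theorem card_spokes_swapMate [Fintype X] [Fintype Y] (hμ : ∀ x, μ (μ x) = x) :
    (spokes (swapMate μ)).card = (spokes μ).card := by
  refine le_antisymm (card_spokes_swapMate_le hμ) ?_
  have := card_spokes_swapMate_le (swapMate_swapMate hμ)
  rwa [swapMate_swapMate_eq] at this

theorem normalModel_three [Fintype X] [Fintype Y] (hσ : Track σ a p) (hτ : Track τ b r)
    (ha : Odd a) (hb : Odd b) (hμ : ∀ x, μ (μ x) = x) (h3 : (spokes μ).card = 3)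
    (hX : ∃ x ∈ spokes μ, σ x ∈ spokes μ)
    (hY : ∃ y ∈ spokes (swapMate μ), τ y ∈ spokes (swapMate μ)) :
    NormalModel (Equiv.sumCongr σ τ) μ := by
  have h3' := (card_spokes_swapMate hμ).trans h3
  obtain ⟨q, hq⟩ : ∃ q : Y → Fin 6, (spokes (swapMate μ)).image q = {0, 1, 2} := by
    obtain ⟨x, y, z, hxy, hxz, hyz, e⟩ := Finset.card_eq_three.mp h3'
    refine ⟨fun w => if w = x then 0 else if w = y then 1 else 2, ?_⟩
    rw [e]
    simp [hxy.symm, hxz.symm, hyz.symm]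
  obtain ⟨f₁, g₁, h1, h2, h4⟩ := exists_three_coloring hσ ha h3 hX ((image_spokes hμ q 0).trans hq)
  obtain ⟨f₂, g₂, k1, k2, k4⟩ := exists_three_coloring hτ hb h3' hY hq
  have hT : ∀ z, colorTriple (Equiv.sumCongr σ τ) (Sum.elim f₁ f₂) (Sum.elim g₁ g₂) z
      = {0, 1, 2} := by
    rintro (x | y)
    · exact h4 x
    · exact k4 y
  have hsp : ∀ x y, μ (Sum.inl x) = Sum.inr y → g₁ x = g₂ y := fun x y h => by
    rw [h1 x (mem_spokes_of_mate h), k1 y (mem_spokes_swapMate_of_mate hμ h), h]; rfl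
  refine ⟨Sum.elim f₁ f₂, Sum.elim g₁ g₂, ?_, ?_, ?_, ?_⟩
  · rintro (x | y)
    · rcases h : μ (Sum.inl x) with x' | y
      · refine h2 _ ?_ _ ?_ <;> rw [mem_spokes]
        · rw [← h, hμ]; simp
        · rw [h]; simp
      · exact (hsp x y h).symm
    · rcases h : μ (Sum.inr y) with x | y'
      · exact hsp x y ((mate_inr hμ).mp h)
      · refine k2 _ ?_ _ ?_ <;> rw [mem_spokes_swapMate hμ] <;> rintro ⟨x, hx⟩ <;>
          rw [← mate_inr hμ] at hx
        · rw [← h, hμ] at hx; cases hx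
        · rw [h] at hx; cases hx
  · intro z; rw [hT]; rfl
  · intro z; rw [hT, hT]; exact PoorOrRich.self rfl
  · intro z; rw [hT, hT]; exact PoorOrRich.self rfl

theorem normalModel_triangle [Fintype X] [Fintype Y] (hσ : Track σ 3 p) (hτ : Track τ b r)
    (hb : Odd b) (hμ : ∀ x, μ (μ x) = x) (hne : ∀ x, μ x ≠ x) (hX : spokes μ = Finset.univ)
    (hY : ∀ y ∈ spokes (swapMate μ), τ y ∉ spokes (swapMate μ)) :
    NormalModel (Equiv.sumCongr σ τ) μ := by
  have hX3 : Fintype.card X = 3 := by exact_mod_cast hσ.card_eq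
  have h3 : (spokes μ).card = 3 := by rw [hX, Finset.card_univ, hX3]
  have hμ' := swapMate_swapMate hμ
  have hne' := swapMate_ne hne
  obtain ⟨f, g, h1, h2, h4, h5, h6, h7⟩ := spokeColoring_of_nonconsecutive
    (m := innerMate (swapMate μ)) hτ hb ((card_spokes_swapMate hμ).trans h3) hY
    (fun y hy => innerMate_not_mem_spokes hμ' hy) (fun y hy => innerMate_innerMate hμ' hy)
    (fun y hy => innerMate_ne hne' hy)
  set q : X → Fin 6 := fun x => Sum.elim (fun _ => 0) g (μ (Sum.inl x)) with hq
  have hqi := image_spokes hμ g 0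
  rw [hX] at hqi
  change Finset.univ.image q = _ at hqi
  have hall : ∀ x : X, ({σ.symm x, σ.symm (σ.symm x), x} : Finset X) = Finset.univ := by
    intro x
    obtain ⟨i, rfl⟩ := hσ.surj x
    refine Finset.eq_univ_of_card _ ?_
    rw [hσ.pos_symm, hσ.pos_symm, hX3, Finset.card_eq_three]
    have key : ∀ i j, p i = p j → i - j < 3 → j - i < 3 → i = j := fun i j h => hσ.inj_of_lt h
    refine ⟨_, _, _, ?_, ?_, ?_, rfl⟩ <;> intro e <;> have := key _ _ e <;> omega
  set F : X ⊕ Y → Fin 6 := Sum.elim (fun x => q (σ.symm x)) f with hF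
  set G : X ⊕ Y → Fin 6 := Sum.elim q g with hG
  have hT1 : ∀ x, colorTriple (Equiv.sumCongr σ τ) F G (Sum.inl x)
      = (spokes (swapMate μ)).image g := fun x => by
    rw [← hqi, ← hall x]
    simp [colorTriple, hF, hG]
  have hT2 : ∀ y, colorTriple (Equiv.sumCongr σ τ) F G (Sum.inr y) = colorTriple τ f g y :=
    fun y => rfl
  have hin : ∀ x, ∃ y, μ (Sum.inl x) = Sum.inr y := fun x => by
    rw [← mem_spokes, hX]; exact Finset.mem_univ x
  have hout : ∀ y y', μ (Sum.inr y) = Sum.inr y' →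
      y ∉ spokes (swapMate μ) ∧ innerMate (swapMate μ) y = y' := by
    intro y y' h
    constructor
    · rw [mem_spokes_swapMate hμ]
      rintro ⟨x, hx⟩
      rw [← mate_inr hμ, h] at hx
      cases hx
    · simp [innerMate, swapMate, h]
  refine ⟨F, G, ?_, ?_, ?_, ?_⟩
  · rintro (x | y)
    · obtain ⟨y, h⟩ := hin x
      simp [hG, hq, h]
    · rcases h : μ (Sum.inr y) with x | y'
      · simp [hG, hq, (mate_inr hμ).mp h]
      · obtain ⟨g1, g2⟩ := hout y y' h
        rw [← g2]
        exact h1 y g1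
  · rintro (x | y)
    · rw [hT1]; exact h6
    · exact h2 y
  · rintro (x | y)
    · rw [show Equiv.sumCongr σ τ (Sum.inl x) = Sum.inl (σ x) from rfl, hT1, hT1]
      exact PoorOrRich.self h6
    · exact h4 y
  · rintro (x | y)
    · obtain ⟨y, h⟩ := hin x
      rw [h, hT1, hT2]
      exact (h7 y (mem_spokes_swapMate_of_mate hμ h)).symm
    · rcases h : μ (Sum.inr y) with x | y'
      · rw [hT1, hT2]
        exact h7 y (mem_spokes_swapMate_of_mate hμ ((mate_inr hμ).mp h))
      · obtain ⟨g1, g2⟩ := hout y y' h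
        rw [← g2]
        exact h5 y g1

end Odd

section Tight

variable {X Y : Type} {σ : Equiv.Perm X} {τ : Equiv.Perm Y} {μ : X ⊕ Y → X ⊕ Y} {a b : ℤ}
  {p : ℤ → X} {r : ℤ → Y}

/-- Any two spokes are consecutive on the first or on the second side. -/
def Tight (σ : Equiv.Perm X) (τ : Equiv.Perm Y) (μ : X ⊕ Y → X ⊕ Y) : Prop :=
  ∀ x x' y y', x ≠ x' → μ (Sum.inl x) = Sum.inr y → μ (Sum.inl x') = Sum.inr y' →
    σ x = x' ∨ σ x' = x ∨ τ y = y' ∨ τ y' = y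

theorem Tight.swap (hμ : ∀ x, μ (μ x) = x) (h : Tight σ τ μ) : Tight τ σ (swapMate μ) := by
  intro y y' x x' hy h1 h2
  rw [swapMate_inl hμ] at h1 h2
  have hx : x ≠ x' := by
    rintro rfl
    exact hy (Sum.inr.inj (h1.symm.trans h2))
  have := h x x' y y' hx h1 h2
  tauto

theorem Tight.erase_subset [Fintype X] (hμ : ∀ x, μ (μ x) = x) (h : Tight σ τ μ) {x : X} {y : Y}
    (hy : μ (Sum.inl x) = Sum.inr y) :
    (spokes μ).erase x ⊆ {σ x, σ.symm x, Sum.elim id (fun _ => x) (μ (Sum.inr (τ y))),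
      Sum.elim id (fun _ => x) (μ (Sum.inr (τ.symm y)))} := by
  intro x' hx'
  obtain ⟨h1, h2⟩ := Finset.mem_erase.mp hx'
  obtain ⟨y', hy'⟩ := mem_spokes.mp h2
  have e := (mate_inr hμ).mpr hy'
  simp only [Finset.mem_insert, Finset.mem_singleton]
  rcases h x x' y y' h1.symm hy hy' with g | g | g | g
  · exact Or.inl g.symm
  · exact Or.inr (Or.inl (by rw [← g, Equiv.symm_apply_apply]))
  · right; right; left; rw [g, e]; rfl
  · right; right; right; rw [← g, Equiv.symm_apply_apply, e]; rfl

theorem Tight.card_le [Fintype X] (hμ : ∀ x, μ (μ x) = x) (h : Tight σ τ μ) :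
    (spokes μ).card ≤ 5 := by
  rcases (spokes μ).eq_empty_or_nonempty with e | ⟨x, hx⟩
  · rw [e]; simp
  obtain ⟨y, hy⟩ := mem_spokes.mp hx
  have := (Finset.card_le_card (h.erase_subset hμ hy)).trans Finset.card_le_four
  rw [Finset.card_erase_of_mem hx] at this
  omega

theorem Tight.spokes_eq_univ [Fintype X] (hσ : Track σ a p) (hμ : ∀ x, μ (μ x) = x)
    (h : Tight σ τ μ) (h5 : (spokes μ).card = 5) : spokes μ = Finset.univ := by
  refine hσ.closed_eq_univ (Finset.card_pos.mp (by omega)) fun x hx => ?_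
  obtain ⟨y, hy⟩ := mem_spokes.mp hx
  have := Finset.eq_of_subset_of_card_le (h.erase_subset hμ hy)
    (Finset.card_le_four.trans (by rw [Finset.card_erase_of_mem hx, h5]))
  exact Finset.mem_of_mem_erase (this ▸ Finset.mem_insert_self _ _)

/-- Embedding of five colors in six. -/
def emb (c : ZMod 5) : Fin 6 := Fin.castSucc (n := 5) c

theorem normalModel_five [Fintype X] [Fintype Y] (hσ : Track σ a p) (hτ : Track τ b r)
    (hμ : ∀ x, μ (μ x) = x) (h : Tight σ τ μ) (h5 : (spokes μ).card = 5) :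
    NormalModel (Equiv.sumCongr σ τ) μ := by
  have hX := h.spokes_eq_univ hσ hμ h5
  have hY := (h.swap hμ).spokes_eq_univ hτ (swapMate_swapMate hμ)
    ((card_spokes_swapMate hμ).trans h5)
  have hin : ∀ x, ∃ y, μ (Sum.inl x) = Sum.inr y := fun x => by
    rw [← mem_spokes, hX]; exact Finset.mem_univ x
  have hout : ∀ y, ∃ x, μ (Sum.inl x) = Sum.inr y := fun y => by
    rw [← mem_spokes_swapMate hμ, hY]; exact Finset.mem_univ y
  obtain ⟨ι, hι⟩ := hσ.exists_potential (θ := fun _ => (1 : ZMod 5)) (by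
    rw [Finset.sum_const, ← hX, h5]; rfl)
  have hι' : ∀ x, ι (σ.symm x) = ι x - 1 := fun x => by
    have := hι (σ.symm x)
    rw [Equiv.apply_symm_apply] at this
    rw [this]; ring
  set ε : X ⊕ Y → ZMod 5 := Sum.elim ι fun y => Sum.elim ι (fun _ => 0) (μ (Sum.inr y)) with hε
  have hεμ : ∀ z, ε (μ z) = ε z := by
    have key : ∀ x y, μ (Sum.inl x) = Sum.inr y → ε (Sum.inl x) = ε (Sum.inr y) := fun x y g => by
      simp [hε, (mate_inr hμ).mpr g]
    rintro (x | y)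
    · obtain ⟨y, g⟩ := hin x
      rw [key x y g, g]
    · obtain ⟨x, g⟩ := hout y
      rw [← key x y g, (mate_inr hμ).mpr g]
  have hpent : ∀ y, (ε (Sum.inr (τ y)) = ε (Sum.inr y) + 2 ∧
      ε (Sum.inr (τ.symm y)) = ε (Sum.inr y) - 2) ∨ (ε (Sum.inr (τ y)) = ε (Sum.inr y) - 2 ∧
      ε (Sum.inr (τ.symm y)) = ε (Sum.inr y) + 2) := by
    intro y
    obtain ⟨x, hx⟩ := hout y
    have hεy : ε (Sum.inr y) = ι x := by rw [← hx, hεμ]; rfl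
    have hsurj : ∀ k : ℕ, ∃ z, ι z = ι x + k := by
      intro k
      induction k with
      | zero => exact ⟨x, by simp⟩
      | succ k ih =>
        obtain ⟨z, hz⟩ := ih
        exact ⟨σ z, by rw [hι, hz]; push_cast; ring⟩
    have hmem : ∀ c : ZMod 5, c = ι x ∨ c = ι x + 1 ∨ c = ι x - 1 ∨ c = ε (Sum.inr (τ y)) ∨
        c = ε (Sum.inr (τ.symm y)) := by
      intro c
      obtain ⟨z, hz⟩ := hsurj (c - ι x).val
      rw [ZMod.natCast_zmod_val, add_sub_cancel] at hz
      subst hz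
      by_cases hzx : z = x
      · exact Or.inl (by rw [hzx])
      · obtain ⟨w, hw⟩ := hin z
        have e : ε (Sum.inr w) = ι z := by rw [← hw, hεμ]; rfl
        rcases h x z y w (Ne.symm hzx) hx hw with g | g | g | g
        · right; left; rw [← g, hι]
        · right; right; left; rw [← g, hι]; ring
        · right; right; right; left; rw [g, e]
        · right; right; right; right; rw [← g, Equiv.symm_apply_apply, e]
    have fin : ∀ i u w : ZMod 5, (∀ c, c = i ∨ c = i + 1 ∨ c = i - 1 ∨ c = u ∨ c = w) →
        (u = i + 2 ∧ w = i - 2) ∨ (u = i - 2 ∧ w = i + 2) := by decide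
    rw [hεy]
    exact fin _ _ _ hmem
  have hT1 : ∀ x, colorTriple (Equiv.sumCongr σ τ)
      (fun z => emb (3 * (ε z + ε (Equiv.sumCongr σ τ z)))) (fun z => emb (ε z)) (Sum.inl x)
      = {emb (ι x + 3), emb (ι x + 2), emb (ι x)} := by
    intro x
    have e1 : (3 : ZMod 5) * (ι x + ι (σ x)) = ι x + 3 := by
      rw [hι]; generalize ι x = i; revert i; decide
    have e2 : (3 : ZMod 5) * (ι (σ.symm x) + ι x) = ι x + 2 := by
      rw [hι']; generalize ι x = i; revert i; decide
    rw [← e1, ← e2]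
    simp [colorTriple, hε]
  have hT2 : ∀ y, colorTriple (Equiv.sumCongr σ τ)
      (fun z => emb (3 * (ε z + ε (Equiv.sumCongr σ τ z)))) (fun z => emb (ε z)) (Sum.inr y)
      = {emb (ε (Sum.inr y) + 1), emb (ε (Sum.inr y) - 1), emb (ε (Sum.inr y))} := by
    intro y
    have e : colorTriple (Equiv.sumCongr σ τ)
      (fun z => emb (3 * (ε z + ε (Equiv.sumCongr σ τ z)))) (fun z => emb (ε z)) (Sum.inr y)
      = {emb (3 * (ε (Sum.inr y) + ε (Sum.inr (τ y)))),
        emb (3 * (ε (Sum.inr (τ.symm y)) + ε (Sum.inr y))), emb (ε (Sum.inr y))} := by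
      simp [colorTriple]
    rw [e]
    have key : ∀ i : ZMod 5,
        ({emb (3 * (i + (i + 2))), emb (3 * (i - 2 + i)), emb i} : Finset (Fin 6))
          = {emb (i + 1), emb (i - 1), emb i} ∧
        ({emb (3 * (i + (i - 2))), emb (3 * (i + 2 + i)), emb i} : Finset (Fin 6))
          = {emb (i + 1), emb (i - 1), emb i} := by decide
    rcases hpent y with ⟨g1, g2⟩ | ⟨g1, g2⟩ <;> rw [g1, g2]
    · exact (key _).1
    · exact (key _).2
  have fin : ∀ i : ZMod 5, ({emb (i + 3), emb (i + 2), emb i} : Finset (Fin 6)).card = 3 ∧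
      ({emb (i + 1), emb (i - 1), emb i} : Finset (Fin 6)).card = 3 ∧
      PoorOrRich {emb (i + 3), emb (i + 2), emb i}
        {emb (i + 1 + 3), emb (i + 1 + 2), emb (i + 1)} ∧
      PoorOrRich {emb (i + 1), emb (i - 1), emb i}
        {emb (i + 2 + 1), emb (i + 2 - 1), emb (i + 2)} ∧
      PoorOrRich {emb (i + 1), emb (i - 1), emb i}
        {emb (i - 2 + 1), emb (i - 2 - 1), emb (i - 2)} ∧
      PoorOrRich {emb (i + 3), emb (i + 2), emb i} {emb (i + 1), emb (i - 1), emb i} := by decide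
  refine ⟨fun z => emb (3 * (ε z + ε (Equiv.sumCongr σ τ z))), fun z => emb (ε z),
    fun z => congrArg emb (hεμ z), ?_, ?_, ?_⟩
  · rintro (x | y)
    · rw [hT1]; exact (fin _).1
    · rw [hT2]; exact (fin _).2.1
  · rintro (x | y)
    · rw [show Equiv.sumCongr σ τ (Sum.inl x) = Sum.inl (σ x) from rfl, hT1, hT1, hι]
      exact (fin _).2.2.1
    · rw [show Equiv.sumCongr σ τ (Sum.inr y) = Sum.inr (τ y) from rfl, hT2, hT2]
      rcases hpent y with ⟨g1, -⟩ | ⟨g1, -⟩ <;> rw [g1]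
      · exact (fin _).2.2.2.1
      · exact (fin _).2.2.2.2.1
  · have key : ∀ x y, μ (Sum.inl x) = Sum.inr y → ε (Sum.inr y) = ι x := fun x y g => by
      rw [← g, hεμ]; rfl
    rintro (x | y)
    · obtain ⟨y, g⟩ := hin x
      rw [g, hT1, hT2, key x y g]
      exact (fin _).2.2.2.2.2
    · obtain ⟨x, g⟩ := hout y
      rw [(mate_inr hμ).mpr g, hT1, hT2, key x y g]
      exact (fin _).2.2.2.2.2.symm

theorem normalModel_of_card_three [Fintype X] [Fintype Y] (hσ : Track σ a p) (hτ : Track τ b r)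
    (hb : Odd b) (hμ : ∀ x, μ (μ x) = x) (hne : ∀ x, μ x ≠ x) (h : Tight σ τ μ)
    (h3 : (spokes μ).card = 3) (hY : ∀ y ∈ spokes (swapMate μ), τ y ∉ spokes (swapMate μ)) :
    NormalModel (Equiv.sumCongr σ τ) μ := by
  have hadj : ∀ x ∈ spokes μ, ∀ x' ∈ spokes μ, x ≠ x' → σ x = x' ∨ σ x' = x := by
    intro x hx x' hx' hxx
    obtain ⟨y, hy⟩ := mem_spokes.mp hx
    obtain ⟨y', hy'⟩ := mem_spokes.mp hx'
    have g := mem_spokes_swapMate_of_mate hμ hy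
    have g' := mem_spokes_swapMate_of_mate hμ hy'
    rcases h x x' y y' hxx hy hy' with e | e | e | e
    · exact Or.inl e
    · exact Or.inr e
    · exact absurd (e ▸ g') (hY y g)
    · exact absurd (e ▸ g) (hY y' g')
  have hX : spokes μ = Finset.univ := by
    refine hσ.closed_eq_univ (Finset.card_pos.mp (by omega)) fun x hx => ?_
    obtain ⟨x', hx', h1⟩ := Finset.exists_mem_ne (s := spokes μ) (by omega) x
    obtain ⟨x'', h2, h4, e⟩ := Finset.exists_eq_of_card_three h3 hx hx' h1.symm
    have hx'' : x'' ∈ spokes μ := by rw [e]; simp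
    rcases hadj x hx x' hx' h1.symm with g | g
    · rwa [g]
    rcases hadj x hx x'' hx'' h2.symm with g' | g'
    · rwa [g']
    · exact absurd (σ.injective (g'.trans g.symm)) h4
  have ha : a = 3 := by rw [← hσ.card_eq, ← Finset.card_univ, ← hX, h3]; rfl
  subst ha
  exact normalModel_triangle hσ hτ hb hμ hne hX hY

/-- Two odd cycles joined by a matching with more than one spoke have a normal coloring. -/
theorem normalModel_odd_cycles [Fintype X] [Fintype Y] (hσ : Track σ a p) (hτ : Track τ b r)
    (ha : Odd a) (hb : Odd b) (hμ : ∀ x, μ (μ x) = x) (hne : ∀ x, μ x ≠ x)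
    (h1 : (spokes μ).card ≠ 1) : NormalModel (Equiv.sumCongr σ τ) μ := by
  by_cases h : Tight σ τ μ
  · have hodd : Odd (spokes μ).card := by
      rw [← hσ.card_eq] at ha
      have ha' : Odd (Fintype.card X) := by exact_mod_cast ha
      rw [← ZMod.natCast_eq_one_iff_odd] at ha' ⊢
      rw [card_spokes hμ hne, ha']
    have hle := h.card_le hμ
    have h35 : (spokes μ).card = 3 ∨ (spokes μ).card = 5 := by
      obtain ⟨d, hd⟩ := hodd
      omega
    rcases h35 with h3 | h5
    · by_cases hY : ∃ y ∈ spokes (swapMate μ), τ y ∈ spokes (swapMate μ)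
      · by_cases hX : ∃ x ∈ spokes μ, σ x ∈ spokes μ
        · exact normalModel_three hσ hτ ha hb hμ h3 hX hY
        · push Not at hX
          rw [← swapMate_swapMate_eq μ] at hX
          exact normalModel_swap (normalModel_of_card_three hτ hσ ha (swapMate_swapMate hμ)
            (swapMate_ne hne) (h.swap hμ) ((card_spokes_swapMate hμ).trans h3) hX)
      · push Not at hY
        exact normalModel_of_card_three hσ hτ hb hμ hne h h3 hY
    · exact normalModel_five hσ hτ hμ h h5
  · unfold Tight at h
    push Not at h
    obtain ⟨x, x', y, y', hx, hy, hy', g1, g2, g3, g4⟩ := h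
    exact normalModel_of_pair hσ hτ hμ ha hb hx hy hy' g1 g2 g3 g4

end Tight

section Graph

variable {V : Type}

theorem exists_traversal [Finite V] {F : SimpleGraph V} (hF : ∀ v, (F.neighborSet v).ncard = 2)
    (v : V) : ∃ (n : ℤ) (p : ℤ → V), 3 ≤ n ∧ (∀ i j, p i = p j ↔ n ∣ i - j) ∧
      (∀ u, F.Reachable v u ↔ ∃ i, p i = u) ∧
      ∀ i u, F.Adj (p i) u ↔ u = p (i + 1) ∨ u = p (i - 1) := by
  obtain ⟨w, hw, hs⟩ := SimpleGraph.IsCycles.exists_cycle_toSubgraph_verts_eq_connectedComponentSupp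
    (c := F.connectedComponentMk v) (fun u _ => hF u) rfl
    (Set.nonempty_of_ncard_ne_zero (by rw [hF]; norm_num))
  have h3 := hw.three_le_length
  set ℓ := w.length with hℓ
  set p : ℤ → V := fun i => w.getVert (i % ℓ).toNat with hp
  have hmod : ∀ i : ℤ, 0 ≤ i % ℓ ∧ i % ℓ < ℓ := fun i =>
    ⟨Int.emod_nonneg _ (by omega), Int.emod_lt_of_pos _ (by omega)⟩
  have hinj : ∀ i j, p i = p j ↔ (ℓ : ℤ) ∣ i - j := by
    intro i j
    have e : (ℓ : ℤ) ∣ i - j ↔ j % ℓ = i % ℓ := (Int.modEq_iff_dvd (n := ℓ) (a := j) (b := i)).symm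
    rw [e]
    obtain ⟨a1, a2⟩ := hmod i
    obtain ⟨b1, b2⟩ := hmod j
    constructor
    · intro h
      have := hw.getVert_injOn' (by rw [Set.mem_ofPred_eq]; omega)
        (by rw [Set.mem_ofPred_eq]; omega) h
      omega
    · intro h
      simp only [hp, h]
  have hstep : ∀ i, F.Adj (p i) (p (i + 1)) := by
    intro i
    obtain ⟨a1, a2⟩ := hmod i
    have e := Int.emod_add_mul_ediv i ℓ
    have hadj := w.adj_getVert_succ (i := (i % ℓ).toNat) (by omega)
    have e2 : (i + 1) % ℓ = (i % ℓ + 1) % ℓ := by simp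
    by_cases hlt : i % ℓ + 1 < ℓ
    · rw [Int.emod_eq_of_lt (by omega) hlt] at e2
      have : ((i + 1) % ℓ).toNat = (i % ℓ).toNat + 1 := by omega
      simp only [hp, this]
      exact hadj
    · have e3 : i % ℓ + 1 = ℓ := by omega
      rw [e3, Int.emod_self] at e2
      have e4 : (i % ℓ).toNat + 1 = w.length := by omega
      rw [e4, SimpleGraph.Walk.getVert_length] at hadj
      simp only [hp, e2]
      simpa using hadj
  refine ⟨ℓ, p, by exact_mod_cast h3, hinj, ?_, ?_⟩
  · intro u
    have : F.Reachable v u ↔ u ∈ w.support := by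
      rw [← SimpleGraph.Walk.mem_verts_toSubgraph, hs, SimpleGraph.ConnectedComponent.mem_supp_iff,
        SimpleGraph.ConnectedComponent.eq, SimpleGraph.reachable_comm]
    rw [this, SimpleGraph.Walk.mem_support_iff_exists_getVert]
    constructor
    · rintro ⟨k, rfl, hk⟩
      rcases hk.lt_or_eq with g | g
      · exact ⟨k, by simp only [hp]; rw [Int.emod_eq_of_lt (by omega) (by omega)]; simp⟩
      · exact ⟨0, by rw [g]; simp [hp]⟩
    · rintro ⟨i, rfl⟩
      obtain ⟨a1, a2⟩ := hmod i
      exact ⟨_, rfl, by omega⟩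
  · intro i u
    have hne : p (i + 1) ≠ p (i - 1) := fun h => by
      have := Int.le_of_dvd (by omega) ((hinj _ _).mp h)
      omega
    have hsub : ({p (i + 1), p (i - 1)} : Set V) ⊆ F.neighborSet (p i) := by
      rintro x (rfl | rfl)
      · exact hstep i
      · have := hstep (i - 1)
        rw [sub_add_cancel] at this
        exact this.symm
    have := Set.eq_of_subset_of_ncard_le hsub (by rw [hF, Set.ncard_pair hne]) (Set.toFinite _)
    rw [← SimpleGraph.mem_neighborSet, ← this]
    rfl

theorem exists_track {X : Type} {n : ℤ} (hn : 0 < n) {p : ℤ → X} (hs : ∀ x, ∃ i, p i = x)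
    (hinj : ∀ i j, p i = p j ↔ n ∣ i - j) : ∃ σ : Equiv.Perm X, Track σ n p := by
  choose idx hidx using hs
  have key : ∀ i c, p (idx (p i) + c) = p (i + c) := fun i c => by
    rw [hinj, add_sub_add_right_eq_sub, ← hinj, hidx]
  refine ⟨⟨fun x => p (idx x + 1), fun x => p (idx x - 1), fun x => ?_, fun x => ?_⟩,
    hn, fun x => ⟨idx x, hidx x⟩, hinj, fun i => (key i 1).symm⟩
  · show p (idx (p (idx x + 1)) + -1) = x
    rw [key, add_neg_cancel_right, hidx]
  · show p (idx (p (idx x - 1)) + 1) = x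
    rw [key, sub_add_cancel, hidx]

/-- A component of a 2-regular graph is traversed by a cyclic permutation. -/
theorem exists_component_track [Finite V] {F : SimpleGraph V}
    (hF : ∀ v, (F.neighborSet v).ncard = 2) (v : V) :
    ∃ (n : ℤ) (σ : Equiv.Perm {u // F.Reachable v u}) (p : ℤ → {u // F.Reachable v u}),
      Track σ n p ∧ (∀ x, σ x ≠ σ.symm x) ∧
      ∀ x : {u // F.Reachable v u}, ∀ u, F.Adj x u ↔ u = σ x ∨ u = σ.symm x := by
  obtain ⟨n, p, h3, hinj, hr, hadj⟩ := exists_traversal hF v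
  let P : ℤ → {u // F.Reachable v u} := fun i => ⟨p i, (hr _).mpr ⟨i, rfl⟩⟩
  have hP : ∀ i j, P i = P j ↔ n ∣ i - j := fun i j => by
    rw [← hinj, Subtype.mk.injEq]
  obtain ⟨σ, hσ⟩ := exists_track (by omega) (fun x : {u // F.Reachable v u} => by
    obtain ⟨i, hi⟩ := (hr _).mp x.2
    exact ⟨i, Subtype.ext hi⟩) hP
  refine ⟨n, σ, P, hσ, fun x => ?_, fun x u => ?_⟩ <;> obtain ⟨i, rfl⟩ := hσ.surj x
  · rw [hσ.pos_symm, ← hσ.step, Ne, hP]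
    intro h
    have := Int.le_of_dvd (by omega) h
    omega
  · rw [hσ.pos_symm, ← hσ.step]
    exact hadj i u

/-- The neighbor of each vertex outside a 2-factor of a cubic graph. -/
theorem exists_third_neighbor [Finite V] {G F : SimpleGraph V} (hFG : F ≤ G)
    (hG : ∀ v, (G.neighborSet v).ncard = 3) (hF : ∀ v, (F.neighborSet v).ncard = 2) :
    ∃ m : V → V, (∀ u w, G.Adj u w ↔ F.Adj u w ∨ w = m u) ∧ ∀ u, ¬ F.Adj u (m u) := by
  have key : ∀ u, ∃ w, G.neighborSet u \ F.neighborSet u = {w} := fun u => by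
    have hsub : F.neighborSet u ⊆ G.neighborSet u := fun w hw => hFG hw
    rw [← Set.ncard_eq_one, Set.ncard_sdiff hsub, hG, hF]
  choose m hm using key
  have hm' : ∀ u w, (G.Adj u w ∧ ¬ F.Adj u w) ↔ w = m u := fun u w => by
    rw [← Set.mem_singleton_iff, ← hm]; rfl
  refine ⟨m, fun u w => ?_, fun u => ((hm' u _).mpr rfl).2⟩
  rw [← hm']
  have := @hFG u w
  tauto

end Graph

section TwoFactor

variable {V : Type} {G F : SimpleGraph V} {m : V → V}

theorem third_neighbor_involutive (hm : ∀ u w, G.Adj u w ↔ F.Adj u w ∨ w = m u)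
    (hFm : ∀ u, ¬ F.Adj u (m u)) (u : V) : m (m u) = u := by
  have h : G.Adj (m u) u := ((hm u (m u)).mpr (Or.inr rfl)).symm
  rcases (hm _ _).mp h with h | h
  · exact absurd h.symm (hFm u)
  · exact h.symm

theorem third_neighbor_ne (hm : ∀ u w, G.Adj u w ↔ F.Adj u w ∨ w = m u) (u : V) : m u ≠ u :=
  ((hm u (m u)).mpr (Or.inr rfl)).ne.symm

theorem hasNormalColoring_of_model [Fintype V] (hm : ∀ u w, G.Adj u w ↔ F.Adj u w ∨ w = m u)
    (hFm : ∀ u, ¬ F.Adj u (m u)) {W : Type} (e : W ≃ V) {σ : Equiv.Perm W}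
    (hσ : ∀ x, σ x ≠ σ.symm x)
    (hF : ∀ x y, F.Adj (e x) (e y) ↔ y = σ x ∨ y = σ.symm x)
    (h : NormalModel σ fun x => e.symm (m (e x))) : HasNormalColoring G 6 := by
  refine h.hasNormalColoring e (fun x y => ?_) (fun x => ?_) hσ fun x hx => ?_
  · rw [hm, hF, Equiv.eq_symm_apply, Equiv.eq_symm_apply, or_assoc, eq_comm (a := σ y)]
  · simp [third_neighbor_involutive hm hFm]
  · refine hFm (e x) ?_
    have := (hF x (e.symm (m (e x)))).mpr (Or.inl hx)
    rwa [Equiv.apply_symm_apply] at this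

/-- The vertices of a graph with exactly two components. -/
noncomputable def twoComponents (F : SimpleGraph V) {v w : V} (hvw : ¬ F.Reachable v w)
    (hall : ∀ u, F.Reachable v u ∨ F.Reachable w u) :
    {u // F.Reachable v u} ⊕ {u // F.Reachable w u} ≃ V :=
  Equiv.ofBijective (Sum.elim Subtype.val Subtype.val) (by
    constructor
    · rintro (⟨x, hx⟩ | ⟨x, hx⟩) (⟨y, hy⟩ | ⟨y, hy⟩) (rfl : x = y)
      · rfl
      · exact absurd (hx.trans hy.symm) hvw
      · exact absurd (hy.trans hx.symm) hvw
      · rfl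
    · intro u
      rcases hall u with h | h
      · exact ⟨Sum.inl ⟨u, h⟩, rfl⟩
      · exact ⟨Sum.inr ⟨u, h⟩, rfl⟩)

theorem card_spokes_ne_one (hG : G.Bridgeless) (hm : ∀ u w, G.Adj u w ↔ F.Adj u w ∨ w = m u)
    {X Y : Type} [Fintype X] (e : X ⊕ Y ≃ V)
    (hF : ∀ x y, ¬ F.Adj (e (Sum.inl x)) (e (Sum.inr y))) :
    (spokes fun z => e.symm (m (e z))).card ≠ 1 := by
  intro h
  obtain ⟨x, hx⟩ := Finset.card_eq_one.mp h
  have hmem : ∀ x', (∃ y, e.symm (m (e (Sum.inl x'))) = Sum.inr y) ↔ x' = x := fun x' => by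
    have := Finset.ext_iff.mp hx x'
    rwa [mem_spokes, Finset.mem_singleton] at this
  obtain ⟨y, hy⟩ := (hmem x).mpr rfl
  refine hG s(e (Sum.inl x), e (Sum.inr y)) (SimpleGraph.isBridge_iff.mpr fun hr => ?_)
  rw [SimpleGraph.reachable_iff_reflTransGen] at hr
  have key : ∀ u, Relation.ReflTransGen
      (G.deleteEdges {s(e (Sum.inl x), e (Sum.inr y))}).Adj (e (Sum.inl x)) u →
      ∃ x', u = e (Sum.inl x') := by
    intro u hu
    induction hu with
    | refl => exact ⟨x, rfl⟩
    | tail _ hadj ih =>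
      rename_i b c _
      obtain ⟨x', rfl⟩ := ih
      rw [SimpleGraph.deleteEdges_adj] at hadj
      obtain ⟨hadj, hdel⟩ := hadj
      rcases hz : e.symm c with x'' | y'
      · exact ⟨x'', by rw [← hz, Equiv.apply_symm_apply]⟩
      · obtain rfl : c = e (Sum.inr y') := by rw [← hz, Equiv.apply_symm_apply]
        rcases (hm _ _).mp hadj with g | g
        · exact absurd g (hF _ _)
        · have hs : e.symm (m (e (Sum.inl x'))) = Sum.inr y' := by
            rw [← g, Equiv.symm_apply_apply]
          obtain rfl := (hmem x').mp ⟨_, hs⟩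
          obtain rfl : y = y' := Sum.inr.inj (hy.symm.trans hs)
          exact absurd rfl hdel
  obtain ⟨x', hx'⟩ := key _ hr
  exact absurd (e.injective hx') (by simp)

theorem hasNormalColoring_of_connected [Fintype V] (hF : ∀ v, (F.neighborSet v).ncard = 2)
    (hm : ∀ u w, G.Adj u w ↔ F.Adj u w ∨ w = m u) (hFm : ∀ u, ¬ F.Adj u (m u)) {v : V}
    (hv : ∀ u, F.Reachable v u) : HasNormalColoring G 6 := by
  obtain ⟨n, σ, p, hσ, hne, hadj⟩ := exists_component_track hF v
  refine hasNormalColoring_of_model hm hFm (Equiv.subtypeUnivEquiv hv) hne (fun x y => ?_) ?_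
  · rw [Subtype.ext_iff, Subtype.ext_iff]
    exact hadj x y
  · refine normalModel_one_cycle hσ (fun x => ?_) fun x hx => ?_
    · simp [third_neighbor_involutive hm hFm]
    · rw [Equiv.symm_apply_eq] at hx
      exact third_neighbor_ne hm _ hx

theorem hasNormalColoring_of_two_components [Fintype V] (hG : G.Bridgeless)
    (hF : ∀ v, (F.neighborSet v).ncard = 2) (hm : ∀ u w, G.Adj u w ↔ F.Adj u w ∨ w = m u)
    (hFm : ∀ u, ¬ F.Adj u (m u)) {v w : V} (hvw : ¬ F.Reachable v w)
    (hall : ∀ u, F.Reachable v u ∨ F.Reachable w u) : HasNormalColoring G 6 := by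
  obtain ⟨a, σ, p, hσ, hσne, hσadj⟩ := exists_component_track hF v
  obtain ⟨b, τ, r, hτ, hτne, hτadj⟩ := exists_component_track hF w
  set e := twoComponents F hvw hall with he
  have hl : ∀ x, e (Sum.inl x) = x := fun x => rfl
  have hr : ∀ y, e (Sum.inr y) = y := fun y => rfl
  have hcross : ∀ x y, ¬ F.Adj (e (Sum.inl x)) (e (Sum.inr y)) := fun x y h =>
    hvw (x.2.trans (h.reachable.trans y.2.symm))
  have hμ : ∀ z, e.symm (m (e (e.symm (m (e z))))) = z := fun z => by
    simp [third_neighbor_involutive hm hFm]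
  have hne : ∀ z, e.symm (m (e z)) ≠ z := fun z hz =>
    third_neighbor_ne hm _ ((Equiv.symm_apply_eq e).mp hz)
  refine hasNormalColoring_of_model hm hFm e (σ := Equiv.sumCongr σ τ) ?_ ?_ ?_
  · rintro (x | y) h
    · exact hσne x (Sum.inl.inj h)
    · exact hτne y (Sum.inr.inj h)
  · rintro (x | y) (x' | y')
    · rw [hl, hl, hσadj]
      simp [Subtype.ext_iff]
    · simpa using hcross x y'
    · simpa using fun h => hcross x' y (SimpleGraph.Adj.symm h)
    · rw [hr, hr, hτadj]
      simp [Subtype.ext_iff]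
  · have hpar := card_spokes (μ := fun z => e.symm (m (e z))) hμ hne
    have hpar' := card_spokes (swapMate_swapMate hμ) (swapMate_ne hne)
    rw [card_spokes_swapMate hμ, hpar, ZMod.natCast_eq_natCast_iff'] at hpar'
    have ha := hσ.card_eq
    have hb := hτ.card_eq
    rcases Int.even_or_odd a with ea | oa
    · have eb : Even b := by
        rw [Int.even_iff] at *
        omega
      exact normalModel_even_cycles hσ hτ ea eb
    · have ob : Odd b := by
        rw [Int.odd_iff] at *
        omega
      exact normalModel_odd_cycles hσ hτ oa ob hμ hne (card_spokes_ne_one hG hm e hcross)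

end TwoFactor

/-- Every bridgeless cubic graph that is not isomorphic to the Petersen graph and contains
a 2-factor with at most two connected components admits a normal 6-edge-coloring. -/
theorem stmt_11 {V : Type} [Fintype V] [DecidableEq V] (G : SimpleGraph V)
    (hbl : G.Bridgeless) (hcubic : G.IsRegularOfDegree 3)
    (hnotpet : ¬ Nonempty (G ≃g PetersenGraph))
    (h2f : ∃ H : G.Subgraph, H.IsSpanning ∧ (∀ v : V, H.degree v = 2) ∧
      ∃ S : Finset V, S.card ≤ 2 ∧ ∀ v : V, ∃ u ∈ S, H.spanningCoe.Reachable u v) :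
    HasNormalColoring G 6 := by
  obtain ⟨H, -, hH, S, hS, hreach⟩ := h2f
  have hF : ∀ v, (H.spanningCoe.neighborSet v).ncard = 2 := fun v => by
    have : H.spanningCoe.neighborSet v = H.neighborSet v := rfl
    rw [this, ← hH v, SimpleGraph.Subgraph.degree, Set.ncard_eq_toFinset_card', Set.toFinset_card]
  have hG : ∀ v, (G.neighborSet v).ncard = 3 := fun v => by
    rw [← hcubic v, ← SimpleGraph.card_neighborSet_eq_degree, Set.ncard_eq_toFinset_card',
      Set.toFinset_card]
  obtain ⟨m, hm, hFm⟩ := exists_third_neighbor H.spanningCoe_le hG hF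
  rcases isEmpty_or_nonempty V with hV | ⟨⟨v⟩⟩
  · exact ⟨fun _ => 0, fun u => isEmptyElim u, fun u => isEmptyElim u⟩
  by_cases hv : ∀ u, H.spanningCoe.Reachable v u
  · exact hasNormalColoring_of_connected hF hm hFm hv
  push Not at hv
  obtain ⟨w, hw⟩ := hv
  refine hasNormalColoring_of_two_components hbl hF hm hFm hw fun u => ?_
  obtain ⟨s, hs, hsv⟩ := hreach v
  obtain ⟨t, ht, htw⟩ := hreach w
  obtain ⟨x, hx, hxu⟩ := hreach u
  have hst : s ≠ t := by
    rintro rfl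
    exact hw (hsv.symm.trans htw)
  have hSe : ({s, t} : Finset V) = S :=
    Finset.eq_of_subset_of_card_le (by simp [Finset.insert_subset_iff, hs, ht])
      (by rwa [Finset.card_pair hst])
  rw [← hSe, Finset.mem_insert, Finset.mem_singleton] at hx
  rcases hx with rfl | rfl
  · exact Or.inl (hsv.symm.trans hxu)
  · exact Or.inr (htw.symm.trans hxu)
end

section
/- For every perfect matching M of the Petersen graph, there is no non-conflicting nowhere-zero Z2×Z2 flow with respect to M. -/
open scoped Classical

/-- The vertices of the Petersen graph. -/
abbrev PetersenVertex : Type := {s : Finset (Fin 5) // s.card = 2}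

namespace PetersenGraph

theorem adj_iff (a b : PetersenVertex) : PetersenGraph.Adj a b ↔ Disjoint a.1 b.1 := by
  simp only [PetersenGraph, SimpleGraph.fromRel_adj, disjoint_comm (a := b.1), or_self,
    and_iff_right_iff_imp]
  rintro h rfl
  have h2 := a.2
  simp [(Finset.disjoint_self_iff_empty _).mp h] at h2

instance decidableAdj : DecidableRel PetersenGraph.Adj :=
  fun a b => decidable_of_iff _ (adj_iff a b).symm

set_option synthInstance.maxHeartbeats 400000 in
set_option synthInstance.maxSize 4000 in
/-- Three distinct neighbours of a vertex are all its neighbours. -/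
theorem eq_or_eq_or_eq_of_adj : ∀ a x : PetersenVertex, PetersenGraph.Adj a x →
    ∀ y, PetersenGraph.Adj a y → x ≠ y → ∀ z, PetersenGraph.Adj a z → x ≠ z → y ≠ z →
    ∀ w, PetersenGraph.Adj a w → w = x ∨ w = y ∨ w = z := by
  decide +kernel

theorem exists_two_other_neighbors : ∀ a x : PetersenVertex, PetersenGraph.Adj a x →
    ∃ y, PetersenGraph.Adj a y ∧ x ≠ y ∧ ∃ z, PetersenGraph.Adj a z ∧ x ≠ z ∧ y ≠ z := by
  decide +kernel

set_option synthInstance.maxHeartbeats 400000 in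
set_option synthInstance.maxSize 4000 in
/-- Every path with three edges closes up to a five-cycle. -/
theorem exists_adj_adj_of_path : ∀ a b : PetersenVertex, PetersenGraph.Adj a b →
    ∀ c, PetersenGraph.Adj b c → a ≠ c → ∀ d, PetersenGraph.Adj c d → b ≠ d →
    ∃ r, PetersenGraph.Adj d r ∧ PetersenGraph.Adj r a ∧ [a, b, c, d, r].Nodup := by
  decide +kernel

set_option synthInstance.maxHeartbeats 400000 in
set_option synthInstance.maxSize 4000 in
/-- In a five-cycle `a b c d r`, the third edge `b b'` at `b` is not joined to the edge `d r`. -/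
theorem not_adj_of_five_cycle : ∀ a b : PetersenVertex, PetersenGraph.Adj a b →
    ∀ c, PetersenGraph.Adj b c → a ≠ c → ∀ d, PetersenGraph.Adj c d → b ≠ d →
    ∀ r, PetersenGraph.Adj d r → PetersenGraph.Adj r a →
    ∀ b', PetersenGraph.Adj b b' → b' ≠ a → b' ≠ c →
    b ≠ r ∧ ¬ PetersenGraph.Adj b d ∧ ¬ PetersenGraph.Adj b r ∧
      ¬ PetersenGraph.Adj b' d ∧ ¬ PetersenGraph.Adj b' r := by
  decide +kernel

set_option synthInstance.maxHeartbeats 400000 in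
set_option synthInstance.maxSize 4000 in
/-- If two edges are not joined by an edge, then after deleting their endpoints there are two
leaves with the same neighbour. -/
theorem exists_two_leaves : ∀ u u' : PetersenVertex, PetersenGraph.Adj u u' →
    ∀ v, u ≠ v → ¬ PetersenGraph.Adj u v → ¬ PetersenGraph.Adj u' v →
    ∀ v', PetersenGraph.Adj v v' → u ≠ v' → ¬ PetersenGraph.Adj u v' → ¬ PetersenGraph.Adj u' v' →
    ∃ x w, PetersenGraph.Adj x w ∧ w ∉ [u, u', v, v'] ∧
      (∀ y, PetersenGraph.Adj w y → y ∈ [u, u', v, v', x]) ∧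
      ∃ z, PetersenGraph.Adj x z ∧ w ≠ z ∧ z ∉ [u, u', v, v'] ∧
      (∀ y, PetersenGraph.Adj z y → y ∈ [u, u', v, v', x]) := by
  decide +kernel

variable {M : PetersenGraph.Subgraph}

/-- Any two edges of a perfect matching of the Petersen graph are joined by an edge. -/
theorem joined_of_isPerfectMatching (hM : M.IsPerfectMatching) {u u' v v' : PetersenVertex}
    (hu : M.Adj u u') (hv : M.Adj v v') (h1 : u ≠ v) (h2 : u ≠ v') :
    PetersenGraph.Adj u v ∨ PetersenGraph.Adj u v' ∨
      PetersenGraph.Adj u' v ∨ PetersenGraph.Adj u' v' := by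
  by_contra! h
  obtain ⟨x, w, -, hw, hw', z, -, hwz, hz, hz'⟩ := exists_two_leaves u u' hu.adj_sub v h1 h.1
    h.2.2.1 v' hv.adj_sub h2 h.2.1 h.2.2.2
  have partner : ∀ w, w ∉ [u, u', v, v'] →
      (∀ y, PetersenGraph.Adj w y → y ∈ [u, u', v, v', x]) → M.Adj w x := by
    intro w hw hw'
    obtain ⟨y, hy, -⟩ := hM.1 (hM.2 w)
    have := hw' y hy.adj_sub
    simp only [List.mem_cons, List.not_mem_nil, or_false, not_or] at this hw
    rcases this with rfl | rfl | rfl | rfl | rfl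
    · exact absurd (hM.1.eq_of_adj_left hy.symm hu) hw.2.1
    · exact absurd (hM.1.eq_of_adj_left hy.symm hu.symm) hw.1
    · exact absurd (hM.1.eq_of_adj_left hy.symm hv) hw.2.2.2
    · exact absurd (hM.1.eq_of_adj_left hy.symm hv.symm) hw.2.2.1
    · exact hy
  exact hwz (hM.1.eq_of_adj_right (partner w hw hw') (partner z hz hz'))

/-- In a five-cycle `a b c d r` whose edges at `b` are unmatched, the edge `d r` is unmatched. -/
theorem not_matched_of_five_cycle (hM : M.IsPerfectMatching) {a b c d r : PetersenVertex}
    (hab : PetersenGraph.Adj a b) (hbc : PetersenGraph.Adj b c) (hac : a ≠ c)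
    (hcd : PetersenGraph.Adj c d) (hbd : b ≠ d) (hdr : PetersenGraph.Adj d r)
    (hra : PetersenGraph.Adj r a) (mab : ¬ M.Adj a b) (mbc : ¬ M.Adj b c) : ¬ M.Adj d r := by
  intro m
  obtain ⟨b', hb', -⟩ := hM.1 (hM.2 b)
  obtain ⟨hbr, n⟩ := not_adj_of_five_cycle a b hab c hbc hac d hcd hbd r hdr hra b'
    hb'.adj_sub (by rintro rfl; exact mab hb'.symm) (by rintro rfl; exact mbc hb')
  have := joined_of_isPerfectMatching hM hb' m hbd hbr
  tauto

/-- A vertex with two unmatched neighbours has no further unmatched neighbours. -/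
theorem eq_or_eq_of_not_matched (hM : M.IsPerfectMatching) {a x y w : PetersenVertex}
    (hx : PetersenGraph.Adj a x) (hy : PetersenGraph.Adj a y) (hxy : x ≠ y)
    (mx : ¬ M.Adj a x) (my : ¬ M.Adj a y) (hw : PetersenGraph.Adj a w) (mw : ¬ M.Adj a w) :
    w = x ∨ w = y := by
  obtain ⟨a', ha', -⟩ := hM.1 (hM.2 a)
  rcases eq_or_eq_or_eq_of_adj a x hx y hy hxy a' ha'.adj_sub (by rintro rfl; exact mx ha')
    (by rintro rfl; exact my ha') w hw with h | h | rfl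
  · exact Or.inl h
  · exact Or.inr h
  · exact absurd ha' mw

theorem compl2Factor_adj {a b : PetersenVertex} :
    (compl2Factor PetersenGraph M).Adj a b ↔ PetersenGraph.Adj a b ∧ ¬ M.Adj a b := by
  simp [compl2Factor]

/-- Deleting a perfect matching leaves a component with exactly five vertices. -/
theorem exists_component_card_eq_five (hM : M.IsPerfectMatching) :
    ∃ (u : PetersenVertex) (S : Finset PetersenVertex), S.card = 5 ∧
      ∀ w, w ∈ S ↔ (compl2Factor PetersenGraph M).Reachable u w := by
  have extend : ∀ x y, PetersenGraph.Adj x y → ¬ M.Adj x y →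
      ∃ z, PetersenGraph.Adj y z ∧ ¬ M.Adj y z ∧ x ≠ z := by
    intro x y hxy mxy
    obtain ⟨y', hy', hu⟩ := hM.1 (hM.2 y)
    obtain ⟨p, hp, hp', q, hq, hq', hpq⟩ := exists_two_other_neighbors y y' hy'.adj_sub
    by_cases h : x = p
    · exact ⟨q, hq, fun m => hq' (hu q m).symm, h ▸ hpq⟩
    · exact ⟨p, hp, fun m => hp' (hu p m).symm, h⟩
  obtain ⟨b, c, hbc, mbc⟩ : ∃ b c, PetersenGraph.Adj b c ∧ ¬ M.Adj b c := by
    let b : PetersenVertex := ⟨{0, 1}, rfl⟩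
    obtain ⟨b', hb', hu⟩ := hM.1 (hM.2 b)
    obtain ⟨p, hp, hp', -⟩ := exists_two_other_neighbors b b' hb'.adj_sub
    exact ⟨b, p, hp, fun m => hp' (hu p m).symm⟩
  obtain ⟨a, hab, mab, hac⟩ := extend c b hbc.symm fun m => mbc m.symm
  obtain ⟨d, hcd, mcd, hbd⟩ := extend b c hbc mbc
  obtain ⟨r, hdr, hra, nodup⟩ := exists_adj_adj_of_path a b hab.symm c hbc hac.symm d hcd hbd
  have mdr := not_matched_of_five_cycle hM hab.symm hbc hac.symm hcd hbd hdr hra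
    (fun m => mab m.symm) mbc
  have mra : ¬ M.Adj a r := not_matched_of_five_cycle hM hcd.symm hbc.symm hbd.symm hab hac
    hra.symm hdr.symm (fun m => mcd m.symm) (fun m => mbc m.symm)
  have closed : ∀ x ∈ [a, b, c, d, r], ∀ y, (compl2Factor PetersenGraph M).Adj x y →
      y ∈ [a, b, c, d, r] := by
    intro x hx y hxy
    rw [compl2Factor_adj] at hxy
    obtain ⟨hxy, mxy⟩ := hxy
    simp only [List.nodup_cons, List.mem_cons, List.not_mem_nil, or_false, not_or] at nodup hx ⊢
    have key := @eq_or_eq_of_not_matched M hM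
    rcases hx with rfl | rfl | rfl | rfl | rfl
    · have := key hab.symm hra.symm nodup.2.1.2.2 (fun m => mab m.symm) mra hxy mxy
      tauto
    · have := key hab hbc nodup.1.2.1 mab mbc hxy mxy
      tauto
    · have := key hbc.symm hcd nodup.2.1.2.1 (fun m => mbc m.symm) mcd hxy mxy
      tauto
    · have := key hcd.symm hdr nodup.2.2.1.2 (fun m => mcd m.symm) mdr hxy mxy
      tauto
    · have := key hdr.symm hra (Ne.symm nodup.1.2.2.1) (fun m => mdr m.symm)
        (fun m => mra m.symm) hxy mxy
      tauto
  refine ⟨a, [a, b, c, d, r].toFinset, List.toFinset_card_of_nodup nodup, fun w => ?_⟩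
  rw [List.mem_toFinset]
  constructor
  · have rb : (compl2Factor PetersenGraph M).Reachable a b :=
      (compl2Factor_adj.mpr ⟨hab.symm, fun m => mab m.symm⟩).reachable
    have rc := rb.trans (compl2Factor_adj.mpr ⟨hbc, mbc⟩).reachable
    have rd := rc.trans (compl2Factor_adj.mpr ⟨hcd, mcd⟩).reachable
    have rr := rd.trans (compl2Factor_adj.mpr ⟨hdr, mdr⟩).reachable
    simp only [List.mem_cons, List.not_mem_nil, or_false]
    rintro (rfl | rfl | rfl | rfl | rfl)
    exacts [.rfl, rb, rc, rd, rr]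
  · rintro ⟨p⟩
    have walk_closed : ∀ x y, (compl2Factor PetersenGraph M).Walk x y →
        x ∈ [a, b, c, d, r] → y ∈ [a, b, c, d, r] := by
      intro x y p
      induction p with
      | nil => exact id
      | cons h _ ih => exact fun hx => ih (closed _ hx _ h)
    exact walk_closed a w p (by simp)

end PetersenGraph

/-- A nonzero element of the Klein four-group other than `α` has second coordinate `1`. -/
theorem snd_eq_one_of_ne_flowAlpha : ∀ x : K4, x ≠ 0 → x ≠ flowAlpha → x.2 = 1 := by
  unfold flowAlpha; decide

/-- A nonzero element of the Klein four-group other than `β` has first coordinate `1`. -/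
theorem fst_eq_one_of_ne_flowBeta : ∀ x : K4, x ≠ 0 → x ≠ flowBeta → x.1 = 1 := by
  unfold flowBeta; decide

/-- For every perfect matching `M` of the Petersen graph, there is no non-conflicting
nowhere-zero `Z2 × Z2` flow with respect to `M`. -/
theorem stmt_12 (M : PetersenGraph.Subgraph) (hM : M.IsPerfectMatching) :
    ¬ ∃ θ : {s : Finset (Fin 5) // s.card = 2} → K4,
      IsNZFlowWrt PetersenGraph M θ ∧ NonConflicting PetersenGraph M θ := by
  rintro ⟨θ, ⟨hθ, hne, hsum⟩, hnc⟩
  have not_both : (∀ v, θ v ≠ flowAlpha) ∨ ∀ v, θ v ≠ flowBeta := by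
    by_contra! h
    obtain ⟨⟨u, hu⟩, v, hv⟩ := h
    have hαβ : flowAlpha ≠ flowBeta := by unfold flowAlpha flowBeta; decide
    obtain ⟨u', mu, -⟩ := hM.1 (hM.2 u)
    obtain ⟨v', mv, -⟩ := hM.1 (hM.2 v)
    have hu' := (hθ mu).symm.trans hu
    have hv' := (hθ mv).symm.trans hv
    have not_adj : ∀ x y, θ x = flowAlpha → θ y = flowBeta → ¬ PetersenGraph.Adj x y :=
      fun x y hx hy hxy =>
        hnc ⟨x, y, hxy, fun m => hαβ (hx.symm.trans ((hθ m).trans hy)), hx, hy⟩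
    rcases PetersenGraph.joined_of_isPerfectMatching hM mu mv
      (fun h => hαβ (hu.symm.trans ((congrArg θ h).trans hv)))
      (fun h => hαβ (hu.symm.trans ((congrArg θ h).trans hv'))) with h | h | h | h
    · exact not_adj _ _ hu hv h
    · exact not_adj _ _ hu hv' h
    · exact not_adj _ _ hu' hv h
    · exact not_adj _ _ hu' hv' h
  obtain ⟨u, S, hcard, hS⟩ := PetersenGraph.exists_component_card_eq_five hM
  have sum_S : ∑ v ∈ S, θ v = 0 := by
    rw [← hsum u]
    exact Finset.sum_congr (by ext w; simp [hS]) fun _ _ => rfl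
  have h5 : (5 : ZMod 2) ≠ 0 := by decide
  rcases not_both with h | h
  · have := congrArg Prod.snd sum_S
    rw [Prod.snd_sum, Finset.sum_congr rfl fun v _ => snd_eq_one_of_ne_flowAlpha _ (hne v) (h v),
      Finset.sum_const, hcard] at this
    exact h5 (by simpa using this)
  · have := congrArg Prod.fst sum_S
    rw [Prod.fst_sum, Finset.sum_congr rfl fun v _ => fst_eq_one_of_ne_flowBeta _ (hne v) (h v),
      Finset.sum_const, hcard] at this
    exact h5 (by simpa using this)
end

section
/- For every perfect matching M of the Petersen graph and any two distinct edges e, f ∈ M, there is an edge of the Petersen graph not belonging to M that joins an endpoint of e to an endpoint of f. -/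
open scoped Classical

theorem petersenGraph_adj_iff (a b : {s : Finset (Fin 5) // s.card = 2}) :
    PetersenGraph.Adj a b ↔ Disjoint a.1 b.1 := by
  simp only [PetersenGraph, SimpleGraph.fromRel_adj, disjoint_comm (a := b.1), or_self,
    and_iff_right_iff_imp]
  rintro h rfl
  have h0 := a.2
  simp [disjoint_self.mp h] at h0

/-- Outside `{u, v, u', v'}`, the vertex `x` has no neighbour in the Petersen graph but `z`. -/
def OnlyPartner (u v u' v' x z : {s : Finset (Fin 5) // s.card = 2}) : Prop :=
  (x ≠ u ∧ x ≠ v ∧ x ≠ u' ∧ x ≠ v') ∧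
    ∀ w, Disjoint x.1 w.1 → w = u ∨ w = v ∨ w = u' ∨ w = v' ∨ w = z

instance (u v u' v' x z : {s : Finset (Fin 5) // s.card = 2}) :
    Decidable (OnlyPartner u v u' v' x z) := by
  unfold OnlyPartner; infer_instance

set_option synthInstance.maxSize 2000 in
/-- If no edge of the Petersen graph joins the disjoint edges `uv` and `u'v'`, then outside these
edges there are two vertices with the same only possible partner `z`. -/
theorem exists_common_onlyPartner :
    ∀ u v : {s : Finset (Fin 5) // s.card = 2}, Disjoint u.1 v.1 →
    ∀ u', (u' ≠ u ∧ u' ≠ v ∧ ¬ Disjoint u.1 u'.1 ∧ ¬ Disjoint v.1 u'.1) →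
    ∀ v', (Disjoint u'.1 v'.1 ∧ ¬ Disjoint u.1 v'.1 ∧ ¬ Disjoint v.1 v'.1) →
    ∃ x z, OnlyPartner u v u' v' x z ∧ ∃ y, y ≠ x ∧ OnlyPartner u v u' v' y z := by
  decide +kernel

/-- In a perfect matching, a vertex off the matching edges `uv` and `u'v'` whose neighbours lie in
`{u, v, u', v', z}` is matched to `z`. -/
theorem SimpleGraph.Subgraph.IsPerfectMatching.adj_of_forall_adj {V : Type*} {G : SimpleGraph V}
    {M : G.Subgraph} (hM : M.IsPerfectMatching) {u v u' v' x z : V}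
    (he : M.Adj u v) (hf : M.Adj u' v') (hx : x ≠ u ∧ x ≠ v ∧ x ≠ u' ∧ x ≠ v')
    (h : ∀ w, G.Adj x w → w = u ∨ w = v ∨ w = u' ∨ w = v' ∨ w = z) : M.Adj x z := by
  obtain ⟨w, hw⟩ := (hM.1 (hM.2 x)).exists
  rcases h w hw.adj_sub with rfl | rfl | rfl | rfl | rfl
  · exact absurd (hM.1.eq_of_adj_left hw.symm he) hx.2.1
  · exact absurd (hM.1.eq_of_adj_left hw.symm he.symm) hx.1
  · exact absurd (hM.1.eq_of_adj_left hw.symm hf) hx.2.2.2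
  · exact absurd (hM.1.eq_of_adj_left hw.symm hf.symm) hx.2.2.1
  · exact hw

/-- For every perfect matching `M` of the Petersen graph and any two distinct edges
`e = uv` and `f = u'v'` of `M`, there is an edge of the Petersen graph not in `M`
joining an endpoint of `e` to an endpoint of `f`. -/
theorem stmt_13 (M : PetersenGraph.Subgraph) (hM : M.IsPerfectMatching)
    (u v u' v' : {s : Finset (Fin 5) // s.card = 2})
    (he : M.Adj u v) (hf : M.Adj u' v') (hne : s(u, v) ≠ s(u', v')) :
    ∃ a b : {s : Finset (Fin 5) // s.card = 2},
      PetersenGraph.Adj a b ∧ ¬ M.Adj a b ∧ (a = u ∨ a = v) ∧ (b = u' ∨ b = v') := by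
  have hu'u : u' ≠ u := by
    rintro rfl
    exact hne (by rw [hM.1.eq_of_adj_left he hf])
  have hu'v : u' ≠ v := by
    rintro rfl
    exact hne (by rw [hM.1.eq_of_adj_left he.symm hf, Sym2.eq_swap])
  have hv'u : v' ≠ u := by
    rintro rfl
    exact hu'v (hM.1.eq_of_adj_left hf.symm he)
  have hv'v : v' ≠ v := by
    rintro rfl
    exact hu'u (hM.1.eq_of_adj_left hf.symm he.symm)
  have not_adj : ∀ a b, (a = u ∨ a = v) → (b = u' ∨ b = v') → ¬ M.Adj a b := by
    rintro a b (rfl | rfl) hb h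
    · obtain rfl := hM.1.eq_of_adj_left h he
      exact hb.elim hu'v.symm hv'v.symm
    · obtain rfl := hM.1.eq_of_adj_left h he.symm
      exact hb.elim hu'u.symm hv'u.symm
  by_contra hcon
  have far : ∀ a b, (a = u ∨ a = v) → (b = u' ∨ b = v') → ¬ Disjoint a.1 b.1 :=
    fun a b ha hb hd =>
      hcon ⟨a, b, (petersenGraph_adj_iff a b).2 hd, not_adj a b ha hb, ha, hb⟩
  obtain ⟨x, z, ⟨hx, hxz⟩, y, hyx, hy, hyz⟩ := exists_common_onlyPartner u v
    ((petersenGraph_adj_iff u v).1 he.adj_sub) u'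
    ⟨hu'u, hu'v, far u u' (.inl rfl) (.inl rfl), far v u' (.inr rfl) (.inl rfl)⟩ v'
    ⟨(petersenGraph_adj_iff u' v').1 hf.adj_sub, far u v' (.inl rfl) (.inr rfl),
      far v v' (.inr rfl) (.inr rfl)⟩
  simp only [← petersenGraph_adj_iff] at hxz hyz
  exact hyx (hM.1.eq_of_adj_right (hM.adj_of_forall_adj he hf hy hyz)
    (hM.adj_of_forall_adj he hf hx hxz))
end

section
/- For every perfect matching M of the Petersen graph, the complementary 2-factor (the spanning subgraph with edge set E ∖ M) is a disjoint union of two cycles of length 5. -/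
open scoped Classical

/-- The vertices of the Petersen graph drawn as an outer pentagon and an inner pentagram:
`(i, true)` is the `i`-th outer vertex and `(i, false)` is the inner vertex joined to it. -/
def petersenVertex (x : Fin 5 × Bool) : {s : Finset (Fin 5) // s.card = 2} :=
  ⟨if x.2 then {2 * x.1, 2 * x.1 + 1} else {2 * x.1 + 2, 2 * x.1 + 4}, by
    revert x; decide⟩

theorem petersenVertex_bijective : Function.Bijective petersenVertex := by
  constructor
  · intro x y; revert x y; decide
  · intro x; revert x; decide

/-- Adjacency in the drawing of the Petersen graph as a pentagon and a pentagram. -/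
def petersenAdj : Fin 5 × Bool → Fin 5 × Bool → Bool
  | (i, true), (j, true) => j == i + 1 || i == j + 1
  | (i, false), (j, false) => j == i + 2 || i == j + 2
  | (i, _), (j, _) => i == j

theorem petersenGraph_adj_petersenVertex (x y : Fin 5 × Bool) :
    PetersenGraph.Adj (petersenVertex x) (petersenVertex y) ↔ petersenAdj x y = true := by
  rw [PetersenGraph, SimpleGraph.fromRel_adj]
  revert x y
  decide

/-- The six partitions of the Petersen graph into two induced pentagons: outer and inner
vertices for `none`, and for `some k` the pentagon centred at the `k`-th outer vertex
and its complement. -/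
def pentagonSide : Option (Fin 5) → Fin 5 × Bool → Bool
  | none, x => x.2
  | some k, (i, true) => i == k || i == k + 1 || i == k + 4
  | some k, (i, false) => i == k + 1 || i == k + 4

theorem card_petersenAdj_pentagonSide (k : Option (Fin 5)) (x : Fin 5 × Bool) :
    (Finset.univ.filter fun y =>
      petersenAdj x y = true ∧ pentagonSide k x = pentagonSide k y).card = 2 := by
  revert k x; decide

theorem card_pentagonSide_eq (k : Option (Fin 5)) (x : Fin 5 × Bool) :
    (Finset.univ.filter fun y => pentagonSide k x = pentagonSide k y).card = 5 := by
  revert k x; decide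

theorem exists_pentagonSide_ne (k : Option (Fin 5)) :
    ∃ x y, pentagonSide k x ≠ pentagonSide k y := by
  revert k; decide

theorem pentagon_diameter_le_two (k : Option (Fin 5)) (x y : Fin 5 × Bool)
    (h : pentagonSide k x = pentagonSide k y) :
    x = y ∨ petersenAdj x y = true ∨ ∃ z, pentagonSide k x = pentagonSide k z ∧
      petersenAdj x z = true ∧ petersenAdj z y = true := by
  revert k x y; decide

/-- If `a`, `b` are the indicators of the outer and inner edges of a perfect matching, then
the edges of the matching are exactly those crossing one of the six pentagon partitions. -/
theorem exists_pentagonSide_of_indicator (a b : Fin 5 → Bool)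
    (ha : ∀ i, ¬ (a i = true ∧ a (i + 4) = true)) (hb : ∀ i, ¬ (b i = true ∧ b (i + 3) = true))
    (hab : ∀ i, a i = true ∨ a (i + 4) = true ↔ b i = true ∨ b (i + 3) = true) :
    ∃ k, ∀ i, (a i = true ↔ pentagonSide k (i, true) ≠ pentagonSide k (i + 1, true)) ∧
      (b i = true ↔ pentagonSide k (i, false) ≠ pentagonSide k (i + 2, false)) ∧
      (¬ (a i = true ∨ a (i + 4) = true) ↔
        pentagonSide k (i, true) ≠ pentagonSide k (i, false)) := by
  revert a b
  decide

theorem SimpleGraph.Subgraph.IsPerfectMatching.exists_pentagonSide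
    {M : PetersenGraph.Subgraph} (hM : M.IsPerfectMatching) :
    ∃ k, ∀ x y, petersenAdj x y = true →
      (M.Adj (petersenVertex x) (petersenVertex y) ↔ pentagonSide k x ≠ pentagonSide k y) := by
  rw [SimpleGraph.Subgraph.isPerfectMatching_iff] at hM
  have huniq : ∀ x y z, M.Adj (petersenVertex x) (petersenVertex y) →
      M.Adj (petersenVertex x) (petersenVertex z) → y = z := fun x y z h h' =>
    petersenVertex_bijective.1 ((hM _).unique h h')
  have hexists : ∀ x, ∃ y, petersenAdj x y = true ∧
      M.Adj (petersenVertex x) (petersenVertex y) := by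
    intro x
    obtain ⟨w, hw, -⟩ := hM (petersenVertex x)
    obtain ⟨y, rfl⟩ := petersenVertex_bijective.2 w
    exact ⟨y, (petersenGraph_adj_petersenVertex x y).1 hw.adj_sub, hw⟩
  let a : Fin 5 → Prop := fun i => M.Adj (petersenVertex (i, true)) (petersenVertex (i + 1, true))
  let b : Fin 5 → Prop := fun i => M.Adj (petersenVertex (i, false)) (petersenVertex (i + 2, false))
  let c : Fin 5 → Prop := fun i => M.Adj (petersenVertex (i, true)) (petersenVertex (i, false))
  have ha' : ∀ i, M.Adj (petersenVertex (i, true)) (petersenVertex (i + 4, true)) ↔ a (i + 4) := by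
    intro i
    rw [SimpleGraph.Subgraph.adj_comm]
    simp only [a, show i + 4 + 1 = i by revert i; decide]
  have hb' : ∀ i, M.Adj (petersenVertex (i, false)) (petersenVertex (i + 3, false)) ↔
      b (i + 3) := by
    intro i
    rw [SimpleGraph.Subgraph.adj_comm]
    simp only [b, show i + 3 + 2 = i by revert i; decide]
  have houter : ∀ i y, petersenAdj (i, true) y = true →
      y = (i + 1, true) ∨ y = (i + 4, true) ∨ y = (i, false) := by decide
  have hinner : ∀ i y, petersenAdj (i, false) y = true →
      y = (i + 2, false) ∨ y = (i + 3, false) ∨ y = (i, true) := by decide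
  have ha : ∀ i, ¬ (a i ∧ a (i + 4)) := fun i h => by
    have := huniq _ _ _ h.1 ((ha' i).2 h.2)
    revert this; clear h; revert i; decide
  have hb : ∀ i, ¬ (b i ∧ b (i + 3)) := fun i h => by
    have := huniq _ _ _ h.1 ((hb' i).2 h.2)
    revert this; clear h; revert i; decide
  have hac : ∀ i, c i ↔ ¬ (a i ∨ a (i + 4)) := by
    intro i
    constructor
    · rintro h (h' | h')
      · simpa using huniq _ _ _ h h'
      · simpa using huniq _ _ _ h ((ha' i).2 h')
    · intro h
      obtain ⟨y, hy, hM⟩ := hexists (i, true)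
      rcases houter i y hy with rfl | rfl | rfl
      · exact absurd (Or.inl hM) h
      · exact absurd (Or.inr ((ha' i).1 hM)) h
      · exact hM
  have hbc : ∀ i, c i ↔ ¬ (b i ∨ b (i + 3)) := by
    intro i
    constructor
    · rintro h (h' | h')
      · simpa using huniq _ _ _ h.symm h'
      · simpa using huniq _ _ _ h.symm ((hb' i).2 h')
    · intro h
      obtain ⟨y, hy, hM⟩ := hexists (i, false)
      rcases hinner i y hy with rfl | rfl | rfl
      · exact absurd (Or.inl hM) h
      · exact absurd (Or.inr ((hb' i).1 hM)) h
      · exact hM.symm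
  obtain ⟨k, hk⟩ := exists_pentagonSide_of_indicator (fun i => decide (a i)) (fun i => decide (b i))
    (by simpa only [decide_eq_true_eq] using ha) (by simpa only [decide_eq_true_eq] using hb)
    (by simpa only [decide_eq_true_eq] using
      fun i => not_iff_not.1 ((hac i).symm.trans (hbc i)))
  simp only [decide_eq_true_eq, ← hac] at hk
  have hka := fun i => (hk i).1
  have hkb := fun i => (hk i).2.1
  have hkc := fun i => (hk i).2.2
  refine ⟨k, ?_⟩
  rintro ⟨i, _ | _⟩ y hy
  · rcases hinner i y hy with rfl | rfl | rfl
    · exact hkb i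
    · rw [hb', hkb, show i + 3 + 2 = i by revert i; decide, ne_comm]
    · rw [SimpleGraph.Subgraph.adj_comm, ne_comm]
      exact hkc i
  · rcases houter i y hy with rfl | rfl | rfl
    · exact hka i
    · rw [ha', hka, show i + 4 + 1 = i by revert i; decide, ne_comm]
    · exact hkc i

/-- For every perfect matching `M` of the Petersen graph, the complementary 2-factor is a
disjoint union of two cycles of length 5: it is 2-regular, has more than one connected
component, and every connected component has exactly 5 vertices. -/
theorem stmt_14 (M : PetersenGraph.Subgraph) (hM : M.IsPerfectMatching) :
    (compl2Factor PetersenGraph M).IsRegularOfDegree 2 ∧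
    (∃ x y : {s : Finset (Fin 5) // s.card = 2},
      ¬ (compl2Factor PetersenGraph M).Reachable x y) ∧
    (∀ u : {s : Finset (Fin 5) // s.card = 2},
      (Finset.univ.filter
        (fun w => (compl2Factor PetersenGraph M).Reachable u w)).card = 5) := by
  obtain ⟨k, hk⟩ := hM.exists_pentagonSide
  let e := Equiv.ofBijective petersenVertex petersenVertex_bijective
  have hadj : ∀ x y, (compl2Factor PetersenGraph M).Adj (e x) (e y) ↔
      petersenAdj x y = true ∧ pentagonSide k x = pentagonSide k y := by
    intro x y
    rw [compl2Factor, SimpleGraph.deleteEdges_adj, SimpleGraph.Subgraph.mem_edgeSet]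
    simp only [e, Equiv.ofBijective_apply, petersenGraph_adj_petersenVertex]
    refine and_congr_right fun h => ?_
    rw [hk x y h, not_not]
  have hreach : ∀ x y, (compl2Factor PetersenGraph M).Reachable (e x) (e y) ↔
      pentagonSide k x = pentagonSide k y := by
    intro x y
    constructor
    · rintro ⟨p⟩
      suffices ∀ u v, (compl2Factor PetersenGraph M).Walk u v →
          pentagonSide k (e.symm u) = pentagonSide k (e.symm v) by
        simpa using this _ _ p
      intro u v p
      induction p with
      | nil => rfl
      | @cons u v w h p ih =>
        rw [← ih]
        exact ((hadj _ _).1 (by simpa using h)).2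
    · intro h
      rcases pentagon_diameter_le_two k x y h with rfl | hxy | ⟨z, hz, hxz, hzy⟩
      · rfl
      · exact ((hadj x y).2 ⟨hxy, h⟩).reachable
      · exact ((hadj x z).2 ⟨hxz, hz⟩).reachable.trans
          ((hadj z y).2 ⟨hzy, hz.symm.trans h⟩).reachable
  refine ⟨fun u => ?_, ?_, fun u => ?_⟩
  · obtain ⟨x, rfl⟩ := e.surjective u
    rw [← SimpleGraph.card_neighborFinset_eq_degree]
    exact (Finset.card_equiv e fun y => by simp [hadj]).symm.trans
      (card_petersenAdj_pentagonSide k x)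
  · obtain ⟨x, y, h⟩ := exists_pentagonSide_ne k
    exact ⟨e x, e y, fun hr => h ((hreach x y).1 hr)⟩
  · obtain ⟨x, rfl⟩ := e.surjective u
    exact (Finset.card_equiv e fun y => by simp [hreach]).symm.trans (card_pentagonSide_eq k x)
end
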